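/- arXiv:0906.5402 — 2 statements merged into one kernel-verified Lean document; each statement's English description precedes it below -/
import Mathlib

section
/- (Theorem 3, second sequence.) Let ε > 0 and α_n = 1/(log(n+2))^{1+ε} for n ≥ 0. Then for every f ∈ H^∞, the function f*α belongs to 𝔑 (i.e. ‖f*α‖_{H^∞} + Λ(f*α) < ∞), and the Toeplitz operator T_{f*α} is bounded on H^1 and on H^∞. -/
open MeasureTheory Complex Metric Set
open scoped ENNReal

/-- Normalized Lebesgue (arc-length) measure on the unit circle `𝕋 ⊆ ℂ`. -/
noncomputable def circleMeasure : Measure ℂ :=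
  Measure.map (fun θ : ℝ => Complex.exp (θ * Complex.I))
    ((ENNReal.ofReal (2 * Real.pi))⁻¹ • volume.restrict (Set.Ioc 0 (2 * Real.pi)))

/-- `‖f‖_{H^p}^p = sup_{0<r<1} ∫_𝕋 |f(rζ)|^p dm(ζ)`, as a value in `[0,∞]`. -/
noncomputable def hardyNorm (p : ℝ) (f : ℂ → ℂ) : ℝ≥0∞ :=
  ⨆ r ∈ Set.Ioo (0 : ℝ) 1,
    ∫⁻ ζ, ENNReal.ofReal (‖f (↑r * ζ)‖ ^ p) ∂circleMeasure

/-- `‖f‖_{H^∞} = sup_{z ∈ 𝔻} |f(z)|`, as a value in `[0,∞]`. -/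
noncomputable def eSupAbs (f : ℂ → ℂ) : ℝ≥0∞ :=
  ⨆ z ∈ Metric.ball (0 : ℂ) 1, ENNReal.ofReal (‖f z‖)

/-- `g` is the boundary function of `f` : radial limits a.e. on `𝕋`. -/
def IsBoundaryFn (f g : ℂ → ℂ) : Prop :=
  ∀ᵐ ζ ∂circleMeasure,
    Filter.Tendsto (fun r : ℝ => f (↑r * ζ)) (nhdsWithin 1 (Set.Iio 1)) (nhds (g ζ))

/-- `Λ(f) = ess sup_{η ∈ 𝕋} ∫_𝕋 |f*(ζ) - f*(η)|/|ζ - η| dm(ζ)` for a boundary function `f*`. -/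
noncomputable def Lam (g : ℂ → ℂ) : ℝ≥0∞ :=
  essSup (fun η =>
    ∫⁻ ζ, ENNReal.ofReal (‖g ζ - g η‖ / ‖ζ - η‖) ∂circleMeasure)
    circleMeasure

/-- Toeplitz operator: `(T_g h)(z) = ∫_𝕋 conj(g*(ζ)) h*(ζ)/(1 - conj(ζ) z) dm(ζ)`,
given boundary functions `gs = g*`, `hs = h*`. -/
noncomputable def toeplitz (gs hs : ℂ → ℂ) : ℂ → ℂ := fun z =>
  ∫ ζ, (starRingEnd ℂ) (gs ζ) * hs ζ / (1 - (starRingEnd ℂ) ζ * z) ∂circleMeasure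

/-- `f̂(n)`, the `n`-th Taylor coefficient of `f` at `0`. -/
noncomputable def taylorCoeff (f : ℂ → ℂ) (n : ℕ) : ℂ :=
  iteratedDeriv n f 0 / n.factorial

/-- `(f*α)(z) = ∑_{n≥0} f̂(n) α_n z^n`. -/
noncomputable def seqConv (f : ℂ → ℂ) (α : ℕ → ℝ) : ℂ → ℂ := fun z =>
  ∑' n : ℕ, taylorCoeff f n * (α n : ℂ) * z ^ n

/-- Partial sum `S_n(f)(z) = ∑_{k=0}^n f̂(k) z^k`. -/
noncomputable def taylorPartial (f : ℂ → ℂ) (n : ℕ) (z : ℂ) : ℂ :=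
  ∑ k ∈ Finset.range (n + 1), taylorCoeff f k * z ^ k

/-- Cesàro mean `σ_n(f)(z) = (1/(n+1)) ∑_{k=0}^n S_k(f)(z)`. -/
noncomputable def cesaro (f : ℂ → ℂ) (n : ℕ) (z : ℂ) : ℂ :=
  ((n : ℂ) + 1)⁻¹ * ∑ k ∈ Finset.range (n + 1), taylorPartial f k z


instance circleMeasure_prob : IsProbabilityMeasure circleMeasure := by
  have hm : Measurable (fun θ : ℝ => Complex.exp (θ * Complex.I)) := by fun_prop
  constructor
  rw [circleMeasure, Measure.map_apply hm MeasurableSet.univ]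
  simp only [preimage_univ, Measure.smul_apply, Measure.restrict_apply, MeasurableSet.univ,
    univ_inter, Real.volume_Ioc, sub_zero, smul_eq_mul]
  refine ENNReal.inv_mul_cancel ?_ ENNReal.ofReal_ne_top
  simp [Real.pi_pos]

lemma ae_norm_eq_one : ∀ᵐ ζ ∂circleMeasure, ‖ζ‖ = 1 := by
  have hm : Measurable (fun θ : ℝ => Complex.exp (θ * Complex.I)) := by fun_prop
  rw [circleMeasure, ae_map_iff hm.aemeasurable (measurableSet_eq_fun (by fun_prop) (by fun_prop))]
  exact Filter.Eventually.of_forall (fun θ => Complex.norm_exp_ofReal_mul_I θ)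

lemma integral_circleMeasure {F : ℂ → ℂ} (hF : AEStronglyMeasurable F circleMeasure) :
    ∫ ζ, F ζ ∂circleMeasure = Real.circleAverage F 0 1 := by
  have hm : Measurable (fun θ : ℝ => Complex.exp (θ * Complex.I)) := by fun_prop
  rw [circleMeasure, integral_map hm.aemeasurable hF, Real.circleAverage_def,
    integral_smul_measure, intervalIntegral.integral_of_le Real.two_pi_pos.le]
  congr 1
  · rw [ENNReal.toReal_inv, ENNReal.toReal_ofReal Real.two_pi_pos.le]
  · simp [circleMap]

lemma circleMeasure_restrict : circleMeasure.restrict (sphere 0 1) = circleMeasure := by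
  apply Measure.restrict_eq_self_of_ae_mem
  filter_upwards [ae_norm_eq_one] with ζ h
  simpa using h

lemma aesm_of_continuousOn {F : ℂ → ℂ} (hF : ContinuousOn F (sphere 0 1)) :
    AEStronglyMeasurable F circleMeasure := by
  rw [← circleMeasure_restrict]
  exact hF.aestronglyMeasurable (isClosed_sphere).measurableSet

lemma integrable_of_continuousOn {F : ℂ → ℂ} (hF : ContinuousOn F (sphere 0 1)) :
    Integrable F circleMeasure := by
  have := hF.integrableOn_compact (μ := circleMeasure) (isCompact_sphere 0 1)
  rwa [IntegrableOn, circleMeasure_restrict] at this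

lemma integrable_of_continuousOn_real {F : ℂ → ℝ} (hF : ContinuousOn F (sphere 0 1)) :
    Integrable F circleMeasure := by
  have := hF.integrableOn_compact (μ := circleMeasure) (isCompact_sphere 0 1)
  rwa [IntegrableOn, circleMeasure_restrict] at this

/-- Cauchy formula for functions holomorphic on a neighbourhood. -/
lemma cauchy_smooth {h : ℂ → ℂ} (hh : DiffContOnCl ℂ h (ball 0 1)) {z : ℂ} (hz : ‖z‖ < 1) :
    ∫ ζ, h ζ / (1 - (starRingEnd ℂ) ζ * z) ∂circleMeasure = h z := by
  have h1 := DiffContOnCl.circleAverage_smul_div (f := h) (c := 0) (R := 1) (w := z)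
    (by simpa using hh) (by simpa using hz)
  rw [← h1, ← integral_circleMeasure]
  · apply integral_congr_ae
    filter_upwards [ae_norm_eq_one] with ζ hζ
    have h3 : (starRingEnd ℂ) ζ * ζ = 1 := by
      rw [mul_comm, Complex.mul_conj, Complex.normSq_eq_norm_sq, hζ]; simp
    have h0 : ζ ≠ 0 := by rintro rfl; simp at hζ
    have h2 : (1 - (starRingEnd ℂ) ζ * z) * ζ = ζ - z := by linear_combination (-z) * h3
    have h4 : ζ - z ≠ 0 := by
      intro h; rw [sub_eq_zero] at h; rw [← h, hζ] at hz; exact lt_irrefl _ hz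
    have h5 : (1 - (starRingEnd ℂ) ζ * z) ≠ 0 := by
      intro h; rw [h] at h2; simp at h2; exact h4 h2.symm
    simp only [smul_eq_mul, sub_zero]
    rw [← h2]
    field_simp
  · apply aesm_of_continuousOn
    have h4 : ∀ ζ ∈ sphere (0:ℂ) 1, ζ - z ≠ 0 := by
      intro ζ hζ h
      rw [sub_eq_zero] at h; rw [← h] at hz
      simp at hζ; linarith
    have h6 : ContinuousOn h (sphere 0 1) := by
      refine hh.continuousOn.mono ?_
      rw [closure_ball _ one_ne_zero]; exact sphere_subset_closedBall
    simp only [sub_zero]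
    exact (ContinuousOn.div (by fun_prop) (by fun_prop) h4).smul h6

lemma integral_pow_conj_pow (j k : ℕ) :
    ∫ ζ, ζ ^ j * (starRingEnd ℂ) ζ ^ k ∂circleMeasure = if j = k then 1 else 0 := by
  rw [integral_circleMeasure]
  swap
  · apply aesm_of_continuousOn; fun_prop
  split_ifs with h
  · subst h
    rw [Real.circleAverage_congr_sphere (f₂ := fun _ => (1:ℂ))]
    · exact Real.circleAverage_const _ _ _
    · intro ζ hζ
      simp at hζ
      simp only
      rw [← mul_pow, Complex.mul_conj, Complex.normSq_eq_norm_sq, hζ]; simp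
  · rw [Real.circleAverage_def]
    have : (∫ θ in (0:ℝ)..2 * Real.pi,
        circleMap 0 1 θ ^ j * (starRingEnd ℂ) (circleMap 0 1 θ) ^ k) = 
        ∫ θ in (0:ℝ)..2 * Real.pi, Complex.exp ((((j:ℂ) - k) * Complex.I) * θ) := by
      congr 1; ext θ
      simp only [circleMap, Complex.ofReal_one, one_mul, zero_add]
      rw [← Complex.exp_conj, ← Complex.exp_nat_mul, ← Complex.exp_nat_mul, ← Complex.exp_add]
      congr 1
      simp; ring
    rw [this, integral_exp_mul_complex]
    · have : Complex.exp ((((j:ℂ) - k) * Complex.I) * ((2 * Real.pi : ℝ):ℂ)) = 1 := by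
        rw [Complex.exp_eq_one_iff]
        refine ⟨(j:ℤ) - k, ?_⟩
        push_cast; ring
      rw [this]; simp
    · simp only [ne_eq, mul_eq_zero, Complex.I_ne_zero, or_false, sub_eq_zero, Nat.cast_inj]
      exact h

lemma norm_pow_sphere {ζ : ℂ} (h : ‖ζ‖ = 1) (k : ℕ) : ‖ζ ^ k‖ = 1 := by simp [h]

lemma continuousOn_series {a : ℕ → ℂ} (ha : Summable fun k => ‖a k‖) :
    ContinuousOn (fun ζ => ∑' k, a k * ζ ^ k) (sphere 0 1) := by
  refine continuousOn_tsum (fun k => by fun_prop) ha ?_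
  intro k ζ hζ
  simp at hζ
  simp [hζ]

lemma integral_series_mul {a : ℕ → ℂ} (ha : Summable fun k => ‖a k‖) {G : ℂ → ℂ}
    (hG : ContinuousOn G (sphere 0 1)) :
    HasSum (fun k => a k * ∫ ζ, ζ ^ k * G ζ ∂circleMeasure)
      (∫ ζ, (∑' k, a k * ζ ^ k) * G ζ ∂circleMeasure) := by
  have hInt : ∀ k, Integrable (fun ζ : ℂ => a k * (ζ ^ k * G ζ)) circleMeasure := fun k =>
    integrable_of_continuousOn (by fun_prop)
  have hGi : Integrable G circleMeasure := integrable_of_continuousOn hG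
  have h := hasSum_integral_of_summable_integral_norm hInt ?_
  · simp only [integral_const_mul] at h
    have e : (fun ζ => (∑' k, a k * ζ ^ k) * G ζ) = fun ζ => ∑' k, a k * (ζ ^ k * G ζ) := by
      ext ζ
      rw [← tsum_mul_right]
      congr 1; ext k; ring
    rw [e]
    exact h
  · have : ∀ k, ∫ ζ, ‖a k * (ζ ^ k * G ζ)‖ ∂circleMeasure = ‖a k‖ * ∫ ζ, ‖G ζ‖ ∂circleMeasure := by
      intro k
      rw [← integral_const_mul]
      apply integral_congr_ae
      filter_upwards [ae_norm_eq_one] with ζ hζ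
      simp [hζ]
    simp only [this]
    exact ha.mul_right _

lemma coeff_series {a : ℕ → ℂ} (ha : Summable fun k => ‖a k‖) (n : ℕ) :
    ∫ ζ, (∑' k, a k * ζ ^ k) * (starRingEnd ℂ) ζ ^ n ∂circleMeasure = a n := by
  have h := integral_series_mul ha (G := fun ζ => (starRingEnd ℂ) ζ ^ n) (by fun_prop)
  simp only [integral_pow_conj_pow, mul_ite, mul_one, mul_zero] at h
  rw [← h.tsum_eq, tsum_ite_eq]

lemma parseval {a : ℕ → ℂ} (ha : Summable fun k => ‖a k‖) :
    HasSum (fun k => ‖a k‖ ^ 2) (∫ ζ, ‖∑' k, a k * ζ ^ k‖ ^ 2 ∂circleMeasure) := by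
  have hc := continuousOn_series ha
  have h := integral_series_mul ha (G := fun ζ => (starRingEnd ℂ) (∑' k, a k * ζ ^ k))
    (Complex.continuous_conj.comp_continuousOn hc)
  have h2 : ∀ k, ∫ ζ, ζ ^ k * (starRingEnd ℂ) (∑' k, a k * ζ ^ k) ∂circleMeasure
      = (starRingEnd ℂ) (a k) := by
    intro k
    rw [← coeff_series ha k, ← integral_conj]
    congr 1; ext ζ
    simp [mul_comm]
  simp only [h2, Complex.mul_conj, Complex.normSq_eq_norm_sq] at h
  rw [integral_complex_ofReal] at h
  exact_mod_cast h

lemma taylor_hasSum {h : ℂ → ℂ} {R : ℝ} (hh : DifferentiableOn ℂ h (ball 0 R)) {z : ℂ}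
    (hz : ‖z‖ < R) : HasSum (fun n => taylorCoeff h n * z ^ n) (h z) := by
  have := Complex.hasSum_taylorSeries_on_ball hh (z := z) (by simpa using hz)
  have e : (fun n => taylorCoeff h n * z ^ n) =
      fun n : ℕ => ((n.factorial : ℂ))⁻¹ • (z - 0) ^ n • iteratedDeriv n h 0 := by
    ext n
    simp [taylorCoeff]; ring
  rw [e]; exact this

lemma taylor_summable {h : ℂ → ℂ} {R : ℝ} (hh : DifferentiableOn ℂ h (ball 0 R)) {z : ℂ}
    (hz : ‖z‖ < R) : Summable (fun n => ‖taylorCoeff h n‖ * ‖z‖ ^ n) := by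
  have := (taylor_hasSum hh hz).summable.norm
  simpa using this

/-- approximation of real continuous functions on the circle by real parts of polynomials -/
lemma approx_re {φ : ℂ → ℝ} (hφ : ContinuousOn φ (sphere 0 1)) {η : ℝ} (hη : 0 < η) :
    ∃ P : Polynomial ℂ, ∀ ζ : ℂ, ‖ζ‖ = 1 → |(P.eval ζ).re - φ ζ| ≤ η := by
  have : Fact (0 < 2 * Real.pi) := ⟨Real.two_pi_pos⟩
  let Φ : C(AddCircle (2 * Real.pi), ℂ) := 
    ⟨fun x => (φ (AddCircle.toCircle x : ℂ) : ℂ), by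
      refine Complex.continuous_ofReal.comp ?_
      refine hφ.comp_continuous (f := fun x : AddCircle (2 * Real.pi) => (AddCircle.toCircle x : ℂ)) ?_ ?_
      · exact continuous_subtype_val.comp AddCircle.continuous_toCircle
      · intro x; simp [Circle.norm_coe]⟩
  have hmem : Φ ∈ (Submodule.span ℂ (range <| @fourier (2 * Real.pi))).topologicalClosure := by
    rw [span_fourier_closure_eq_top]; trivial
  have hmem' : Φ ∈ closure ((Submodule.span ℂ (range <| @fourier (2 * Real.pi)) : Set _)) := hmem
  rw [Metric.mem_closure_iff] at hmem'
  obtain ⟨b, hb, hd⟩ := hmem' η hη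
  have hb' : ∃ P Q : Polynomial ℂ, ∀ x, b x = P.eval (AddCircle.toCircle x : ℂ) +
      (starRingEnd ℂ) (Q.eval (AddCircle.toCircle x : ℂ)) := by
    refine Submodule.span_induction ?_ ?_ ?_ ?_ hb
    · rintro _ ⟨n, rfl⟩
      obtain ⟨k, rfl | rfl⟩ := n.eq_nat_or_neg
      · refine ⟨Polynomial.X ^ k, 0, fun x => ?_⟩
        simp [fourier_apply, AddCircle.toCircle_nsmul]
      · refine ⟨0, Polynomial.X ^ k, fun x => ?_⟩
        rw [fourier_neg]
        simp [fourier_apply, AddCircle.toCircle_nsmul]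
    · exact ⟨0, 0, fun x => by simp⟩
    · rintro f g _ _ ⟨P, Q, h1⟩ ⟨P', Q', h2⟩
      refine ⟨P + P', Q + Q', fun x => ?_⟩
      simp [h1, h2]; ring
    · rintro c f _ ⟨P, Q, h1⟩
      refine ⟨Polynomial.C c * P, Polynomial.C ((starRingEnd ℂ) c) * Q, fun x => ?_⟩
      simp [h1]; ring
  obtain ⟨P, Q, hPQ⟩ := hb'
  refine ⟨P + Q, fun ζ hζ => ?_⟩
  have hθ : ∃ x : AddCircle (2 * Real.pi), (AddCircle.toCircle x : ℂ) = ζ := by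
    refine ⟨((Complex.arg ζ : ℝ) : AddCircle (2 * Real.pi)), ?_⟩
    rw [AddCircle.toCircle_apply_mk]
    have := Complex.norm_mul_exp_arg_mul_I ζ
    rw [hζ] at this
    simpa using this
  obtain ⟨x, rfl⟩ := hθ
  have h3 : dist (Φ x) (b x) ≤ η := (ContinuousMap.dist_apply_le_dist x).trans hd.le
  rw [dist_comm, Complex.dist_eq] at h3
  refine le_trans ?_ ((Complex.abs_re_le_norm _).trans h3)
  rw [hPQ]
  simp [Φ]

lemma factor_step {h : ℂ → ℂ} {R : ℝ} (hR : 1 < R) (hh : DifferentiableOn ℂ h (ball 0 R)) {A : ℝ}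
    (hA : ∫ ζ, ‖h ζ‖ ∂circleMeasure ≤ A) :
    ∃ F G : ℕ → ℂ, (∀ N, ∑ k ∈ Finset.range N, ‖F k‖ ^ 2 ≤ Real.exp 1 * (A + 1)) ∧
      (∀ N, ∑ k ∈ Finset.range N, ‖G k‖ ^ 2 ≤ Real.exp 1 * (A + 1)) ∧
      ∀ z : ℂ, ‖z‖ < 1 → h z = (∑' k, F k * z ^ k) * (∑' k, G k * z ^ k) := by
  have hsub : sphere (0:ℂ) 1 ⊆ ball 0 R := by
    intro z hz; simp at hz ⊢; linarith
  have hc : ContinuousOn h (sphere 0 1) := hh.continuousOn.mono hsub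
  have hi : Integrable (fun ζ => ‖h ζ‖) circleMeasure := integrable_of_continuousOn_real hc.norm
  obtain ⟨P, hP⟩ := approx_re (φ := fun ζ => Real.log (‖h ζ‖ + 1))
    (ContinuousOn.log (by fun_prop) (fun x _ => by positivity)) one_pos
  let K : ℂ → ℂ := fun z => Complex.exp (P.eval z / 2)
  have hKd : Differentiable ℂ K := by
    have := P.differentiable
    fun_prop
  have hK0 : ∀ z, K z ≠ 0 := fun z => Complex.exp_ne_zero _
  let F : ℂ → ℂ := fun z => h z / K z
  have hFd : DifferentiableOn ℂ F (ball 0 R) := hh.div hKd.differentiableOn (fun z _ => hK0 z)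
  have hKd' : DifferentiableOn ℂ K (ball 0 R) := hKd.differentiableOn
  have hKsq : ∀ z, ‖K z‖ ^ 2 = Real.exp (P.eval z).re := by
    intro z
    rw [Complex.norm_exp, ← Real.exp_nat_mul]
    congr 1
    rw [show P.eval z / 2 = P.eval z / ((2:ℝ):ℂ) by simp, Complex.div_ofReal_re]
    push_cast; ring
  have hlog : ∀ ζ, Real.exp (Real.log (‖h ζ‖ + 1)) = ‖h ζ‖ + 1 := fun ζ =>
    Real.exp_log (by positivity)
  have hKu : ∀ ζ : ℂ, ‖ζ‖ = 1 → ‖K ζ‖ ^ 2 ≤ Real.exp 1 * (‖h ζ‖ + 1) := by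
    intro ζ hζ
    rw [hKsq, ← hlog ζ, ← Real.exp_add]
    have := abs_le.1 (hP ζ hζ)
    exact Real.exp_le_exp.2 (by linarith [this.2])
  have hKl : ∀ ζ : ℂ, ‖ζ‖ = 1 → ‖h ζ‖ + 1 ≤ Real.exp 1 * ‖K ζ‖ ^ 2 := by
    intro ζ hζ
    rw [hKsq, ← hlog ζ, ← Real.exp_add]
    have := abs_le.1 (hP ζ hζ)
    exact Real.exp_le_exp.2 (by linarith [this.1])
  have hFu : ∀ ζ : ℂ, ‖ζ‖ = 1 → ‖F ζ‖ ^ 2 ≤ Real.exp 1 * (‖h ζ‖ + 1) := by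
    intro ζ hζ
    have h1 := hKl ζ hζ
    have h2 : 0 < ‖K ζ‖ := norm_pos_iff.2 (hK0 ζ)
    simp only [F]
    rw [norm_div, div_pow, div_le_iff₀ (by positivity)]
    have h3 := norm_nonneg (h ζ)
    nlinarith
  have key : ∀ U : ℂ → ℂ, DifferentiableOn ℂ U (ball 0 R) →
      (∀ ζ : ℂ, ‖ζ‖ = 1 → ‖U ζ‖ ^ 2 ≤ Real.exp 1 * (‖h ζ‖ + 1)) → 
      ∀ N, ∑ k ∈ Finset.range N, ‖taylorCoeff U k‖ ^ 2 ≤ Real.exp 1 * (A + 1) := by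
    intro U hU hUb N
    have hs : Summable fun k => ‖taylorCoeff U k‖ := by
      simpa using taylor_summable hU (z := 1) (by simpa using hR)
    have hp := parseval hs
    refine (sum_le_hasSum _ (fun _ _ => by positivity) hp).trans ?_
    calc ∫ ζ, ‖∑' k, taylorCoeff U k * ζ ^ k‖ ^ 2 ∂circleMeasure 
        ≤ ∫ ζ, Real.exp 1 * (‖h ζ‖ + 1) ∂circleMeasure := by
          apply integral_mono_ae
          · exact integrable_of_continuousOn_real ((continuousOn_series hs).norm.pow 2)
          · exact (hi.add (integrable_const _)).const_mul _
          · filter_upwards [ae_norm_eq_one] with ζ hζ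
            rw [(taylor_hasSum hU (z := ζ) (by linarith)).tsum_eq]
            exact hUb ζ hζ
      _ ≤ _ := by
          rw [integral_const_mul, integral_add hi (integrable_const _)]
          simp only [integral_const, probReal_univ, smul_eq_mul, mul_one]
          exact mul_le_mul_of_nonneg_left (by linarith) (Real.exp_pos 1).le
  refine ⟨taylorCoeff F, taylorCoeff K, key F hFd hFu, key K hKd' hKu, fun z hz => ?_⟩
  rw [(taylor_hasSum hFd (z := z) (by linarith)).tsum_eq,
    (taylor_hasSum hKd' (z := z) (by linarith)).tsum_eq]
  simp only [F]
  rw [div_mul_cancel₀ _ (hK0 z)]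

lemma summable_coeff_pow {F : ℕ → ℂ} {B : ℝ} (hF : ∀ k, ‖F k‖ ≤ B) {r : ℝ} (h0 : 0 ≤ r) (hr : r < 1) :
    Summable fun k => ‖F k‖ * r ^ k :=
  Summable.of_nonneg_of_le (fun k => by positivity)
    (fun k => mul_le_mul_of_nonneg_right (hF k) (by positivity))
    ((summable_geometric_of_lt_one h0 hr).mul_left B)

lemma tendsto_series {F : ℕ → ℕ → ℂ} {F₀ : ℕ → ℂ} {B : ℝ} (hF : ∀ j k, ‖F j k‖ ≤ B)
    (hl : Filter.Tendsto F Filter.atTop (nhds F₀)) {z : ℂ} (hz : ‖z‖ < 1) :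
    Filter.Tendsto (fun j => ∑' k, F j k * z ^ k) Filter.atTop (nhds (∑' k, F₀ k * z ^ k)) := by
  refine tendsto_tsum_of_dominated_convergence (bound := fun k => B * ‖z‖ ^ k)
    ((summable_geometric_of_lt_one (norm_nonneg z) hz).mul_left B) ?_ ?_
  · intro k
    exact ((tendsto_pi_nhds.1 hl) k).mul_const _
  · refine Filter.Eventually.of_forall fun j k => ?_
    rw [norm_mul, norm_pow]
    exact mul_le_mul_of_nonneg_right (hF j k) (by positivity)

lemma factor_limit {h : ℂ → ℂ} (hh : DifferentiableOn ℂ h (ball 0 1)) {A : ℝ}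
    (hA : ∀ r ∈ Ioo (0:ℝ) 1, ∫ ζ, ‖h (r * ζ)‖ ∂circleMeasure ≤ A) :
    ∃ F G : ℕ → ℂ, Summable (fun k => ‖F k‖ ^ 2) ∧ Summable (fun k => ‖G k‖ ^ 2) ∧
      ∀ z : ℂ, ‖z‖ < 1 → h z = (∑' k, F k * z ^ k) * (∑' k, G k * z ^ k) := by
  let r : ℕ → ℝ := fun n => 1 - 1 / ((n:ℝ) + 2)
  have hr : ∀ n, r n ∈ Ioo (0:ℝ) 1 := by
    intro n
    have : 1 / ((n:ℝ) + 2) < 1 := by rw [div_lt_one (by positivity)]; linarith [(Nat.cast_nonneg n : (0:ℝ) ≤ n)]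
    have h2 : 0 < 1 / ((n:ℝ) + 2) := by positivity
    exact ⟨by simp only [r]; linarith, by simp only [r]; linarith⟩
  have hr1 : Filter.Tendsto r Filter.atTop (nhds 1) := by
    have h1 : Filter.Tendsto (fun n : ℕ => 1 / ((n:ℝ) + 2)) Filter.atTop (nhds 0) := by
      have := (tendsto_one_div_add_atTop_nhds_zero_nat (𝕜 := ℝ)).comp (Filter.tendsto_add_atTop_nat 1)
      refine this.congr fun n => ?_
      simp only [Function.comp]; push_cast; ring
    simpa [r] using (tendsto_const_nhds (x := (1:ℝ))).sub h1
  have step : ∀ n, ∃ FG : (ℕ → ℂ) × (ℕ → ℂ), 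
      (∀ N, ∑ k ∈ Finset.range N, ‖FG.1 k‖ ^ 2 ≤ Real.exp 1 * (A + 1)) ∧
      (∀ N, ∑ k ∈ Finset.range N, ‖FG.2 k‖ ^ 2 ≤ Real.exp 1 * (A + 1)) ∧
      ∀ z : ℂ, ‖z‖ < 1 → h (r n * z) = (∑' k, FG.1 k * z ^ k) * (∑' k, FG.2 k * z ^ k) := by
    intro n
    have hrn := hr n
    have hd : DifferentiableOn ℂ (fun z => h (r n * z)) (ball 0 (1 / r n)) := by
      refine hh.comp (by fun_prop) ?_
      intro z hz
      simp only [mem_ball_zero_iff, norm_mul, Complex.norm_real, Real.norm_eq_abs, abs_of_pos hrn.1] at hz ⊢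
      rw [lt_div_iff₀ hrn.1] at hz
      linarith
    obtain ⟨F, G, h1, h2, h3⟩ := factor_step (one_lt_one_div hrn.1 hrn.2) hd (hA _ hrn)
    exact ⟨(F, G), h1, h2, h3⟩
  choose FG hF hG hFG using step
  set B := Real.exp 1 * (A + 1) with hB
  have hbd : ∀ a : ℕ → ℂ, (∀ N, ∑ k ∈ Finset.range N, ‖a k‖ ^ 2 ≤ B) → ∀ k, ‖a k‖ ≤ B + 1 := by
    intro a ha k
    have h1 : ‖a k‖ ^ 2 ≤ B := (Finset.single_le_sum (f := fun k => ‖a k‖ ^ 2) (fun _ _ => by positivity)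
      (Finset.self_mem_range_succ k)).trans (ha (k+1))
    nlinarith [sq_nonneg (‖a k‖ - 1), norm_nonneg (a k)]
  have hcomp : IsCompact (Set.univ.pi fun _ : ℕ => closedBall (0:ℂ) (B+1)) :=
    isCompact_univ_pi fun _ => isCompact_closedBall _ _
  obtain ⟨L, -, φ, hφ, hL⟩ := (hcomp.prod hcomp).tendsto_subseq (x := FG) (by
    intro n
    refine ⟨fun k _ => ?_, fun k _ => ?_⟩
    · simpa using hbd _ (hF n) k
    · simpa using hbd _ (hG n) k)
  have hL1 : Filter.Tendsto (fun j => (FG (φ j)).1) Filter.atTop (nhds L.1) :=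
    (continuous_fst.tendsto _).comp hL
  have hL2 : Filter.Tendsto (fun j => (FG (φ j)).2) Filter.atTop (nhds L.2) :=
    (continuous_snd.tendsto _).comp hL
  have hsum : ∀ (a : ℕ → ℕ → ℂ) (b : ℕ → ℂ), Filter.Tendsto a Filter.atTop (nhds b) → 
      (∀ j N, ∑ k ∈ Finset.range N, ‖a j k‖ ^ 2 ≤ B) → Summable fun k => ‖b k‖ ^ 2 := by
    intro a b hab ha
    refine summable_of_sum_range_le (c := B) (fun _ => by positivity) fun N => ?_
    refine le_of_tendsto (f := fun j => ∑ k ∈ Finset.range N, ‖a j k‖ ^ 2) (x := Filter.atTop) ?_ 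
      (Filter.Eventually.of_forall fun j => ha j N)
    exact tendsto_finsetSum _ fun k _ => (((tendsto_pi_nhds.1 hab) k).norm).pow 2
  refine ⟨L.1, L.2, hsum _ _ hL1 (fun j => hF _), hsum _ _ hL2 (fun j => hG _), fun z hz => ?_⟩
  have t1 := tendsto_series (fun j => hbd _ (hF (φ j))) hL1 hz
  have t2 := tendsto_series (fun j => hbd _ (hG (φ j))) hL2 hz
  have t3 := t1.mul t2
  have hcz : ContinuousAt h z := (hh.differentiableAt (isOpen_ball.mem_nhds (by simpa using hz))).continuousAt
  have t4 : Filter.Tendsto (fun j => h (r (φ j) * z)) Filter.atTop (nhds (h z)) := by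
    refine hcz.tendsto.comp ?_
    have : Filter.Tendsto (fun j => ((r (φ j) : ℝ) : ℂ) * z) Filter.atTop (nhds (((1:ℝ):ℂ) * z)) :=
      ((Complex.continuous_ofReal.tendsto _).comp (hr1.comp hφ.tendsto_atTop)).mul_const _
    simpa using this
  refine tendsto_nhds_unique t4 (t3.congr fun j => ?_)
  exact (hFG (φ j) z hz).symm

lemma continuousOn_dilate {h : ℂ → ℂ} (hh : DifferentiableOn ℂ h (ball 0 1)) {r : ℝ}
    (hr : r ∈ Ioo (0:ℝ) 1) : ContinuousOn (fun ζ : ℂ => h (r * ζ)) (sphere 0 1) := by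
  refine hh.continuousOn.comp (by fun_prop) ?_
  intro z hz
  simp only [mem_sphere_zero_iff_norm] at hz
  simp only [mem_ball_zero_iff, norm_mul, Complex.norm_real, Real.norm_eq_abs, abs_of_pos hr.1, hz]
  linarith [hr.2]

/-- the `L²` modulus of convergence -/
lemma parseval_diff {F : ℕ → ℂ} (hF : Summable fun k => ‖F k‖ ^ 2) {r s : ℝ}
    (hr : r ∈ Ioo (0:ℝ) 1) (hs : s ∈ Ioo (0:ℝ) 1) (hrs : r ≤ s) :
    ∫ ζ, ‖(∑' k, F k * (r * ζ) ^ k) - ∑' k, F k * (s * ζ) ^ k‖ ^ 2 ∂circleMeasure ≤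
      ∑' k, ‖F k‖ ^ 2 * (1 - r ^ k) ^ 2 := by
  obtain ⟨B, hB⟩ : ∃ B, ∀ k, ‖F k‖ ≤ B := by
    refine ⟨∑' k, ‖F k‖ ^ 2 + 1, fun k => ?_⟩
    have := hF.le_tsum k (fun _ _ => by positivity)
    nlinarith [sq_nonneg (‖F k‖ - 1), norm_nonneg (F k)]
  have hsr : Summable fun k => ‖F k * (r:ℂ) ^ k‖ := by
    simpa [abs_of_pos hr.1] using summable_coeff_pow hB hr.1.le hr.2
  have hss : Summable fun k => ‖F k * (s:ℂ) ^ k‖ := by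
    simpa [abs_of_pos hs.1] using summable_coeff_pow hB hs.1.le hs.2
  have hsd : Summable fun k => ‖F k * (r:ℂ) ^ k - F k * (s:ℂ) ^ k‖ :=
    Summable.of_nonneg_of_le (fun _ => norm_nonneg _) (fun _ => norm_sub_le _ _) (hsr.add hss)
  have hp := parseval hsd
  have e : ∫ ζ, ‖(∑' k, F k * (r * ζ) ^ k) - ∑' k, F k * (s * ζ) ^ k‖ ^ 2 ∂circleMeasure = 
      ∫ ζ, ‖∑' k, (F k * (r:ℂ) ^ k - F k * (s:ℂ) ^ k) * ζ ^ k‖ ^ 2 ∂circleMeasure := by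
    apply integral_congr_ae
    filter_upwards [ae_norm_eq_one] with ζ hζ
    have s1 : Summable fun k => F k * (r:ℂ) ^ k * ζ ^ k := by
      refine Summable.of_norm ?_
      simpa [hζ] using hsr
    have s2 : Summable fun k => F k * (s:ℂ) ^ k * ζ ^ k := by
      refine Summable.of_norm ?_
      simpa [hζ] using hss
    congr 2
    simp only [mul_pow, ← mul_assoc, sub_mul]
    rw [s1.tsum_sub s2]
  rw [e, ← hp.tsum_eq]
  have hb : ∀ k, ‖F k * (r:ℂ) ^ k - F k * (s:ℂ) ^ k‖ ^ 2 ≤ ‖F k‖ ^ 2 * (1 - r ^ k) ^ 2 := by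
    intro k
    rw [← mul_sub, norm_mul, mul_pow, ← Complex.ofReal_pow, ← Complex.ofReal_pow, 
      ← Complex.ofReal_sub, Complex.norm_real, Real.norm_eq_abs, sq_abs]
    refine mul_le_mul_of_nonneg_left ?_ (by positivity)
    have h1 : r ^ k ≤ s ^ k := pow_le_pow_left₀ hr.1.le hrs k
    have h2 : s ^ k ≤ 1 := pow_le_one₀ hs.1.le hs.2.le
    nlinarith
  refine hp.summable.tsum_le_tsum hb ?_
  refine Summable.of_nonneg_of_le (fun _ => by positivity) (fun k => ?_) hF
  have h1 : r ^ k ≤ 1 := pow_le_one₀ hr.1.le hr.2.le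
  have h2 : 0 ≤ r ^ k := pow_nonneg hr.1.le k
  have h3 : (1 - r ^ k) ^ 2 ≤ 1 := by nlinarith
  exact mul_le_of_le_one_right (by positivity) h3

lemma parseval_le {F : ℕ → ℂ} (hF : Summable fun k => ‖F k‖ ^ 2) {r : ℝ}
    (hr : r ∈ Ioo (0:ℝ) 1) :
    ∫ ζ, ‖(∑' k, F k * (r * ζ) ^ k)‖ ^ 2 ∂circleMeasure ≤ ∑' k, ‖F k‖ ^ 2 := by
  obtain ⟨B, hB⟩ : ∃ B, ∀ k, ‖F k‖ ≤ B := by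
    refine ⟨∑' k, ‖F k‖ ^ 2 + 1, fun k => ?_⟩
    have := hF.le_tsum k (fun _ _ => by positivity)
    nlinarith [sq_nonneg (‖F k‖ - 1), norm_nonneg (F k)]
  have hsr : Summable fun k => ‖F k * (r:ℂ) ^ k‖ := by
    simpa [abs_of_pos hr.1] using summable_coeff_pow hB hr.1.le hr.2
  have hp := parseval hsr
  simp only [mul_pow, ← mul_assoc]
  rw [← hp.tsum_eq]
  refine hp.summable.tsum_le_tsum (fun k => ?_) hF
  have h1 : r ^ k ≤ 1 := pow_le_one₀ hr.1.le hr.2.le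
  have h2 : 0 ≤ r ^ k := pow_nonneg hr.1.le k
  have h3 : (r ^ k) ^ 2 ≤ 1 := by nlinarith
  rw [norm_mul, mul_pow, norm_pow, Complex.norm_real, Real.norm_eq_abs, abs_of_pos hr.1]
  exact mul_le_of_le_one_right (by positivity) h3

lemma modulus_tendsto {F : ℕ → ℂ} (hF : Summable fun k => ‖F k‖ ^ 2) :
    Filter.Tendsto (fun r : ℝ => ∑' k, ‖F k‖ ^ 2 * (1 - r ^ k) ^ 2) (nhdsWithin 1 (Iio 1)) (nhds 0) := by
  have : Filter.Tendsto (fun r : ℝ => ∑' k, ‖F k‖ ^ 2 * (1 - r ^ k) ^ 2) (nhdsWithin 1 (Iio 1))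
      (nhds (∑' k, ‖F k‖ ^ 2 * (1 - 1 ^ k) ^ 2)) := by
    refine tendsto_tsum_of_dominated_convergence hF ?_ ?_
    · intro k
      refine Filter.Tendsto.mono_left ?_ nhdsWithin_le_nhds
      have : Continuous fun r : ℝ => ‖F k‖ ^ 2 * (1 - r ^ k) ^ 2 := by fun_prop
      exact this.tendsto 1
    · filter_upwards [Ioo_mem_nhdsLT (zero_lt_one (α := ℝ))] with r hr k
      have h1 : r ^ k ≤ 1 := pow_le_one₀ hr.1.le hr.2.le
      have h2 : 0 ≤ r ^ k := pow_nonneg hr.1.le k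
      have h3 : (1 - r ^ k) ^ 2 ≤ 1 := by nlinarith
      rw [Real.norm_of_nonneg (by positivity)]
      exact mul_le_of_le_one_right (by positivity) h3
  simpa using this

lemma continuousOn_series_dilate {F : ℕ → ℂ} (hF : Summable fun k => ‖F k‖ ^ 2) {r : ℝ}
    (hr : r ∈ Ioo (0:ℝ) 1) : ContinuousOn (fun ζ : ℂ => ∑' k, F k * (r * ζ) ^ k) (sphere 0 1) := by
  obtain ⟨B, hB⟩ : ∃ B, ∀ k, ‖F k‖ ≤ B := by
    refine ⟨∑' k, ‖F k‖ ^ 2 + 1, fun k => ?_⟩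
    have := hF.le_tsum k (fun _ _ => by positivity)
    nlinarith [sq_nonneg (‖F k‖ - 1), norm_nonneg (F k)]
  have hsr : Summable fun k => ‖F k * (r:ℂ) ^ k‖ := by
    simpa [abs_of_pos hr.1] using summable_coeff_pow hB hr.1.le hr.2
  simp only [mul_pow, ← mul_assoc]
  exact continuousOn_series hsr

/-- dilates of an `H¹` function form a Cauchy family in `L¹`. -/
lemma h1_cauchy {h : ℂ → ℂ} (hh : DifferentiableOn ℂ h (ball 0 1)) {A : ℝ}
    (hA : ∀ r ∈ Ioo (0:ℝ) 1, ∫ ζ, ‖h (r * ζ)‖ ∂circleMeasure ≤ A) {δ : ℝ} (hδ : 0 < δ) :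
    ∀ᶠ r in nhdsWithin (1:ℝ) (Iio 1), ∀ s : ℝ, s ∈ Ico r 1 →
      ∫ ζ, ‖h (r * ζ) - h (s * ζ)‖ ∂circleMeasure ≤ δ := by
  obtain ⟨F, G, hF, hG, hFG⟩ := factor_limit hh hA
  set SF := ∑' k, ‖F k‖ ^ 2
  set SG := ∑' k, ‖G k‖ ^ 2
  have hSF : 0 ≤ SF := tsum_nonneg fun _ => by positivity
  have hSG : 0 ≤ SG := tsum_nonneg fun _ => by positivity
  let lam : ℝ := δ / (SF + SG + 1)
  have hlam : 0 < lam := by positivity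
  have hlamS : lam * (SF + SG) ≤ δ := by
    simp only [lam]
    rw [div_mul_eq_mul_div, div_le_iff₀ (by positivity)]
    nlinarith
  have t := (modulus_tendsto hF).add (modulus_tendsto hG)
  rw [add_zero] at t
  have ev := t.eventually_lt_const (u := lam * δ) (by positivity)
  filter_upwards [ev, Ioo_mem_nhdsLT (zero_lt_one (α := ℝ))] with r hr hr01 s hs
  have hs01 : s ∈ Ioo (0:ℝ) 1 := ⟨hr01.1.trans_le hs.1, hs.2⟩
  set Fr : ℂ → ℂ := fun ζ => ∑' k, F k * (r * ζ) ^ k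
  set Fs : ℂ → ℂ := fun ζ => ∑' k, F k * (s * ζ) ^ k
  set Gr : ℂ → ℂ := fun ζ => ∑' k, G k * (r * ζ) ^ k
  set Gs : ℂ → ℂ := fun ζ => ∑' k, G k * (s * ζ) ^ k
  have cFr : ContinuousOn Fr (sphere 0 1) := continuousOn_series_dilate hF hr01
  have cFs : ContinuousOn Fs (sphere 0 1) := continuousOn_series_dilate hF hs01
  have cGr : ContinuousOn Gr (sphere 0 1) := continuousOn_series_dilate hG hr01
  have cGs : ContinuousOn Gs (sphere 0 1) := continuousOn_series_dilate hG hs01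
  have i1 : Integrable (fun ζ => ‖Fr ζ‖ ^ 2) circleMeasure := integrable_of_continuousOn_real (by fun_prop)
  have i2 : Integrable (fun ζ => ‖Gs ζ‖ ^ 2) circleMeasure := integrable_of_continuousOn_real (by fun_prop)
  have i3 : Integrable (fun ζ => ‖Fr ζ - Fs ζ‖ ^ 2) circleMeasure := integrable_of_continuousOn_real (by fun_prop)
  have i4 : Integrable (fun ζ => ‖Gr ζ - Gs ζ‖ ^ 2) circleMeasure := integrable_of_continuousOn_real (by fun_prop)
  have b1 : ∫ ζ, ‖Fr ζ‖ ^ 2 ∂circleMeasure ≤ SF := parseval_le hF hr01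
  have b2 : ∫ ζ, ‖Gs ζ‖ ^ 2 ∂circleMeasure ≤ SG := parseval_le hG hs01
  have b3 := parseval_diff hF hr01 hs01 hs.1
  have b4 := parseval_diff hG hr01 hs01 hs.1
  have nz : ∀ ζ : ℂ, ‖ζ‖ = 1 → ∀ t ∈ Ioo (0:ℝ) 1, ‖(t:ℂ) * ζ‖ < 1 := by
    intro ζ hζ t ht
    simp [hζ, abs_of_pos ht.1, ht.2]
  calc ∫ ζ, ‖h (r * ζ) - h (s * ζ)‖ ∂circleMeasure 
      ≤ ∫ ζ, ((lam / 2) * (‖Fr ζ‖ ^ 2 + ‖Gs ζ‖ ^ 2) + (1 / (2 * lam)) * (‖Fr ζ - Fs ζ‖ ^ 2 + ‖Gr ζ - Gs ζ‖ ^ 2)) ∂circleMeasure := by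
        apply integral_mono_ae
        · exact integrable_of_continuousOn_real
            ((continuousOn_dilate hh hr01).sub (continuousOn_dilate hh hs01)).norm
        · exact ((i1.add i2).const_mul _).add ((i3.add i4).const_mul _)
        · filter_upwards [ae_norm_eq_one] with ζ hζ
          rw [hFG _ (nz ζ hζ r hr01), hFG _ (nz ζ hζ s hs01)]
          change ‖Fr ζ * Gr ζ - Fs ζ * Gs ζ‖ ≤ _
          have e : Fr ζ * Gr ζ - Fs ζ * Gs ζ = Fr ζ * (Gr ζ - Gs ζ) + Gs ζ * (Fr ζ - Fs ζ) := by ring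
          rw [e]
          refine (norm_add_le _ _).trans ?_
          rw [norm_mul, norm_mul]
          have amgm : ∀ a b : ℝ, a * b ≤ lam / 2 * a ^ 2 + 1 / (2 * lam) * b ^ 2 := by
            intro a b
            have : lam / 2 * a ^ 2 + 1 / (2 * lam) * b ^ 2 - a * b = (lam * a - b) ^ 2 / (2 * lam) := by
              field_simp; ring
            have h2 : 0 ≤ (lam * a - b) ^ 2 / (2 * lam) := by positivity
            linarith
          have := amgm ‖Fr ζ‖ ‖Gr ζ - Gs ζ‖
          have := amgm ‖Gs ζ‖ ‖Fr ζ - Fs ζ‖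
          linarith
    _ = (lam / 2) * (∫ ζ, ‖Fr ζ‖ ^ 2 ∂circleMeasure + ∫ ζ, ‖Gs ζ‖ ^ 2 ∂circleMeasure) + 
        (1 / (2 * lam)) * (∫ ζ, ‖Fr ζ - Fs ζ‖ ^ 2 ∂circleMeasure + ∫ ζ, ‖Gr ζ - Gs ζ‖ ^ 2 ∂circleMeasure) := by
        have j1 : Integrable (fun ζ => (lam / 2) * (‖Fr ζ‖ ^ 2 + ‖Gs ζ‖ ^ 2)) circleMeasure :=
          (i1.add i2).const_mul _
        have j2 : Integrable (fun ζ => (1 / (2 * lam)) * (‖Fr ζ - Fs ζ‖ ^ 2 + ‖Gr ζ - Gs ζ‖ ^ 2))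
            circleMeasure := (i3.add i4).const_mul _
        rw [integral_add j1 j2, integral_const_mul,
          integral_const_mul, integral_add i1 i2, integral_add i3 i4]
    _ ≤ (lam / 2) * (SF + SG) + (1 / (2 * lam)) * (lam * δ) := by
        refine add_le_add (mul_le_mul_of_nonneg_left (add_le_add b1 b2) (by positivity))
          (mul_le_mul_of_nonneg_left ((add_le_add b3 b4).trans hr.le) (by positivity))
    _ ≤ δ := by
        have : (1 / (2 * lam)) * (lam * δ) = δ / 2 := by field_simp
        rw [this]; linarith

/-- the radii tending to one -/
noncomputable def rad (n : ℕ) : ℝ := 1 - 1 / ((n:ℝ) + 2)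

lemma rad_mem (n : ℕ) : rad n ∈ Ioo (0:ℝ) 1 := by
  have : 1 / ((n:ℝ) + 2) < 1 := by
    rw [div_lt_one (by positivity)]; linarith [(Nat.cast_nonneg n : (0:ℝ) ≤ n)]
  have h2 : 0 < 1 / ((n:ℝ) + 2) := by positivity
  exact ⟨by simp only [rad]; linarith, by simp only [rad]; linarith⟩

lemma rad_tendsto : Filter.Tendsto rad Filter.atTop (nhdsWithin 1 (Iio 1)) := by
  refine tendsto_nhdsWithin_iff.2 ⟨?_, Filter.Eventually.of_forall fun n => (rad_mem n).2⟩
  have h1 : Filter.Tendsto (fun n : ℕ => 1 / ((n:ℝ) + 2)) Filter.atTop (nhds 0) := by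
    have := (tendsto_one_div_add_atTop_nhds_zero_nat (𝕜 := ℝ)).comp (Filter.tendsto_add_atTop_nat 1)
    refine this.congr fun n => ?_
    simp only [Function.comp]; push_cast; ring
  have h2 := (tendsto_const_nhds (x := (1:ℝ))).sub h1
  rw [sub_zero] at h2
  exact h2

lemma aesm_dilate {h : ℂ → ℂ} (hh : DifferentiableOn ℂ h (ball 0 1)) {r : ℝ}
    (hr : r ∈ Ioo (0:ℝ) 1) : AEStronglyMeasurable (fun ζ : ℂ => h (r * ζ)) circleMeasure :=
  aesm_of_continuousOn (continuousOn_dilate hh hr)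

lemma aesm_boundary {h hs : ℂ → ℂ} (hh : DifferentiableOn ℂ h (ball 0 1)) (hb : IsBoundaryFn h hs) :
    AEStronglyMeasurable hs circleMeasure := by
  refine aestronglyMeasurable_of_tendsto_ae Filter.atTop (fun n => aesm_dilate hh (rad_mem n)) ?_
  filter_upwards [hb] with ζ hζ
  exact hζ.comp rad_tendsto

lemma cauchy_dilate {h : ℂ → ℂ} (hh : DifferentiableOn ℂ h (ball 0 1)) {r : ℝ}
    (hr : r ∈ Ioo (0:ℝ) 1) {z : ℂ} (hz : ‖z‖ < 1) :
    ∫ ζ, h (r * ζ) / (1 - (starRingEnd ℂ) ζ * z) ∂circleMeasure = h (r * z) := by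
  refine cauchy_smooth (h := fun ζ => h (r * ζ)) ?_ hz
  have : DifferentiableOn ℂ (fun ζ : ℂ => h (r * ζ)) (closure (ball 0 1)) := by
    rw [closure_ball _ one_ne_zero]
    refine hh.comp (by fun_prop) ?_
    intro z hz
    simp only [mem_closedBall_zero_iff] at hz
    simp only [mem_ball_zero_iff, norm_mul, Complex.norm_real, Real.norm_eq_abs, abs_of_pos hr.1]
    nlinarith [hr.1, hr.2]
  exact this.diffContOnCl

lemma one_sub_norm_le {ζ z : ℂ} (hζ : ‖ζ‖ = 1) : 1 - ‖z‖ ≤ ‖1 - (starRingEnd ℂ) ζ * z‖ := by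
  have h := norm_sub_norm_le (1:ℂ) ((starRingEnd ℂ) ζ * z)
  simpa [hζ] using h

lemma tendsto_dilate_point {h : ℂ → ℂ} (hh : DifferentiableOn ℂ h (ball 0 1)) {z : ℂ} (hz : ‖z‖ < 1) :
    Filter.Tendsto (fun n => h (rad n * z)) Filter.atTop (nhds (h z)) := by
  have hcz : ContinuousAt h z := (hh.differentiableAt (isOpen_ball.mem_nhds (by simpa using hz))).continuousAt
  refine hcz.tendsto.comp ?_
  have : Filter.Tendsto (fun j => ((rad j : ℝ) : ℂ) * z) Filter.atTop (nhds (((1:ℝ):ℂ) * z)) :=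
    ((Complex.continuous_ofReal.tendsto _).comp (rad_tendsto.mono_right nhdsWithin_le_nhds)).mul_const _
  simpa using this

lemma cauchy_h1 {h hs : ℂ → ℂ} (hh : DifferentiableOn ℂ h (ball 0 1)) {A : ℝ}
    (hA : ∀ r ∈ Ioo (0:ℝ) 1, ∫ ζ, ‖h (r * ζ)‖ ∂circleMeasure ≤ A) (hb : IsBoundaryFn h hs) 
    (hi : Integrable hs circleMeasure) {z : ℂ} (hz : ‖z‖ < 1) :
    ∫ ζ, hs ζ / (1 - (starRingEnd ℂ) ζ * z) ∂circleMeasure = h z := by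
  have L1 : Filter.Tendsto (fun n => ∫⁻ ζ, ‖h (rad n * ζ) - hs ζ‖ₑ ∂circleMeasure) Filter.atTop (nhds 0) := by
    rw [ENNReal.tendsto_nhds_zero]
    intro δ hδ
    obtain ⟨δ', h0, h1⟩ : ∃ δ' : ℝ, 0 < δ' ∧ ENNReal.ofReal δ' ≤ δ := by
      by_cases ht : δ = ⊤
      · exact ⟨1, one_pos, by simp [ht]⟩
      · exact ⟨δ.toReal, ENNReal.toReal_pos hδ.ne' ht, by rw [ENNReal.ofReal_toReal ht]⟩
    filter_upwards [rad_tendsto.eventually (h1_cauchy hh hA h0)] with n hn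
    refine le_trans ?_ h1
    calc ∫⁻ ζ, ‖h (rad n * ζ) - hs ζ‖ₑ ∂circleMeasure 
        = ∫⁻ ζ, Filter.liminf (fun m => ‖h (rad n * ζ) - h (rad m * ζ)‖ₑ) Filter.atTop ∂circleMeasure := by
          apply lintegral_congr_ae
          filter_upwards [hb] with ζ hζ
          have t := hζ.comp rad_tendsto
          exact ((t.const_sub (h (rad n * ζ))).enorm).liminf_eq.symm
      _ ≤ Filter.liminf (fun m => ∫⁻ ζ, ‖h (rad n * ζ) - h (rad m * ζ)‖ₑ ∂circleMeasure) Filter.atTop := 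
          lintegral_liminf_le' fun m => ((aesm_dilate hh (rad_mem n)).sub (aesm_dilate hh (rad_mem m))).enorm
      _ ≤ ENNReal.ofReal δ' := by
          refine Filter.liminf_le_of_frequently_le' (Filter.Eventually.frequently ?_)
          have hm : ∀ᶠ m in Filter.atTop, rad n < rad m := 
            rad_tendsto.eventually (mem_nhdsWithin_of_mem_nhds (lt_mem_nhds (rad_mem n).2))
          filter_upwards [hm] with m hm
          rw [← ofReal_integral_norm_eq_lintegral_enorm]
          · exact ENNReal.ofReal_le_ofReal (hn _ ⟨hm.le, (rad_mem m).2⟩)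
          · exact integrable_of_continuousOn ((continuousOn_dilate hh (rad_mem n)).sub (continuousOn_dilate hh (rad_mem m)))
  have hC : 0 < 1 - ‖z‖ := by linarith
  have T : Filter.Tendsto (fun n => ∫ ζ, h (rad n * ζ) / (1 - (starRingEnd ℂ) ζ * z) ∂circleMeasure) Filter.atTop
      (nhds (∫ ζ, hs ζ / (1 - (starRingEnd ℂ) ζ * z) ∂circleMeasure)) := by
    have hk : AEStronglyMeasurable (fun ζ : ℂ => (1 - (starRingEnd ℂ) ζ * z)⁻¹) circleMeasure := by
      have : Measurable fun ζ : ℂ => (1 - (starRingEnd ℂ) ζ * z)⁻¹ := by fun_prop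
      exact this.aestronglyMeasurable
    have hkb : ∀ᵐ ζ ∂circleMeasure, ‖(1 - (starRingEnd ℂ) ζ * z)⁻¹‖ ≤ (1 - ‖z‖)⁻¹ := by
      filter_upwards [ae_norm_eq_one] with ζ hζ
      rw [norm_inv]
      exact inv_anti₀ hC (one_sub_norm_le hζ)
    refine tendsto_integral_of_L1 _ ?_ ?_ ?_
    · simp only [div_eq_mul_inv]
      exact (hi.mul_bdd hk hkb).aestronglyMeasurable
    · refine Filter.Eventually.of_forall fun n => ?_
      simp only [div_eq_mul_inv]
      exact (integrable_of_continuousOn (continuousOn_dilate hh (rad_mem n))).mul_bdd hk hkb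
    · have t2 := ENNReal.Tendsto.mul_const (b := ENNReal.ofReal (1 - ‖z‖)⁻¹) L1 (Or.inr ENNReal.ofReal_ne_top)
      rw [zero_mul] at t2
      refine tendsto_of_tendsto_of_tendsto_of_le_of_le tendsto_const_nhds t2 (fun _ => zero_le) fun n => ?_
      simp only
      rw [← lintegral_mul_const' _ _ ENNReal.ofReal_ne_top]
      apply lintegral_mono_ae
      filter_upwards [hkb] with ζ hζ
      rw [← sub_div, div_eq_mul_inv, enorm_mul]
      gcongr
      rw [← ofReal_norm]
      exact ENNReal.ofReal_le_ofReal hζ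
  refine tendsto_nhds_unique T ?_
  refine (tendsto_dilate_point hh hz).congr fun n => ?_
  exact (cauchy_dilate hh (rad_mem n) hz).symm

lemma cauchy_hinf {h hs : ℂ → ℂ} (hh : DifferentiableOn ℂ h (ball 0 1)) {A : ℝ}
    (hA : ∀ z : ℂ, ‖z‖ < 1 → ‖h z‖ ≤ A) (hb : IsBoundaryFn h hs) :
    (∀ᵐ ζ ∂circleMeasure, ‖hs ζ‖ ≤ A) ∧ ∀ z : ℂ, ‖z‖ < 1 → 
    ∫ ζ, hs ζ / (1 - (starRingEnd ℂ) ζ * z) ∂circleMeasure = h z := by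
  have nz : ∀ ζ : ℂ, ‖ζ‖ = 1 → ∀ t ∈ Ioo (0:ℝ) 1, ‖(t:ℂ) * ζ‖ < 1 := by
    intro ζ hζ t ht
    simp [hζ, abs_of_pos ht.1, ht.2]
  have h1 : ∀ᵐ ζ ∂circleMeasure, ‖hs ζ‖ ≤ A := by
    filter_upwards [hb, ae_norm_eq_one] with ζ hζ h1
    exact le_of_tendsto (hζ.comp rad_tendsto).norm
      (Filter.Eventually.of_forall fun n => hA _ (nz ζ h1 _ (rad_mem n)))
  refine ⟨h1, fun z hz => cauchy_h1 (A := A) hh (fun r hr => ?_) hb ?_ hz⟩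
  · have : ∫ ζ, ‖h (r * ζ)‖ ∂circleMeasure ≤ ∫ ζ, A ∂circleMeasure := by
      apply integral_mono_ae
      · exact integrable_of_continuousOn_real (continuousOn_dilate hh hr).norm
      · exact integrable_const _
      · filter_upwards [ae_norm_eq_one] with ζ hζ
        exact hA _ (nz ζ hζ r hr)
    simpa using this
  · exact Integrable.of_bound (aesm_boundary hh hb) A h1

lemma measurable_inv_Gamma : Measurable fun t : ℝ => (Real.Gamma t)⁻¹ := by
  have h : (fun t : ℝ => (Real.Gamma t)⁻¹) = fun t : ℝ => ((Complex.Gamma (t:ℂ))⁻¹).re := by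
    ext t
    rw [Complex.Gamma_ofReal, ← Complex.ofReal_inv, Complex.ofReal_re]
  rw [h]
  have h2 : Continuous fun z : ℂ => (Complex.Gamma z)⁻¹ := Complex.differentiable_one_div_Gamma.continuous
  exact (Complex.continuous_re.comp (h2.comp Complex.continuous_ofReal)).measurable

lemma lintegral_gamma {a r : ℝ} (ha : 0 < a) (hr : 0 < r) :
    ∫⁻ t in Ioi (0:ℝ), ENNReal.ofReal (t ^ (a - 1) * Real.exp (-(r * t))) =
      ENNReal.ofReal ((1 / r) ^ a * Real.Gamma a) := by
  have h := Real.integral_rpow_mul_exp_neg_mul_Ioi ha hr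
  have hpos : 0 < (1 / r) ^ a * Real.Gamma a := by
    have := Real.Gamma_pos_of_pos ha
    positivity
  rw [← h, ofReal_integral_eq_lintegral_ofReal]
  · exact Integrable.of_integral_ne_zero (by rw [h]; exact hpos.ne')
  · filter_upwards [ae_restrict_mem measurableSet_Ioi] with t ht
    have : (0:ℝ) < t := ht
    positivity

/-- Hausdorff moment measure for the sequence `1 / log (n+2) ^ s`. -/
lemma exists_moment {s : ℝ} (hs : 0 < s) : ∃ μ : Measure ℝ, (∀ᵐ r ∂μ, r ∈ Ioo (0:ℝ) 1) ∧
    ∀ n : ℕ, ∫⁻ r, ENNReal.ofReal (r ^ n) ∂μ = ENNReal.ofReal (1 / Real.log ((n:ℝ) + 2) ^ s) := by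
  let d : ℝ × ℝ → ℝ≥0∞ := fun p => ENNReal.ofReal (p.1 ^ (s - 1) * (Real.Gamma s)⁻¹ * (Real.Gamma p.1)⁻¹
     * p.2 ^ (p.1 - 1) * Real.exp (-(2 * p.2)))
  have hd : Measurable d := by
    have : Measurable fun p : ℝ × ℝ => (Real.Gamma p.1)⁻¹ := measurable_inv_Gamma.comp measurable_fst
    simp only [d]
    fun_prop
  let ν : Measure (ℝ × ℝ) := ((volume.restrict (Ioi (0:ℝ))).prod (volume.restrict (Ioi (0:ℝ)))).withDensity d
  have he : Measurable fun p : ℝ × ℝ => Real.exp (-p.2) := by fun_prop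
  refine ⟨ν.map (fun p => Real.exp (-p.2)), ?_, fun n => ?_⟩
  · refine (ae_map_iff he.aemeasurable (p := fun r => r ∈ Ioo (0:ℝ) 1) measurableSet_Ioo).2 ?_
    have hac : ν ≪ (volume.restrict (Ioi (0:ℝ))).prod (volume.restrict (Ioi (0:ℝ))) :=
      withDensity_absolutelyContinuous _ _
    refine hac.ae_le ?_
    rw [Measure.prod_restrict]
    filter_upwards [ae_restrict_mem (measurableSet_Ioi.prod measurableSet_Ioi)] with p hp
    have : (0:ℝ) < p.2 := hp.2
    exact ⟨Real.exp_pos _, Real.exp_lt_one_iff.mpr (by linarith)⟩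
  · rw [lintegral_map (by fun_prop) he, lintegral_withDensity_eq_lintegral_mul _ hd (by fun_prop),
      lintegral_prod _ (by fun_prop)]
    have hn : (0:ℝ) < (n:ℝ) + 2 := by positivity
    have hlog : 0 < Real.log ((n:ℝ) + 2) := Real.log_pos (by linarith [(Nat.cast_nonneg n : (0:ℝ) ≤ n)])
    have hGs := Real.Gamma_pos_of_pos hs
    have inner : ∀ t ∈ Ioi (0:ℝ), ∫⁻ u in Ioi (0:ℝ), (d * fun p : ℝ × ℝ => ENNReal.ofReal (Real.exp (-p.2) ^ n)) (t, u)
        = ENNReal.ofReal (Real.Gamma s)⁻¹ * ENNReal.ofReal (t ^ (s - 1) * Real.exp (-(Real.log ((n:ℝ) + 2) * t))) := by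
      intro t ht
      have ht0 : (0:ℝ) < t := ht
      have hGt := Real.Gamma_pos_of_pos ht0
      have e : ∀ u ∈ Ioi (0:ℝ), (d * fun p : ℝ × ℝ => ENNReal.ofReal (Real.exp (-p.2) ^ n)) (t, u) = 
          ENNReal.ofReal (t ^ (s - 1) * (Real.Gamma s)⁻¹ * (Real.Gamma t)⁻¹) * 
          ENNReal.ofReal (u ^ (t - 1) * Real.exp (-(((n:ℝ) + 2) * u))) := by
        intro u hu
        have hu0 : (0:ℝ) < u := hu
        simp only [d, Pi.mul_apply]
        rw [← ENNReal.ofReal_mul (by positivity), ← ENNReal.ofReal_mul (by positivity)]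
        congr 1
        rw [← Real.exp_nat_mul, mul_assoc, mul_assoc, ← Real.exp_add]
        rw [show -(2 * u) + n * -u = -(((n:ℝ) + 2) * u) by ring]
      rw [setLIntegral_congr_fun measurableSet_Ioi e, lintegral_const_mul' _ _ ENNReal.ofReal_ne_top,
        lintegral_gamma ht0 hn, ← ENNReal.ofReal_mul (by positivity), ← ENNReal.ofReal_mul (by positivity)]
      congr 1
      have : (1 / ((n:ℝ) + 2)) ^ t = Real.exp (-(Real.log ((n:ℝ) + 2) * t)) := by
        rw [Real.rpow_def_of_pos (by positivity), one_div, Real.log_inv]; ring_nf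
      rw [this]
      field_simp
    rw [setLIntegral_congr_fun measurableSet_Ioi inner, lintegral_const_mul' _ _ ENNReal.ofReal_ne_top,
      lintegral_gamma hs hlog, ← ENNReal.ofReal_mul (by positivity)]
    congr 1
    rw [Real.div_rpow zero_le_one hlog.le, Real.one_rpow]
    field_simp

/-- coefficients of `(1-z)^{-1/2}`. -/
noncomputable def cb : ℕ → ℝ
  | 0 => 1
  | (n+1) => cb n * (2 * n + 1) / (2 * n + 2)

lemma cb_rec (n : ℕ) : 2 * ((n:ℝ) + 1) * cb (n+1) = (2 * n + 1) * cb n := by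
  rw [cb]; field_simp

lemma cb_pos (n : ℕ) : 0 < cb n := by
  induction n with
  | zero => simp [cb]
  | succ n ih => rw [cb]; positivity

lemma cb_sq (n : ℕ) : cb n ^ 2 ≤ 1 / ((n:ℝ) + 1) := by
  have h : cb n ^ 2 * (2 * n + 1) ≤ 1 := by
    induction n with
    | zero => simp [cb]
    | succ n ih =>
      have e : cb (n+1) ^ 2 * (2 * ((n+1 : ℕ):ℝ) + 1) = cb n ^ 2 * (2 * n + 1) * (((2 * n + 1) * (2 * n + 3)) / (2 * n + 2) ^ 2) := by
        rw [cb]; push_cast; field_simp; ring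
      rw [e]
      have h1 : ((2 * n + 1) * (2 * n + 3)) / (2 * (n:ℝ) + 2) ^ 2 ≤ 1 := by
        rw [div_le_one (by positivity)]; nlinarith
      exact mul_le_one₀ ih (by positivity) h1
  rw [le_div_iff₀ (by positivity)]
  have : 0 ≤ cb n ^ 2 := by positivity
  have : (0:ℝ) ≤ n := Nat.cast_nonneg n
  nlinarith

lemma cb_le_one (n : ℕ) : cb n ≤ 1 := by
  have h := cb_sq n
  have h1 : 1 / ((n:ℝ) + 1) ≤ 1 := by
    rw [div_le_one (by positivity)]; linarith [(Nat.cast_nonneg n : (0:ℝ) ≤ n)]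
  nlinarith [cb_pos n]

lemma cb_conv (n : ℕ) : ∑ p ∈ Finset.HasAntidiagonal.antidiagonal n, cb p.1 * cb p.2 = 1 := by
  have hsym : ∀ n : ℕ, 2 * ∑ p ∈ Finset.HasAntidiagonal.antidiagonal n, (p.1:ℝ) * (cb p.1 * cb p.2) =
      n * ∑ p ∈ Finset.HasAntidiagonal.antidiagonal n, cb p.1 * cb p.2 := by
    intro n
    have h1 : ∑ p ∈ Finset.HasAntidiagonal.antidiagonal n, (p.1:ℝ) * (cb p.1 * cb p.2) =
        ∑ p ∈ Finset.HasAntidiagonal.antidiagonal n, (p.2:ℝ) * (cb p.1 * cb p.2) := by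
      rw [← Finset.Nat.sum_antidiagonal_swap]
      refine Finset.sum_congr rfl fun p _ => ?_
      simp; left; ring
    rw [two_mul]
    nth_rewrite 2 [h1]
    rw [← Finset.sum_add_distrib, Finset.mul_sum]
    refine Finset.sum_congr rfl fun p hp => ?_
    rw [Finset.HasAntidiagonal.mem_antidiagonal] at hp
    rw [← hp]; push_cast; ring
  induction n with
  | zero => simp [cb]
  | succ n ih =>
    have h1 := hsym (n+1)
    have h2 : 2 * ∑ p ∈ Finset.HasAntidiagonal.antidiagonal (n+1), (p.1:ℝ) * (cb p.1 * cb p.2) = 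
        ∑ p ∈ Finset.HasAntidiagonal.antidiagonal n, (2 * (p.1:ℝ) + 1) * (cb p.1 * cb p.2) := by
      rw [Finset.Nat.sum_antidiagonal_succ]
      simp only [Nat.cast_zero, zero_mul, zero_add, Finset.mul_sum]
      refine Finset.sum_congr rfl fun p _ => ?_
      have := cb_rec p.1
      push_cast
      linear_combination cb p.2 * this
    have h3 : ∑ p ∈ Finset.HasAntidiagonal.antidiagonal n, (2 * (p.1:ℝ) + 1) * (cb p.1 * cb p.2) = (n:ℝ) + 1 := by
      have : ∀ p : ℕ × ℕ, (2 * (p.1:ℝ) + 1) * (cb p.1 * cb p.2) = 2 * ((p.1:ℝ) * (cb p.1 * cb p.2)) + cb p.1 * cb p.2 := 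
        fun p => by ring
      simp only [this]
      rw [Finset.sum_add_distrib, ← Finset.mul_sum, hsym n, ih, mul_one]
    rw [h2, h3] at h1
    push_cast at h1
    have h0 : (n:ℝ) + 1 ≠ 0 := by positivity
    field_simp at h1
    linarith

lemma cb_series {z : ℂ} (hz : ‖z‖ < 1) : (∑' k, (cb k : ℂ) * z ^ k) ^ 2 = (1 - z)⁻¹ := by
  have hs : Summable fun k => ‖(cb k : ℂ) * z ^ k‖ := by
    have := summable_coeff_pow (F := fun k => (cb k : ℂ)) (B := 1) (fun k => by
      simpa [abs_of_pos (cb_pos k)] using cb_le_one k) (norm_nonneg z) hz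
    simpa using this
  rw [sq, tsum_mul_tsum_eq_tsum_sum_antidiagonal_of_summable_norm hs hs, ← tsum_geometric_of_norm_lt_one hz]
  congr 1; ext n
  have : ∑ p ∈ Finset.HasAntidiagonal.antidiagonal n, (cb p.1 : ℂ) * z ^ p.1 * ((cb p.2 : ℂ) * z ^ p.2) = 
      ∑ p ∈ Finset.HasAntidiagonal.antidiagonal n, ((cb p.1 * cb p.2 : ℝ) : ℂ) * z ^ n := by
    refine Finset.sum_congr rfl fun p hp => ?_
    rw [Finset.HasAntidiagonal.mem_antidiagonal] at hp
    rw [← hp, pow_add]; push_cast; ring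
  rw [this, ← Finset.sum_mul, ← Complex.ofReal_sum, cb_conv]; simp

/-- `∫ 1/|1 - r ζ conj η|` -/
lemma kernel_integral {r : ℝ} (hr : r ∈ Ioo (0:ℝ) 1) {η : ℂ} (hη : ‖η‖ = 1) :
    ∫⁻ ζ, ENNReal.ofReal ‖(1 - r * (starRingEnd ℂ) η * ζ)⁻¹‖ ∂circleMeasure ≤
      ∑' n : ℕ, ENNReal.ofReal (1 / ((n:ℝ) + 1)) * ENNReal.ofReal (r ^ (2 * n)) := by
  set w : ℂ := r * (starRingEnd ℂ) η with hw
  have hwn : ‖w‖ = r := by simp [hw, hη, abs_of_pos hr.1]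
  have hs : Summable fun k => ‖(cb k : ℂ) * w ^ k‖ := by
    have := summable_coeff_pow (F := fun k => (cb k : ℂ)) (B := 1) (fun k => by
      simpa [abs_of_pos (cb_pos k)] using cb_le_one k) hr.1.le hr.2
    simpa [hwn] using this
  have hp := parseval hs
  have e : ∫⁻ ζ, ENNReal.ofReal ‖(1 - w * ζ)⁻¹‖ ∂circleMeasure = 
      ENNReal.ofReal (∫ ζ, ‖∑' k, (cb k : ℂ) * w ^ k * ζ ^ k‖ ^ 2 ∂circleMeasure) := by
    rw [ofReal_integral_eq_lintegral_ofReal]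
    · apply lintegral_congr_ae
      filter_upwards [ae_norm_eq_one] with ζ hζ
      rw [← cb_series (by rw [norm_mul, hwn, hζ]; linarith [hr.2]), norm_pow]
      simp only [mul_pow, mul_assoc]
    · exact integrable_of_continuousOn_real ((continuousOn_series hs).norm.pow 2)
    · exact Filter.Eventually.of_forall fun _ => by positivity
  rw [e, ← hp.tsum_eq, ENNReal.ofReal_tsum_of_nonneg (fun _ => by positivity) hp.summable]
  refine ENNReal.tsum_le_tsum fun n => ?_
  rw [← ENNReal.ofReal_mul (by positivity)]
  apply ENNReal.ofReal_le_ofReal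
  rw [norm_mul, norm_pow, hwn, mul_pow, Complex.norm_real, Real.norm_eq_abs, sq_abs, ← pow_mul, mul_comm n 2]
  exact mul_le_mul_of_nonneg_right (cb_sq n) (pow_nonneg hr.1.le _)

lemma summable_alpha {s : ℝ} (hs : 1 < s) :
    Summable fun n : ℕ => 1 / ((n:ℝ) + 1) * (1 / Real.log (((2 * n : ℕ) : ℝ) + 2) ^ s) := by
  let g : ℕ → ℝ := fun m => 1 / (m:ℝ) * (1 / Real.log (2 * (m:ℝ)) ^ s)
  have hlog : ∀ m : ℕ, 0 < m → 0 < Real.log (2 * (m:ℝ)) := by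
    intro m hm
    apply Real.log_pos
    have : (1:ℝ) ≤ m := by exact_mod_cast hm
    linarith
  have hg : Summable g := by
    rw [← summable_condensed_iff_of_nonneg]
    · have e : ∀ k : ℕ, (2:ℝ) ^ k * g (2 ^ k) = (1 / Real.log 2 ^ s) * (1 / ((k + 1 : ℕ) : ℝ) ^ s) := by
        intro k
        have h2 : Real.log (2 * ((2 ^ k : ℕ) : ℝ)) = ((k + 1 : ℕ) : ℝ) * Real.log 2 := by
          rw [← Real.log_pow, pow_succ]; push_cast; ring_nf
        have hl : 0 < Real.log 2 := Real.log_pos (by norm_num)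
        simp only [g]
        rw [h2, Real.mul_rpow (by positivity) hl.le]
        have h3 : (0:ℝ) < ((k + 1 : ℕ) : ℝ) ^ s := Real.rpow_pos_of_pos (by positivity) _
        have h4 : (0:ℝ) < Real.log 2 ^ s := Real.rpow_pos_of_pos hl _
        push_cast at *
        field_simp
      simp only [e]
      apply Summable.mul_left
      exact (summable_nat_add_iff 1 (f := fun k : ℕ => 1 / (k:ℝ) ^ s)).2 (Real.summable_one_div_nat_rpow.2 hs)
    · intro n
      rcases Nat.eq_zero_or_pos n with h | h
      · simp [g, h]
      · have := hlog n h
        positivity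
    · intro m n hm hmn
      have h1 := hlog m hm
      have h2 : (m:ℝ) ≤ n := by exact_mod_cast hmn
      have h3 : (0:ℝ) < m := by exact_mod_cast hm
      have h4 : Real.log (2 * (m:ℝ)) ≤ Real.log (2 * (n:ℝ)) := Real.log_le_log (by positivity) (by linarith)
      have h5 : 0 < Real.log (2 * (m:ℝ)) ^ s := Real.rpow_pos_of_pos h1 _
      have h6 : Real.log (2 * (m:ℝ)) ^ s ≤ Real.log (2 * (n:ℝ)) ^ s := Real.rpow_le_rpow h1.le h4 (by linarith)
      simp only [g]
      exact mul_le_mul (one_div_le_one_div_of_le h3 h2) (one_div_le_one_div_of_le h5 h6) 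
        (one_div_nonneg.2 (h5.le.trans h6)) (by positivity)
  have := (summable_nat_add_iff 1).2 hg
  refine this.congr fun n => ?_
  simp only [g]
  push_cast
  rw [mul_add, mul_one]

lemma tsum_alpha_ne_top {s : ℝ} (hs : 1 < s) :
    ∑' n : ℕ, ENNReal.ofReal (1 / ((n:ℝ) + 1)) * ENNReal.ofReal (1 / Real.log (((2 * n : ℕ) : ℝ) + 2) ^ s) ≠ ⊤ := by
  have e : ∀ n : ℕ, ENNReal.ofReal (1 / ((n:ℝ) + 1)) * ENNReal.ofReal (1 / Real.log (((2 * n : ℕ) : ℝ) + 2) ^ s) =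
      ENNReal.ofReal (1 / ((n:ℝ) + 1) * (1 / Real.log (((2 * n : ℕ) : ℝ) + 2) ^ s)) := fun n => by
    rw [ENNReal.ofReal_mul (by positivity)]
  simp only [e]
  exact (summable_alpha hs).tsum_ofReal_ne_top

lemma diff_bound {f : ℂ → ℂ} {M : ℝ} (hf : DifferentiableOn ℂ f (ball 0 1))
    (hM : ∀ z, ‖z‖ < 1 → ‖f z‖ ≤ M) {r : ℝ} (hr : r ∈ Ioo (0:ℝ) 1) {ζ η : ℂ} (hζ : ‖ζ‖ = 1) (hη : ‖η‖ = 1) :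
    ‖f (r * ζ) - f (r * η)‖ / ‖ζ - η‖ ≤ 4 * M * ‖(1 - r * (starRingEnd ℂ) η * ζ)⁻¹‖ := by
  obtain ⟨h0, h1⟩ := hr
  have hM0 : 0 ≤ M := (norm_nonneg _).trans (hM 0 (by simp))
  rcases eq_or_ne ζ η with rfl | hne
  · simp; positivity
  have hd : 0 < ‖ζ - η‖ := norm_pos_iff.2 (sub_ne_zero.2 hne)
  set d := ‖ζ - η‖ with hdd
  have hrn : ∀ w : ℂ, ‖w‖ = 1 → ‖(r:ℂ) * w‖ = r := fun w hw => by simp [hw, abs_of_pos h0]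
  have hk : ‖1 - r * (starRingEnd ℂ) η * ζ‖ = ‖η - r * ζ‖ := by
    have : (1 - r * (starRingEnd ℂ) η * ζ) = (starRingEnd ℂ) η * (η - r * ζ) := by
      have h : (starRingEnd ℂ) η * η = 1 := by rw [mul_comm, Complex.mul_conj, Complex.normSq_eq_norm_sq, hη]; simp
      linear_combination -h
    rw [this, norm_mul, RCLike.norm_conj, hη, one_mul]
  have hup : ‖η - r * ζ‖ ≤ d + (1 - r) := by
    calc ‖η - r * ζ‖ = ‖-(ζ - η) + ((1 - r : ℝ) : ℂ) * ζ‖ := by congr 1; push_cast; ring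
      _ ≤ ‖-(ζ - η)‖ + ‖((1 - r : ℝ) : ℂ) * ζ‖ := norm_add_le _ _
      _ = d + (1 - r) := by rw [norm_neg, norm_mul, hζ, mul_one, Complex.norm_real, Real.norm_eq_abs, abs_of_pos (by linarith)]
  have hlow : 0 < ‖η - r * ζ‖ := by
    have := norm_sub_norm_le η (r * ζ)
    rw [hrn ζ hζ, hη] at this
    linarith
  have hinv : (d + (1 - r))⁻¹ ≤ ‖(1 - r * (starRingEnd ℂ) η * ζ)⁻¹‖ := by
    rw [norm_inv, hk]; exact inv_anti₀ hlow hup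
  have hA : ‖f (r * ζ) - f (r * η)‖ ≤ 2 * M := by
    have := norm_sub_le (f (r * ζ)) (f (r * η))
    have := hM (r * ζ) (by rw [hrn ζ hζ]; exact h1)
    have := hM (r * η) (by rw [hrn η hη]; exact h1)
    linarith
  have hB : ‖f (r * ζ) - f (r * η)‖ ≤ 2 * M / (1 - r) * d := by
    have hdf : ∀ x ∈ closedBall (0:ℂ) r, DifferentiableAt ℂ f x := fun x hx =>
      hf.differentiableAt (isOpen_ball.mem_nhds (closedBall_subset_ball h1 hx))
    have hbd : ∀ x ∈ closedBall (0:ℂ) r, ‖deriv f x‖ ≤ M / ((1 - r) / 2) := by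
      intro x hx
      have hx' : ‖x‖ ≤ r := by simpa using hx
      have hlt : ∀ y, dist y x ≤ (1 - r) / 2 → ‖y‖ < 1 := by
        intro y hy
        have h3 : ‖y - x‖ ≤ (1 - r) / 2 := by rwa [← dist_eq_norm]
        have h2 := norm_add_le (y - x) x
        rw [sub_add_cancel] at h2
        linarith
      refine Complex.norm_deriv_le_of_forall_mem_sphere_norm_le (by linarith) ?_ ?_
      · refine (hf.mono ?_).diffContOnCl_ball (U := closedBall x ((1 - r) / 2)) (subset_refl _)
        intro y hy
        simpa using hlt y (mem_closedBall.1 hy)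
      · intro y hy
        exact hM y (hlt y (mem_sphere.1 hy).le)
    have := (convex_closedBall (0:ℂ) r).norm_image_sub_le_of_norm_deriv_le hdf hbd
      (x := r * η) (y := r * ζ) (by simp [hη, abs_of_pos h0]) (by simp [hζ, abs_of_pos h0])
    refine this.trans ?_
    rw [← mul_sub, norm_mul, ← hdd, Complex.norm_real, Real.norm_eq_abs, abs_of_pos h0]
    have e : M / ((1 - r) / 2) = 2 * M / (1 - r) := by field_simp
    rw [e]
    have : 0 ≤ 2 * M / (1 - r) := div_nonneg (by linarith) (by linarith)
    apply mul_le_mul_of_nonneg_left _ this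
    nlinarith
  refine le_trans ?_ (mul_le_mul_of_nonneg_left hinv (by positivity))
  rw [← div_eq_mul_inv]
  have hs : 0 < d + (1 - r) := by linarith
  rw [div_le_div_iff₀ hd hs]
  rcases le_total d (1 - r) with h | h
  · have h3 : 2 * M / (1 - r) * d * (1 - r) = 2 * M * d := by
      have : 1 - r ≠ 0 := by linarith
      field_simp
    calc ‖f (r * ζ) - f (r * η)‖ * (d + (1 - r)) ≤ (2 * M / (1 - r) * d) * (2 * (1 - r)) :=
          mul_le_mul hB (by linarith) hs.le ((norm_nonneg _).trans hB)
      _ = 4 * M * d := by linear_combination 2 * h3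
  · calc ‖f (r * ζ) - f (r * η)‖ * (d + (1 - r)) ≤ 2 * M * (2 * d) :=
          mul_le_mul hA (by linarith) hs.le (by positivity)
      _ = 4 * M * d := by ring

/-- average of dilations -/
noncomputable def avg (μ : Measure ℝ) (f : ℂ → ℂ) (z : ℂ) : ℂ := ∫ r, f ((r:ℂ) * z) ∂μ

lemma norm_dil {r : ℝ} (hr : r ∈ Ioo (0:ℝ) 1) {z : ℂ} (hz : ‖z‖ ≤ 1) : ‖(r:ℂ) * z‖ < 1 := by
  rw [norm_mul, Complex.norm_real, Real.norm_eq_abs, abs_of_pos hr.1]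
  have := hr.1; have := hr.2; nlinarith [norm_nonneg z]

lemma aesm_dil {μ : Measure ℝ} (hμ : ∀ᵐ r ∂μ, r ∈ Ioo (0:ℝ) 1) {f : ℂ → ℂ}
    (hf : DifferentiableOn ℂ f (ball 0 1)) {z : ℂ} (hz : ‖z‖ ≤ 1) :
    AEStronglyMeasurable (fun r : ℝ => f ((r:ℂ) * z)) μ := by
  have hc : ContinuousOn (fun r : ℝ => f ((r:ℂ) * z)) (Ioo 0 1) := by
    refine hf.continuousOn.comp (by fun_prop) ?_
    intro r hr
    simpa using norm_dil hr hz
  have := hc.aestronglyMeasurable (μ := μ) measurableSet_Ioo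
  rwa [Measure.restrict_eq_self_of_ae_mem hμ] at this

lemma integrable_dil {μ : Measure ℝ} [IsFiniteMeasure μ] (hμ : ∀ᵐ r ∂μ, r ∈ Ioo (0:ℝ) 1) {f : ℂ → ℂ} {M : ℝ}
    (hf : DifferentiableOn ℂ f (ball 0 1)) (hM : ∀ z, ‖z‖ < 1 → ‖f z‖ ≤ M) {z : ℂ} (hz : ‖z‖ ≤ 1) :
    Integrable (fun r : ℝ => f ((r:ℂ) * z)) μ := by
  refine Integrable.of_bound (aesm_dil hμ hf hz) M ?_
  filter_upwards [hμ] with r hr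
  exact hM _ (norm_dil hr hz)

lemma avg_bound {μ : Measure ℝ} [IsFiniteMeasure μ] (hμ : ∀ᵐ r ∂μ, r ∈ Ioo (0:ℝ) 1) {f : ℂ → ℂ} {M : ℝ}
    (hM : ∀ z, ‖z‖ < 1 → ‖f z‖ ≤ M) {z : ℂ} (hz : ‖z‖ ≤ 1) :
    ‖avg μ f z‖ ≤ M * μ.real univ := by
  refine norm_integral_le_of_norm_le_const ?_
  filter_upwards [hμ] with r hr
  exact hM _ (norm_dil hr hz)

lemma avg_boundary {μ : Measure ℝ} [IsFiniteMeasure μ] (hμ : ∀ᵐ r ∂μ, r ∈ Ioo (0:ℝ) 1) {f : ℂ → ℂ} {M : ℝ}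
    (hf : DifferentiableOn ℂ f (ball 0 1)) (hM : ∀ z, ‖z‖ < 1 → ‖f z‖ ≤ M) :
    IsBoundaryFn (avg μ f) (avg μ f) := by
  unfold IsBoundaryFn
  filter_upwards [ae_norm_eq_one] with ζ hζ
  have hev : ∀ᶠ t : ℝ in nhdsWithin 1 (Iio 1), ‖(t:ℂ) * ζ‖ ≤ 1 := by
    have : ∀ᶠ t : ℝ in nhdsWithin 1 (Iio 1), t ∈ Ioo (0:ℝ) 1 := Ioo_mem_nhdsLT (by norm_num)
    filter_upwards [this] with t ht
    exact (norm_dil ht hζ.le).le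
  refine tendsto_integral_filter_of_dominated_convergence (fun _ => M) ?_ ?_ (integrable_const _) ?_
  · filter_upwards [hev] with t ht
    exact aesm_dil hμ hf ht
  · filter_upwards [hev] with t ht
    filter_upwards [hμ] with r hr
    exact hM _ (norm_dil hr ht)
  · filter_upwards [hμ] with r hr
    have hc : ContinuousAt f ((r:ℂ) * ζ) := (hf.differentiableAt (isOpen_ball.mem_nhds (by
      simpa using norm_dil hr hζ.le))).continuousAt
    have h2 : Filter.Tendsto (fun t : ℝ => (r:ℂ) * ((t:ℂ) * ζ)) (nhdsWithin 1 (Iio 1)) (nhds ((r:ℂ) * ζ)) := by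
      have : Continuous fun t : ℝ => (r:ℂ) * ((t:ℂ) * ζ) := by fun_prop
      have := (this.tendsto 1).mono_left (nhdsWithin_le_nhds (s := Iio 1))
      simpa using this
    exact hc.tendsto.comp h2

lemma seqConv_eq_avg {μ : Measure ℝ} [IsFiniteMeasure μ] (hμ : ∀ᵐ r ∂μ, r ∈ Ioo (0:ℝ) 1) {f : ℂ → ℂ}
    (hf : DifferentiableOn ℂ f (ball 0 1)) {α : ℕ → ℝ} (h0 : ∀ n, 0 ≤ α n)
    (hα : ∀ n : ℕ, ∫⁻ r, ENNReal.ofReal (r ^ n) ∂μ = ENNReal.ofReal (α n)) {z : ℂ} (hz : ‖z‖ < 1) :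
    seqConv f α z = avg μ f z := by
  have hInt : ∀ n : ℕ, Integrable (fun r : ℝ => r ^ n) μ := by
    intro n
    refine Integrable.of_bound (by fun_prop) 1 ?_
    filter_upwards [hμ] with r hr
    rw [Real.norm_eq_abs, abs_of_nonneg (pow_nonneg hr.1.le _)]
    exact pow_le_one₀ hr.1.le hr.2.le
  have hmom : ∀ n : ℕ, ∫ r, r ^ n ∂μ = α n := by
    intro n
    rw [integral_eq_lintegral_of_nonneg_ae, hα, ENNReal.toReal_ofReal (h0 n)]
    · filter_upwards [hμ] with r hr
      exact pow_nonneg hr.1.le _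
    · fun_prop
  have hle : ∀ n, α n ≤ μ.real univ := by
    intro n
    rw [← hmom]
    have := integral_mono_ae (hInt n) (integrable_const (1:ℝ)) (μ := μ) (by
      filter_upwards [hμ] with r hr
      exact pow_le_one₀ hr.1.le hr.2.le)
    simpa using this
  have hF : ∀ n : ℕ, Integrable (fun r : ℝ => taylorCoeff f n * ((r:ℂ) * z) ^ n) μ := by
    intro n
    simp only [mul_pow]
    have := ((hInt n).ofReal (𝕜 := ℂ)).mul_const (z ^ n) |>.const_mul (taylorCoeff f n)
    simpa using this
  have hnorm : ∀ n : ℕ, ∫ r, ‖taylorCoeff f n * ((r:ℂ) * z) ^ n‖ ∂μ = ‖taylorCoeff f n‖ * ‖z‖ ^ n * α n := by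
    intro n
    rw [← hmom, ← integral_const_mul]
    apply integral_congr_ae
    filter_upwards [hμ] with r hr
    rw [norm_mul, norm_pow, norm_mul, Complex.norm_real, Real.norm_eq_abs, abs_of_pos hr.1, mul_pow]
    ring
  have hsum : Summable fun n : ℕ => ∫ r, ‖taylorCoeff f n * ((r:ℂ) * z) ^ n‖ ∂μ := by
    simp only [hnorm]
    refine Summable.of_nonneg_of_le (fun n => mul_nonneg (by positivity) (h0 n)) (fun n =>
      mul_le_mul_of_nonneg_left (hle n) (by positivity)) ((taylor_summable hf hz).mul_right _)
  have h1 := hasSum_integral_of_summable_integral_norm hF hsum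
  unfold seqConv avg
  have h2 : ∫ r, ∑' n, taylorCoeff f n * ((r:ℂ) * z) ^ n ∂μ = ∫ r, f ((r:ℂ) * z) ∂μ := by
    apply integral_congr_ae
    filter_upwards [hμ] with r hr
    exact (taylor_hasSum hf (norm_dil hr hz.le)).tsum_eq
  rw [← h2, ← h1.tsum_eq]
  congr 1; ext n
  simp only [mul_pow]
  rw [integral_const_mul, integral_mul_const, ← hmom, ← integral_complex_ofReal]
  simp only [Complex.ofReal_pow]
  ring

lemma seqConv_differentiable {f : ℂ → ℂ} (hf : DifferentiableOn ℂ f (ball 0 1)) {α : ℕ → ℝ} {A : ℝ}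
    (hα : ∀ n, |α n| ≤ A) : DifferentiableOn ℂ (seqConv f α) (ball 0 1) := by
  intro z hz
  have hz1 : ‖z‖ < 1 := by simpa using hz
  obtain ⟨ρ, h1, h2⟩ := exists_between hz1
  have hρ0 : 0 ≤ ρ := (norm_nonneg z).trans h1.le
  have hρ : ‖(ρ:ℂ)‖ = ρ := by simp [abs_of_nonneg hρ0]
  have hs : Summable fun n => ‖taylorCoeff f n‖ * ρ ^ n * A := by
    have := taylor_summable hf (z := (ρ:ℂ)) (by rw [hρ]; exact h2)
    rw [hρ] at this
    exact this.mul_right A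
  have := differentiableOn_tsum_of_summable_norm (F := fun n (w:ℂ) => taylorCoeff f n * (α n : ℂ) * w ^ n)
    (U := ball 0 ρ) hs (fun n => by fun_prop) isOpen_ball (fun n w hw => by
      have hw' : ‖w‖ ≤ ρ := by simpa using (mem_ball.1 hw).le
      rw [norm_mul, norm_mul, norm_pow, Complex.norm_real, Real.norm_eq_abs]
      have := hα n
      have hA0 : 0 ≤ A := (abs_nonneg _).trans this
      have h3 : ‖w‖ ^ n ≤ ρ ^ n := pow_le_pow_left₀ (norm_nonneg _) hw' n
      calc ‖taylorCoeff f n‖ * |α n| * ‖w‖ ^ n ≤ ‖taylorCoeff f n‖ * A * ρ ^ n := by gcongr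
        _ = _ := by ring)
  exact (this.differentiableAt (isOpen_ball.mem_nhds (by simpa using h1))).differentiableWithinAt

lemma avg_lam {μ : Measure ℝ} [IsFiniteMeasure μ] (hμ : ∀ᵐ r ∂μ, r ∈ Ioo (0:ℝ) 1) {f : ℂ → ℂ} {M : ℝ}
    (hf : DifferentiableOn ℂ f (ball 0 1)) (hM : ∀ z, ‖z‖ < 1 → ‖f z‖ ≤ M) {α : ℕ → ℝ}
    (hα : ∀ n : ℕ, ∫⁻ r, ENNReal.ofReal (r ^ n) ∂μ = ENNReal.ofReal (α n)) {η : ℂ} (hη : ‖η‖ = 1) :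
    ∫⁻ ζ, ENNReal.ofReal (‖avg μ f ζ - avg μ f η‖ / ‖ζ - η‖) ∂circleMeasure ≤
      ENNReal.ofReal (4 * M) * ∑' n : ℕ, ENNReal.ofReal (1 / ((n:ℝ) + 1)) * ENNReal.ofReal (α (2 * n)) := by
  have hM0 : 0 ≤ M := (norm_nonneg _).trans (hM 0 (by simp))
  have hk : Measurable fun p : ℂ × ℝ => ENNReal.ofReal ‖(1 - (p.2:ℂ) * (starRingEnd ℂ) η * p.1)⁻¹‖ := by
    fun_prop
  have h1 : ∀ᵐ ζ ∂circleMeasure, ENNReal.ofReal (‖avg μ f ζ - avg μ f η‖ / ‖ζ - η‖) ≤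
      ENNReal.ofReal (4 * M) * ∫⁻ r, ENNReal.ofReal ‖(1 - (r:ℂ) * (starRingEnd ℂ) η * ζ)⁻¹‖ ∂μ := by
    filter_upwards [ae_norm_eq_one] with ζ hζ
    have e : avg μ f ζ - avg μ f η = ∫ r, (f ((r:ℂ) * ζ) - f ((r:ℂ) * η)) ∂μ := by
      unfold avg
      rw [integral_sub (integrable_dil hμ hf hM hζ.le) (integrable_dil hμ hf hM hη.le)]
    rw [e, div_eq_mul_inv, ENNReal.ofReal_mul (norm_nonneg _), ofReal_norm]
    refine (mul_le_mul_left (enorm_integral_le_lintegral_enorm _) _).trans ?_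
    rw [← lintegral_mul_const' _ _ ENNReal.ofReal_ne_top, ← lintegral_const_mul' _ _ ENNReal.ofReal_ne_top]
    apply lintegral_mono_ae
    filter_upwards [hμ] with r hr
    rw [← ofReal_norm, ← ENNReal.ofReal_mul (norm_nonneg _), ← ENNReal.ofReal_mul (by positivity), ← div_eq_mul_inv]
    exact ENNReal.ofReal_le_ofReal (diff_bound hf hM hr hζ hη)
  refine (lintegral_mono_ae h1).trans ?_
  rw [lintegral_const_mul' _ _ ENNReal.ofReal_ne_top]
  refine mul_le_mul_right ?_ _
  rw [lintegral_lintegral_swap hk.aemeasurable]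
  calc _ ≤ ∫⁻ r, ∑' n : ℕ, ENNReal.ofReal (1 / ((n:ℝ) + 1)) * ENNReal.ofReal (r ^ (2 * n)) ∂μ := by
        apply lintegral_mono_ae
        filter_upwards [hμ] with r hr
        exact kernel_integral hr hη
    _ = _ := by
        rw [lintegral_tsum (fun n => by fun_prop)]
        congr 1; ext n
        rw [lintegral_const_mul' _ _ ENNReal.ofReal_ne_top, hα]

lemma dist_le_two {r : ℝ} (h0 : 0 ≤ r) (h1 : r < 1) {ζ η : ℂ} (hζ : ‖ζ‖ = 1) (hη : ‖η‖ = 1) :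
    ‖ζ - η‖ ≤ 2 * ‖1 - (starRingEnd ℂ) ζ * (r * η)‖ ∧ 0 < ‖1 - (starRingEnd ℂ) ζ * (r * η)‖ := by
  have hk : ‖1 - (starRingEnd ℂ) ζ * (r * η)‖ = ‖ζ - r * η‖ := by
    have : (1 - (starRingEnd ℂ) ζ * (r * η)) = (starRingEnd ℂ) ζ * (ζ - r * η) := by
      have h : (starRingEnd ℂ) ζ * ζ = 1 := by rw [mul_comm, Complex.mul_conj, Complex.normSq_eq_norm_sq, hζ]; simp
      linear_combination -h
    rw [this, norm_mul, RCLike.norm_conj, hζ, one_mul]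
  have hrn : ‖(r:ℂ) * η‖ = r := by simp [hη, abs_of_nonneg h0]
  have hlow := norm_sub_norm_le ζ (r * η)
  rw [hrn, hζ] at hlow
  have hup : ‖ζ - η‖ ≤ ‖ζ - r * η‖ + (1 - r) := by
    calc ‖ζ - η‖ = ‖(ζ - r * η) - ((1 - r : ℝ) : ℂ) * η‖ := by congr 1; push_cast; ring
      _ ≤ ‖ζ - r * η‖ + ‖((1 - r : ℝ) : ℂ) * η‖ := norm_sub_le _ _
      _ = _ := by rw [norm_mul, hη, mul_one, Complex.norm_real, Real.norm_eq_abs, abs_of_pos (by linarith)]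
  rw [hk]
  constructor <;> linarith

lemma toeplitz_point {gs hs h : ℂ → ℂ} {B : ℝ} (hB : ∀ ζ, ‖ζ‖ = 1 → ‖gs ζ‖ ≤ B)
    (hgm : AEStronglyMeasurable gs circleMeasure) (hi : Integrable hs circleMeasure)
    (hC : ∀ z : ℂ, ‖z‖ < 1 → ∫ ζ, hs ζ / (1 - (starRingEnd ℂ) ζ * z) ∂circleMeasure = h z)
    {r : ℝ} (h0 : 0 ≤ r) (h1 : r < 1) {η : ℂ} (hη : ‖η‖ = 1) :
    ENNReal.ofReal ‖toeplitz gs hs (r * η)‖ ≤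
      2 * (∫⁻ ζ, ENNReal.ofReal (‖gs ζ - gs η‖ / ‖ζ - η‖) * ENNReal.ofReal ‖hs ζ‖ ∂circleMeasure) +
        ENNReal.ofReal B * ENNReal.ofReal ‖h (r * η)‖ := by
  set z : ℂ := r * η with hz
  have hzn : ‖z‖ < 1 := by simp [hz, hη, abs_of_nonneg h0, h1]
  have hI : Integrable (fun ζ => hs ζ / (1 - (starRingEnd ℂ) ζ * z)) circleMeasure := by
    have hm : AEStronglyMeasurable (fun ζ : ℂ => (1 - (starRingEnd ℂ) ζ * z)⁻¹) circleMeasure := by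
      apply Measurable.aestronglyMeasurable; fun_prop
    simp only [div_eq_mul_inv]
    refine hi.mul_bdd (c := (1 - r)⁻¹) hm ?_
    filter_upwards [ae_norm_eq_one] with ζ hζ
    rw [norm_inv]
    apply inv_anti₀ (by linarith)
    have := norm_sub_norm_le (1:ℂ) ((starRingEnd ℂ) ζ * z)
    rw [norm_mul, RCLike.norm_conj, hζ, norm_one, one_mul, hz, norm_mul, hη, mul_one, Complex.norm_real,
      Real.norm_eq_abs, abs_of_nonneg h0] at this
    exact this
  have hgm' : AEStronglyMeasurable (fun ζ => (starRingEnd ℂ) (gs ζ)) circleMeasure :=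
    Complex.continuous_conj.comp_aestronglyMeasurable hgm
  have hI2 : Integrable (fun ζ => (starRingEnd ℂ) (gs ζ) * (hs ζ / (1 - (starRingEnd ℂ) ζ * z))) circleMeasure := by
    refine hI.bdd_mul (c := B) hgm' ?_
    filter_upwards [ae_norm_eq_one] with ζ hζ
    rw [RCLike.norm_conj]; exact hB ζ hζ
  have e : toeplitz gs hs z = (∫ ζ, ((starRingEnd ℂ) (gs ζ) - (starRingEnd ℂ) (gs η)) *
      (hs ζ / (1 - (starRingEnd ℂ) ζ * z)) ∂circleMeasure) + (starRingEnd ℂ) (gs η) * h z := by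
    simp only [sub_mul]
    rw [integral_sub hI2 (hI.const_mul _), integral_const_mul, hC z hzn]
    simp only [toeplitz, mul_div_assoc]
    ring
  rw [e]
  refine (ENNReal.ofReal_le_ofReal (norm_add_le _ _)).trans ?_
  rw [ENNReal.ofReal_add (norm_nonneg _) (norm_nonneg _)]
  refine add_le_add ?_ ?_
  · rw [ofReal_norm]
    refine (enorm_integral_le_lintegral_enorm _).trans ?_
    rw [← lintegral_const_mul' _ _ (by simp)]
    apply lintegral_mono_ae
    filter_upwards [ae_norm_eq_one] with ζ hζ
    rw [← ofReal_norm, show (2:ℝ≥0∞) = ENNReal.ofReal 2 by simp, ← ENNReal.ofReal_mul (by positivity),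
      ← ENNReal.ofReal_mul (by positivity)]
    apply ENNReal.ofReal_le_ofReal
    obtain ⟨ha, hb⟩ := dist_le_two h0 h1 hζ hη
    rw [norm_mul, norm_div, ← map_sub, RCLike.norm_conj]
    rcases eq_or_ne ζ η with rfl | hne
    · simp
    have hd : 0 < ‖ζ - η‖ := norm_pos_iff.2 (sub_ne_zero.2 hne)
    rw [← hz] at ha hb
    have : (‖1 - (starRingEnd ℂ) ζ * z‖)⁻¹ ≤ 2 * ‖ζ - η‖⁻¹ := by
      rw [← div_eq_mul_inv, le_div_iff₀ hd, inv_mul_le_iff₀ hb]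
      linarith
    calc ‖gs ζ - gs η‖ * (‖hs ζ‖ / ‖1 - (starRingEnd ℂ) ζ * z‖) 
        = ‖gs ζ - gs η‖ * ‖hs ζ‖ * (‖1 - (starRingEnd ℂ) ζ * z‖)⁻¹ := by ring
      _ ≤ ‖gs ζ - gs η‖ * ‖hs ζ‖ * (2 * ‖ζ - η‖⁻¹) := by gcongr
      _ = _ := by ring
  · rw [norm_mul, RCLike.norm_conj, ENNReal.ofReal_mul (norm_nonneg _)]
    exact mul_le_mul_left (ENNReal.ofReal_le_ofReal (hB η hη)) _

lemma eSup_bound {h : ℂ → ℂ} (hb : eSupAbs h ≠ ⊤) : ∀ z : ℂ, ‖z‖ < 1 → ‖h z‖ ≤ (eSupAbs h).toReal := by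
  intro z hz
  rw [← ENNReal.ofReal_le_iff_le_toReal hb]
  exact le_iSup₂ (f := fun z (_ : z ∈ ball (0:ℂ) 1) => ENNReal.ofReal ‖h z‖) z (by simpa using hz)

lemma toeplitz_hinf {gs : ℂ → ℂ} {B : ℝ} {L : ℝ≥0∞} (hB : ∀ ζ, ‖ζ‖ = 1 → ‖gs ζ‖ ≤ B)
    (hgm : AEStronglyMeasurable gs circleMeasure)
    (hL : ∀ η : ℂ, ‖η‖ = 1 → ∫⁻ ζ, ENNReal.ofReal (‖gs ζ - gs η‖ / ‖ζ - η‖) ∂circleMeasure ≤ L)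
    {h hs : ℂ → ℂ} (hh : DifferentiableOn ℂ h (ball 0 1)) (hb : eSupAbs h ≠ ⊤) (hbd : IsBoundaryFn h hs) :
    eSupAbs (toeplitz gs hs) ≤ (2 * L + ENNReal.ofReal B) * eSupAbs h := by
  have hA := eSup_bound hb
  obtain ⟨ha, hC⟩ := cauchy_hinf hh hA hbd
  have hi : Integrable hs circleMeasure := Integrable.of_bound (aesm_boundary hh hbd) _ ha
  refine iSup₂_le fun z hz => ?_
  have hz1 : ‖z‖ < 1 := by simpa using hz
  obtain ⟨η, hη, hzη⟩ : ∃ η : ℂ, ‖η‖ = 1 ∧ z = (‖z‖ : ℂ) * η := by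
    rcases eq_or_ne z 0 with rfl | hne
    · exact ⟨1, by simp, by simp⟩
    · have : (‖z‖:ℂ) ≠ 0 := by simpa using hne
      refine ⟨z / ‖z‖, by simp [hne], ?_⟩
      field_simp
  have h1 := toeplitz_point hB hgm hi hC (norm_nonneg z) hz1 hη
  rw [← hzη] at h1
  refine h1.trans ?_
  rw [add_mul, mul_assoc]
  refine add_le_add (mul_le_mul_right ?_ _) (mul_le_mul_right ?_ _)
  · calc _ ≤ ∫⁻ ζ, ENNReal.ofReal (‖gs ζ - gs η‖ / ‖ζ - η‖) * eSupAbs h ∂circleMeasure := by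
          apply lintegral_mono_ae
          filter_upwards [ha] with ζ hζ
          refine mul_le_mul_right ?_ _
          rwa [ENNReal.ofReal_le_iff_le_toReal hb]
      _ = (∫⁻ ζ, ENNReal.ofReal (‖gs ζ - gs η‖ / ‖ζ - η‖) ∂circleMeasure) * eSupAbs h :=
          lintegral_mul_const' _ _ hb
      _ ≤ _ := mul_le_mul_left (hL η hη) _
  · rw [ENNReal.ofReal_le_iff_le_toReal hb]
    exact hA z hz1

lemma hardy_le {h : ℂ → ℂ} {r : ℝ} (hr : r ∈ Ioo (0:ℝ) 1) :
    ∫⁻ ζ, ENNReal.ofReal ‖h (r * ζ)‖ ∂circleMeasure ≤ hardyNorm 1 h := by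
  have := le_iSup₂ (f := fun r (_ : r ∈ Ioo (0:ℝ) 1) => ∫⁻ ζ, ENNReal.ofReal (‖h (↑r * ζ)‖ ^ (1:ℝ)) ∂circleMeasure) r hr
  simpa only [hardyNorm, Real.rpow_one] using this

lemma boundary_hardy {h hs : ℂ → ℂ} (hh : DifferentiableOn ℂ h (ball 0 1)) (hbd : IsBoundaryFn h hs) :
    ∫⁻ ζ, ENNReal.ofReal ‖hs ζ‖ ∂circleMeasure ≤ hardyNorm 1 h := by
  have h1 : ∀ᵐ ζ ∂circleMeasure, ENNReal.ofReal ‖hs ζ‖ = 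
      Filter.liminf (fun n => ENNReal.ofReal ‖h (rad n * ζ)‖) Filter.atTop := by
    unfold IsBoundaryFn at hbd
    filter_upwards [hbd] with ζ hζ
    have := hζ.comp rad_tendsto
    exact ((ENNReal.continuous_ofReal.tendsto _).comp this.norm).liminf_eq.symm
  rw [lintegral_congr_ae h1]
  refine (lintegral_liminf_le' fun n => ?_).trans ?_
  · exact (aesm_dilate hh (rad_mem n)).norm.aemeasurable.ennreal_ofReal
  · refine Filter.liminf_le_of_le (by isBoundedDefault) fun b hb => ?_
    obtain ⟨n, hn⟩ := hb.exists
    exact hn.trans (hardy_le (rad_mem n))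

lemma toeplitz_h1 {gs : ℂ → ℂ} {B : ℝ} {L : ℝ≥0∞} (hB : ∀ ζ, ‖ζ‖ = 1 → ‖gs ζ‖ ≤ B)
    (hgm : AEStronglyMeasurable gs circleMeasure)
    (hL : ∀ η : ℂ, ‖η‖ = 1 → ∫⁻ ζ, ENNReal.ofReal (‖gs ζ - gs η‖ / ‖ζ - η‖) ∂circleMeasure ≤ L) 
    {h hs : ℂ → ℂ} (hh : DifferentiableOn ℂ h (ball 0 1)) (hb : hardyNorm 1 h ≠ ⊤) (hbd : IsBoundaryFn h hs)
    (hi : Integrable hs circleMeasure) :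
    hardyNorm 1 (toeplitz gs hs) ≤ (2 * L + ENNReal.ofReal B) * hardyNorm 1 h := by
  have hA : ∀ r ∈ Ioo (0:ℝ) 1, ∫ ζ, ‖h (r * ζ)‖ ∂circleMeasure ≤ (hardyNorm 1 h).toReal := by
    intro r hr
    rw [integral_eq_lintegral_of_nonneg_ae (Filter.Eventually.of_forall fun _ => norm_nonneg _)
      (aesm_dilate hh hr).norm]
    exact ENNReal.toReal_mono hb (hardy_le hr)
  have hC : ∀ z : ℂ, ‖z‖ < 1 → ∫ ζ, hs ζ / (1 - (starRingEnd ℂ) ζ * z) ∂circleMeasure = h z :=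
    fun z hz => cauchy_h1 hh hA hbd hi hz
  have hgfst : AEMeasurable (fun p : ℂ × ℂ => gs p.1) (circleMeasure.prod circleMeasure) :=
    hgm.aemeasurable.comp_quasiMeasurePreserving Measure.quasiMeasurePreserving_fst
  have hgsnd : AEMeasurable (fun p : ℂ × ℂ => gs p.2) (circleMeasure.prod circleMeasure) :=
    hgm.aemeasurable.comp_quasiMeasurePreserving Measure.quasiMeasurePreserving_snd
  have hhsnd : AEMeasurable (fun p : ℂ × ℂ => hs p.2) (circleMeasure.prod circleMeasure) :=
    hi.1.aemeasurable.comp_quasiMeasurePreserving Measure.quasiMeasurePreserving_snd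
  have hK : AEMeasurable (fun p : ℂ × ℂ => ENNReal.ofReal (‖gs p.2 - gs p.1‖ / ‖p.2 - p.1‖) * ENNReal.ofReal ‖hs p.2‖)
      (circleMeasure.prod circleMeasure) := by
    fun_prop
  refine iSup₂_le fun r hr => ?_
  simp only [Real.rpow_one]
  calc _ ≤ ∫⁻ η, (2 * (∫⁻ ζ, ENNReal.ofReal (‖gs ζ - gs η‖ / ‖ζ - η‖) * ENNReal.ofReal ‖hs ζ‖ ∂circleMeasure) +
        ENNReal.ofReal B * ENNReal.ofReal ‖h (r * η)‖) ∂circleMeasure := by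
        apply lintegral_mono_ae
        filter_upwards [ae_norm_eq_one] with η hη
        exact toeplitz_point hB hgm hi hC hr.1.le hr.2 hη
    _ = 2 * (∫⁻ η, ∫⁻ ζ, ENNReal.ofReal (‖gs ζ - gs η‖ / ‖ζ - η‖) * ENNReal.ofReal ‖hs ζ‖ ∂circleMeasure ∂circleMeasure)
        + ENNReal.ofReal B * ∫⁻ η, ENNReal.ofReal ‖h (r * η)‖ ∂circleMeasure := by
        rw [lintegral_add_right', lintegral_const_mul' _ _ (by simp), lintegral_const_mul' _ _ ENNReal.ofReal_ne_top]
        exact (aesm_dilate hh hr).norm.aemeasurable.ennreal_ofReal.const_mul _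
    _ ≤ 2 * (L * hardyNorm 1 h) + ENNReal.ofReal B * hardyNorm 1 h := by
        refine add_le_add (mul_le_mul_right ?_ _) (mul_le_mul_right (hardy_le hr) _)
        rw [lintegral_lintegral_swap hK]
        calc _ ≤ ∫⁻ ζ, L * ENNReal.ofReal ‖hs ζ‖ ∂circleMeasure := by
              apply lintegral_mono_ae
              filter_upwards [ae_norm_eq_one] with ζ hζ
              rw [lintegral_mul_const' _ _ ENNReal.ofReal_ne_top]
              refine mul_le_mul_left ?_ _
              refine le_trans (le_of_eq ?_) (hL ζ hζ)
              apply lintegral_congr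
              intro η
              rw [norm_sub_rev, norm_sub_rev ζ η]
          _ = L * ∫⁻ ζ, ENNReal.ofReal ‖hs ζ‖ ∂circleMeasure :=
              lintegral_const_mul'' _ hi.1.norm.aemeasurable.ennreal_ofReal
          _ ≤ _ := mul_le_mul_right (boundary_hardy hh hbd) _
    _ = _ := by ring

/-- **Theorem 3, second sequence.** For `ε > 0` and `α_n = 1/(log(n+2))^{1+ε}`, for every `f ∈ H^∞` the function `f*α` belongs to `𝔑` and the Toeplitz operator `T_{f*α}` is bounded on `H^1` and on `H^∞`. -/
theorem theorem3_log_sequence (ε : ℝ) (hε : 0 < ε) (f : ℂ → ℂ)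
    (hf : DifferentiableOn ℂ f (Metric.ball (0 : ℂ) 1))
    (hfb : eSupAbs f ≠ ⊤) :
    ∃ gs : ℂ → ℂ,
      IsBoundaryFn (seqConv f (fun n : ℕ => 1 / Real.log ((n : ℝ) + 2) ^ (1 + ε))) gs ∧
      DifferentiableOn ℂ (seqConv f (fun n : ℕ => 1 / Real.log ((n : ℝ) + 2) ^ (1 + ε))) (Metric.ball (0 : ℂ) 1) ∧
      eSupAbs (seqConv f (fun n : ℕ => 1 / Real.log ((n : ℝ) + 2) ^ (1 + ε))) ≠ ⊤ ∧
      Lam gs ≠ ⊤ ∧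
      ∃ C : ℝ≥0∞, C ≠ ⊤ ∧
        (∀ h hs : ℂ → ℂ,
          DifferentiableOn ℂ h (Metric.ball (0 : ℂ) 1) →
          hardyNorm 1 h ≠ ⊤ →
          IsBoundaryFn h hs →
          Integrable hs circleMeasure →
          hardyNorm 1 (toeplitz gs hs) ≤ C * hardyNorm 1 h) ∧
        (∀ h hs : ℂ → ℂ,
          DifferentiableOn ℂ h (Metric.ball (0 : ℂ) 1) →
          eSupAbs h ≠ ⊤ →
          IsBoundaryFn h hs →
          eSupAbs (toeplitz gs hs) ≤ C * eSupAbs h) := by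
  have hs : 1 < 1 + ε := by linarith
  set α : ℕ → ℝ := fun n : ℕ => 1 / Real.log ((n : ℝ) + 2) ^ (1 + ε) with hαdef
  obtain ⟨μ, hμ, hα⟩ := exists_moment (s := 1 + ε) (by linarith)
  have hα' : ∀ n : ℕ, ∫⁻ r, ENNReal.ofReal (r ^ n) ∂μ = ENNReal.ofReal (α n) := hα
  have hfin : IsFiniteMeasure μ := by
    refine ⟨?_⟩
    have h := hα 0
    simp only [pow_zero, ENNReal.ofReal_one, lintegral_const, one_mul] at h
    rw [h]
    exact ENNReal.ofReal_lt_top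
  have hα0 : ∀ n, 0 ≤ α n := by
    intro n
    have : 0 ≤ Real.log ((n:ℝ) + 2) := Real.log_nonneg (by linarith [(Nat.cast_nonneg n : (0:ℝ) ≤ n)])
    have := Real.rpow_nonneg this (1 + ε)
    simp only [hαdef]
    positivity
  have hαA : ∀ n, |α n| ≤ α 0 := by
    intro n
    rw [abs_of_nonneg (hα0 n)]
    rw [← ENNReal.ofReal_le_ofReal_iff (hα0 0), ← hα' n, ← hα' 0]
    apply lintegral_mono_ae
    filter_upwards [hμ] with r hr
    apply ENNReal.ofReal_le_ofReal
    rw [pow_zero]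
    exact pow_le_one₀ hr.1.le hr.2.le
  have hM := eSup_bound hfb
  set M := (eSupAbs f).toReal
  have heq : ∀ z : ℂ, ‖z‖ < 1 → seqConv f α z = avg μ f z :=
    fun z hz => seqConv_eq_avg hμ hf hα0 hα' hz
  have hbdry : IsBoundaryFn (seqConv f α) (avg μ f) := by
    have h := avg_boundary hμ hf hM
    unfold IsBoundaryFn at h ⊢
    filter_upwards [h, ae_norm_eq_one] with ζ hζ hn
    refine hζ.congr' ?_
    have : ∀ᶠ t : ℝ in nhdsWithin 1 (Iio 1), t ∈ Ioo (0:ℝ) 1 := Ioo_mem_nhdsLT (by norm_num)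
    filter_upwards [this] with t ht
    exact (heq _ (norm_dil ht hn.le)).symm
  have hdiff : DifferentiableOn ℂ (seqConv f α) (ball 0 1) := seqConv_differentiable hf hαA
  have hgm := aesm_boundary hdiff hbdry
  have hB : ∀ ζ : ℂ, ‖ζ‖ = 1 → ‖avg μ f ζ‖ ≤ M * μ.real univ := fun ζ hζ => avg_bound hμ hM hζ.le
  have hLt : ENNReal.ofReal (4 * M) * ∑' n : ℕ, ENNReal.ofReal (1 / ((n:ℝ) + 1)) * ENNReal.ofReal (α (2 * n)) ≠ ⊤ :=
    ENNReal.mul_ne_top ENNReal.ofReal_ne_top (tsum_alpha_ne_top hs)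
  have hL : ∀ η : ℂ, ‖η‖ = 1 → _ := fun η hη => avg_lam hμ hf hM hα' hη
  refine ⟨avg μ f, hbdry, hdiff, ?_, ?_, 2 * (ENNReal.ofReal (4 * M) *
    ∑' n : ℕ, ENNReal.ofReal (1 / ((n:ℝ) + 1)) * ENNReal.ofReal (α (2 * n))) + ENNReal.ofReal (M * μ.real univ), ?_,
    fun h k hh hb hbd hi => toeplitz_h1 hB hgm hL hh hb hbd hi,
    fun h k hh hb hbd => toeplitz_hinf hB hgm hL hh hb hbd⟩
  · refine ne_top_of_le_ne_top (ENNReal.ofReal_ne_top (r := M * μ.real univ)) (iSup₂_le fun z hz => ?_)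
    have hz1 : ‖z‖ < 1 := by simpa using hz
    rw [heq z hz1]
    exact ENNReal.ofReal_le_ofReal (avg_bound hμ hM hz1.le)
  · refine ne_top_of_le_ne_top hLt (essSup_le_of_ae_le _ ?_)
    filter_upwards [ae_norm_eq_one] with η hη
    exact hL η hη
  · exact ENNReal.add_ne_top.2 ⟨ENNReal.mul_ne_top (by simp) hLt, ENNReal.ofReal_ne_top⟩
end

section
/- (Theorem 4.) There is an absolute constant c₀ with the following property. Let α = (α_n)_{n≥0} be a monotone decreasing sequence of positive real numbers with nondecreasing successive differences (α_n − 2α_{n+1} + α_{n+2} ≥ 0 for all n) and ‖α‖ := ∑_{n≥0} α_n/(n+1) < ∞. Then for every square-summable sequence a = (a_n)_{n≥0} of complex numbers, there exists f ∈ 𝔑 (in particular f ∈ H^∞ with Λ(f) < ∞) whose Taylor coefficients satisfy |f̂(n)| ≥ α_n |a_n| for all n ≥ 0 and ‖f‖_𝔑 = ‖f‖_{H^∞} + Λ(f) ≤ c₀ ‖α‖ ‖a‖_{ℓ²}. -/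
open MeasureTheory Complex Metric Set
open scoped ENNReal

namespace Kis

open Filter Topology

instance factTwoPi : Fact (0 < 2 * Real.pi) := Fact.mk Real.two_pi_pos

/-- The circle as an additive group. -/
abbrev X : Type := AddCircle (2 * Real.pi)

/-- Normalized Haar measure. -/
noncomputable abbrev mu : Measure X := AddCircle.haarAddCircle

/-- The embedding of the circle in the plane. -/
noncomputable def E (t : X) : ℂ := fourier 1 t

lemma E_cont : Continuous E := by unfold E; fun_prop

lemma E_norm (t : X) : ‖E t‖ = 1 := by rw [E, fourier_one]; exact Circle.norm_coe _

lemma E_coe (x : ℝ) : E (x : X) = Complex.exp (x * Complex.I) := by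
  unfold E
  rw [fourier_coe_apply]
  congr 1
  have : (Real.pi : ℂ) ≠ 0 := by exact_mod_cast Real.pi_ne_zero
  push_cast
  field_simp

lemma E_add (s t : X) : E (s + t) = E s * E t := by
  simp [E, AddCircle.toCircle_add]

lemma fourier_nat (n : ℕ) (t : X) : fourier (n : ℤ) t = E t ^ n := by
  induction n with
  | zero => simp
  | succ k ih => push_cast; rw [fourier_add, ih, pow_succ]; rfl

lemma fourier_neg_nat (n : ℕ) (t : X) :
    fourier (-(n : ℤ)) t = (starRingEnd ℂ) (E t) ^ n := by
  rw [fourier_neg, fourier_nat, map_pow]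

lemma conj_mul_E (t : X) : (starRingEnd ℂ) (E t) * E t = 1 := by
  rw [mul_comm, Complex.mul_conj, Complex.normSq_eq_norm_sq, E_norm]; simp

lemma integrable_of_cont {F : Type*} [NormedAddCommGroup F] {f : X → F} (hf : Continuous f) :
    Integrable f mu :=
  hf.integrable_of_hasCompactSupport (HasCompactSupport.of_compactSpace f)

/-- mean value property -/
lemma mean_value {g : ℂ → ℂ} (hg : Differentiable ℂ g) : ∫ t, g (E t) ∂mu = g 0 := by
  have h1 := circleAverage_of_differentiable_on_off_countable (f := g) (c := 0) (R := 1)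
    (s := ∅) (by simp) hg.continuous.continuousOn (fun z _ => hg z)
  rw [← h1, Real.circleAverage_def]
  have h2 := fourierCoeff_eq_intervalIntegral (fun t : X => g (E t)) 0 0
  simp only [fourierCoeff, neg_zero, fourier_zero, one_smul, zero_add, one_div] at h2
  rw [h2]
  congr 1
  apply intervalIntegral.integral_congr
  intro x _
  simp [E_coe, circleMap]

/-- Taylor coefficient -/
noncomputable def coef (g : ℂ → ℂ) (n : ℕ) : ℂ := ∫ t, (starRingEnd ℂ) (E t) ^ n * g (E t) ∂mu

lemma cont_comp {g : ℂ → ℂ} (hg : Differentiable ℂ g) : Continuous fun t => g (E t) :=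
  hg.continuous.comp E_cont

lemma cont_coef {g : ℂ → ℂ} (hg : Differentiable ℂ g) (n : ℕ) :
    Continuous fun t => (starRingEnd ℂ) (E t) ^ n * g (E t) :=
  (((Complex.continuous_conj.comp E_cont).pow n)).mul (cont_comp hg)

lemma coef_add {g h : ℂ → ℂ} (hg : Differentiable ℂ g) (hh : Differentiable ℂ h) (n : ℕ) :
    coef (fun z => g z + h z) n = coef g n + coef h n := by
  unfold coef
  rw [← integral_add (integrable_of_cont (cont_coef hg n)) (integrable_of_cont (cont_coef hh n))]
  simp only [mul_add]

lemma coef_sub {g h : ℂ → ℂ} (hg : Differentiable ℂ g) (hh : Differentiable ℂ h) (n : ℕ) :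
    coef (fun z => g z - h z) n = coef g n - coef h n := by
  unfold coef
  rw [← integral_sub (integrable_of_cont (cont_coef hg n)) (integrable_of_cont (cont_coef hh n))]
  simp only [mul_sub]

lemma coef_shift {φ : ℂ → ℂ} (hφ : Differentiable ℂ φ) (s : ℂ) (n : ℕ) :
    coef (fun z => s * z ^ n * φ z) n = s * φ 0 := by
  unfold coef
  rw [← mean_value hφ, ← integral_const_mul]
  congr 1
  ext t
  have : (starRingEnd ℂ) (E t) ^ n * E t ^ n = 1 := by rw [← mul_pow, conj_mul_E, one_pow]
  linear_combination s * φ (E t) * this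

lemma coef_norm_le {g : ℂ → ℂ} (hb : ∀ t, ‖g (E t)‖ ≤ 1) (n : ℕ) :
    ‖coef g n‖ ≤ 1 := by
  have := norm_integral_le_of_norm_le_const (μ := mu) (C := 1)
    (f := fun t => (starRingEnd ℂ) (E t) ^ n * g (E t)) (ae_of_all _ fun t => by
      simpa [E_norm] using hb t)
  simpa [coef] using this

lemma bessel {g : ℂ → ℂ} (hg : Differentiable ℂ g) (hb : ∀ t, ‖g (E t)‖ ≤ 1) (N : ℕ) :
    ∑ n ∈ Finset.range N, ‖coef g n‖ ^ 2 ≤ 1 := by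
  let f : C(X, ℂ) := ⟨fun t => g (E t), cont_comp hg⟩
  have h := hasSum_sq_fourierCoeff (ContinuousMap.toLp (E := ℂ) 2 mu ℂ f)
  have h1 : ∫ t : X, ‖(ContinuousMap.toLp (E := ℂ) 2 mu ℂ f) t‖ ^ 2 ∂mu ≤ 1 := by
    have : ∫ t : X, ‖(ContinuousMap.toLp (E := ℂ) 2 mu ℂ f) t‖ ^ 2 ∂mu = ∫ t, ‖f t‖ ^ 2 ∂mu := by
      apply integral_congr_ae
      filter_upwards [ContinuousMap.coeFn_toLp (p := 2) (𝕜 := ℂ) mu f] with t ht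
      rw [ht]
    rw [this]
    calc ∫ t, ‖f t‖ ^ 2 ∂mu ≤ ∫ t : X, (1 : ℝ) ∂mu := by
          apply integral_mono (integrable_of_cont (by fun_prop)) (integrable_const _)
          intro t
          exact pow_le_one₀ (norm_nonneg _) (hb t)
      _ = 1 := by simp
  have h2 := sum_le_hasSum ((Finset.range N).map (Nat.castEmbedding (R := ℤ)))
    (fun i _ => by positivity) h
  rw [Finset.sum_map] at h2
  refine le_trans (le_of_eq ?_) (h2.trans h1)
  apply Finset.sum_congr rfl
  intro n _
  rw [fourierCoeff_toLp]
  simp only [fourierCoeff, coef, Nat.castEmbedding_apply, fourier_neg_nat, smul_eq_mul]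
  rfl

lemma half_poly {p : C(X, ℂ)} (hp : p ∈ Submodule.span ℂ (Set.range (@fourier (2 * Real.pi)))) :
    ∀ c : ℂ, ∃ G : ℂ → ℂ, Differentiable ℂ G ∧ ∀ t, (G (E t)).re = (c * p t).re := by
  induction hp using Submodule.span_induction with
  | mem x hx =>
    obtain ⟨n, rfl⟩ := hx
    intro c
    obtain ⟨m, rfl | rfl⟩ := Int.eq_nat_or_neg n
    · refine ⟨fun z => c * z ^ m, by fun_prop, fun t => ?_⟩
      rw [fourier_nat]
    · refine ⟨fun z => (starRingEnd ℂ) c * z ^ m, by fun_prop, fun t => ?_⟩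
      rw [fourier_neg_nat, ← Complex.conj_re]
      simp
  | zero => intro c; exact ⟨fun _ => 0, by fun_prop, by simp⟩
  | add x y _ _ hx hy =>
    intro c
    obtain ⟨G, hG, h1⟩ := hx c
    obtain ⟨H, hH, h2⟩ := hy c
    refine ⟨fun z => G z + H z, hG.add hH, fun t => ?_⟩
    rw [Complex.add_re, h1, h2, ContinuousMap.add_apply, mul_add, Complex.add_re]
  | smul a x _ hx =>
    intro c
    obtain ⟨G, hG, h1⟩ := hx (c * a)
    refine ⟨G, hG, fun t => ?_⟩
    rw [h1, ContinuousMap.smul_apply, smul_eq_mul, mul_assoc]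

/-- The penalty. -/
noncomputable def Q (w : ℂ) : ℝ := - Real.log (1 - ‖w‖ ^ 2)

lemma Q_cont {g : ℂ → ℂ} (hg : Differentiable ℂ g) (hb : ∀ t, ‖g (E t)‖ < 1) :
    Continuous fun t => Q (g (E t)) := by
  unfold Q
  refine (Continuous.log (continuous_const.sub ((cont_comp hg).norm.pow 2)) ?_).neg
  intro t
  have := hb t
  have h0 := norm_nonneg (g (E t))
  have h1 : 0 < 1 - ‖g (E t)‖ ^ 2 := by nlinarith
  exact h1.ne'

lemma Q_nonneg {w : ℂ} (hw : ‖w‖ < 1) : 0 ≤ Q w := by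
  unfold Q
  have h0 := norm_nonneg w
  have := Real.log_nonpos (x := 1 - ‖w‖ ^ 2) (by nlinarith) (by nlinarith)
  linarith

/-- Approximate outer function. -/
lemma outer_exists {g : ℂ → ℂ} (hg : Differentiable ℂ g) (hb : ∀ t, ‖g (E t)‖ < 1) :
    ∃ φ : ℂ → ℂ, Differentiable ℂ φ ∧ (∀ t, ‖φ (E t)‖ ≤ 1 - ‖g (E t)‖ ^ 2) ∧
      Real.exp (-1 - ∫ t, Q (g (E t)) ∂mu) ≤ ‖φ 0‖ := by
  let L : C(X, ℂ) := ⟨fun t => ((Q (g (E t)) + 1 / 2 : ℝ) : ℂ),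
    Complex.continuous_ofReal.comp ((Q_cont hg hb).add continuous_const)⟩
  have hL : L ∈ (Submodule.span ℂ (Set.range (@fourier (2 * Real.pi)))).topologicalClosure := by
    rw [span_fourier_closure_eq_top]; trivial
  obtain ⟨p, hp, hpL⟩ := Metric.mem_closure_iff.1 hL (1 / 2) (by norm_num)
  obtain ⟨G, hG, hre⟩ := half_poly hp 1
  have hd : ∀ t, |Q (g (E t)) + 1 / 2 - (G (E t)).re| ≤ 1 / 2 := by
    intro t
    have h1 : dist (L t) (p t) ≤ dist L p := ContinuousMap.dist_apply_le_dist t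
    rw [hre, one_mul]
    calc _ = |(L t - p t).re| := by simp [L]
      _ ≤ ‖L t - p t‖ := Complex.abs_re_le_norm _
      _ = dist (L t) (p t) := (dist_eq_norm _ _).symm
      _ ≤ _ := h1.trans hpL.le
  refine ⟨fun z => Complex.exp (-G z), by fun_prop, fun t => ?_, ?_⟩
  · rw [Complex.norm_exp]
    have h2 := (abs_le.1 (hd t)).2
    have hpos : 0 < 1 - ‖g (E t)‖ ^ 2 := by
      have := hb t
      have h0 := norm_nonneg (g (E t))
      nlinarith
    rw [← Real.exp_log hpos]
    apply Real.exp_le_exp.2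
    simp only [Complex.neg_re]
    unfold Q at h2
    linarith
  · rw [Complex.norm_exp]
    apply Real.exp_le_exp.2
    have h3 : (G 0).re = ∫ t, (G (E t)).re ∂mu := by
      rw [← mean_value hG]
      exact ((integral_re (𝕜 := ℂ) (integrable_of_cont (cont_comp hG)))).symm
    have h4 : ∫ t, (G (E t)).re ∂mu ≤ ∫ t, (Q (g (E t)) + 1) ∂mu := by
      apply integral_mono (integrable_of_cont (Complex.continuous_re.comp (cont_comp hG)))
        (integrable_of_cont ((Q_cont hg hb).add continuous_const))
      intro t
      have h2 := (abs_le.1 (hd t)).1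
      change (G (E t)).re ≤ Q (g (E t)) + 1
      linarith
    rw [integral_add (integrable_of_cont (Q_cont hg hb)) (integrable_const _)] at h4
    simp at h4
    simp only [Complex.neg_re]
    linarith

lemma pert_lt {w v : ℂ} {s : ℝ} (hw : ‖w‖ < 1) (hs : s ≤ 1 / 4)
    (hv : ‖v‖ ≤ s * (1 - ‖w‖ ^ 2)) : ‖w + v‖ < 1 := by
  have h0 := norm_nonneg w
  have := norm_add_le w v
  have h1 : s * (1 - ‖w‖ ^ 2) ≤ 1 / 4 * (1 - ‖w‖ ^ 2) :=
    mul_le_mul_of_nonneg_right hs (by nlinarith)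
  nlinarith

lemma Q_second {w v : ℂ} {s : ℝ} (hw : ‖w‖ < 1) (hs0 : 0 ≤ s) (hs : s ≤ 1 / 4)
    (hv : ‖v‖ ≤ s * (1 - ‖w‖ ^ 2)) : Q (w + v) + Q (w - v) ≤ 2 * Q w + 12 * s ^ 2 := by
  have hp := pert_lt hw hs hv
  have hm : ‖w - v‖ < 1 := by
    rw [sub_eq_add_neg]; exact pert_lt hw hs (by simpa using hv)
  have h0 := norm_nonneg w
  have hv0 := norm_nonneg v
  have a1 : 0 < 1 - ‖w + v‖ ^ 2 := by have := norm_nonneg (w + v); nlinarith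
  have a2 : 0 < 1 - ‖w - v‖ ^ 2 := by have := norm_nonneg (w - v); nlinarith
  have hd : 0 < 1 - ‖w‖ ^ 2 := by nlinarith
  set d := 1 - ‖w‖ ^ 2 with hdd
  have hd1 : d ≤ 1 := by nlinarith
  have key : d ^ 2 * (1 - 6 * s ^ 2) ≤ (1 - ‖w + v‖ ^ 2) * (1 - ‖w - v‖ ^ 2) := by
    have e1 : ‖w + v‖ ^ 2 = ‖w‖ ^ 2 + ‖v‖ ^ 2 + 2 * (w * (starRingEnd ℂ) v).re := by
      rw [← Complex.normSq_eq_norm_sq, ← Complex.normSq_eq_norm_sq, ← Complex.normSq_eq_norm_sq,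
        Complex.normSq_add]
    have e2 : ‖w - v‖ ^ 2 = ‖w‖ ^ 2 + ‖v‖ ^ 2 - 2 * (w * (starRingEnd ℂ) v).re := by
      rw [← Complex.normSq_eq_norm_sq, ← Complex.normSq_eq_norm_sq, ← Complex.normSq_eq_norm_sq,
        Complex.normSq_sub]
    set R := (w * (starRingEnd ℂ) v).re
    have hR : R ^ 2 ≤ ‖v‖ ^ 2 := by
      have : |R| ≤ ‖v‖ := (Complex.abs_re_le_norm _).trans (by
        rw [norm_mul, RCLike.norm_conj]; nlinarith)
      rw [← sq_abs R]
      exact pow_le_pow_left₀ (abs_nonneg _) this 2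
    have hv2 : ‖v‖ ^ 2 ≤ s ^ 2 * d ^ 2 := by
      rw [← mul_pow]; exact pow_le_pow_left₀ hv0 hv 2
    rw [e1, e2]
    have : (1 - (‖w‖ ^ 2 + ‖v‖ ^ 2 + 2 * R)) * (1 - (‖w‖ ^ 2 + ‖v‖ ^ 2 - 2 * R))
      = d ^ 2 - 2 * d * ‖v‖ ^ 2 + (‖v‖ ^ 2) ^ 2 - 4 * R ^ 2 := by rw [hdd]; ring
    rw [this]
    nlinarith [sq_nonneg (‖v‖ ^ 2), sq_nonneg ‖v‖]
  have hx : 0 < 1 - 6 * s ^ 2 := by nlinarith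
  have l1 := Real.log_le_log (by positivity) key
  rw [Real.log_mul (by positivity) (by positivity), Real.log_mul (by positivity) (by positivity),
    Real.log_pow] at l1
  have l2 : -(12 * s ^ 2) ≤ Real.log (1 - 6 * s ^ 2) := by
    refine le_trans ?_ (Real.one_sub_inv_le_log_of_pos hx)
    have : (1 - 6 * s ^ 2)⁻¹ ≤ 1 + 12 * s ^ 2 := by
      rw [inv_le_iff_one_le_mul₀ hx]
      nlinarith [sq_nonneg s, mul_nonneg (sq_nonneg s) (sub_nonneg.2 (show 12 * s ^ 2 ≤ 1 by nlinarith))]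
    linarith
  unfold Q
  push_cast at l1
  linarith

end Kis

namespace Kis

open Filter Topology

/-- The class of admissible functions. -/
def Adm (g : ℂ → ℂ) : Prop := Differentiable ℂ g ∧ ∀ t, ‖g (E t)‖ < 1

/-- The functional which is maximized. -/
noncomputable def W (r : ℕ → ℝ) (N : ℕ) (g : ℂ → ℂ) : ℝ :=
  ∑ n ∈ Finset.range N, r n * ‖coef g n‖ - ∫ t, Q (g (E t)) ∂mu

lemma sum_le_one {r : ℕ → ℝ} {N : ℕ} (hr : ∑ n ∈ Finset.range N, r n ^ 2 ≤ 1)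
    {g : ℂ → ℂ} (hg : Adm g) : ∑ n ∈ Finset.range N, r n * ‖coef g n‖ ≤ 1 := by
  have h := bessel hg.1 (fun t => (hg.2 t).le) N
  have : ∑ n ∈ Finset.range N, r n * ‖coef g n‖ ≤
      ∑ n ∈ Finset.range N, (r n ^ 2 / 2 + ‖coef g n‖ ^ 2 / 2) := by
    apply Finset.sum_le_sum
    intro n _
    nlinarith [sq_nonneg (r n - ‖coef g n‖)]
  rw [Finset.sum_add_distrib, ← Finset.sum_div, ← Finset.sum_div] at this
  linarith

lemma intQ_nonneg {g : ℂ → ℂ} (hg : Adm g) : 0 ≤ ∫ t, Q (g (E t)) ∂mu :=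
  integral_nonneg fun t => Q_nonneg (hg.2 t)

/-- near maximizer -/
lemma near_max (r : ℕ → ℝ) (N : ℕ) (hr : ∑ n ∈ Finset.range N, r n ^ 2 ≤ 1)
    (η : ℝ) (hη : 0 < η) : ∃ g, Adm g ∧ ∀ k, Adm k → W r N k ≤ W r N g + η := by
  have h0 : Adm (fun _ => 0) := ⟨by fun_prop, by simp⟩
  let S : Set ℝ := W r N '' {g | Adm g}
  have hbdd : BddAbove S := by
    refine ⟨1, ?_⟩
    rintro _ ⟨g, hg, rfl⟩
    have := sum_le_one hr hg
    have := intQ_nonneg hg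
    unfold W
    linarith
  have hne : S.Nonempty := ⟨_, _, h0, rfl⟩
  obtain ⟨_, ⟨g, hg, rfl⟩, hlt⟩ := exists_lt_of_lt_csSup hne (show sSup S - η < sSup S by linarith)
  refine ⟨g, hg, fun k hk => ?_⟩
  have := le_csSup hbdd (Set.mem_image_of_mem (W r N) hk)
  linarith

lemma two_le (x y : ℂ) : 2 * ‖x‖ ≤ ‖x + y‖ + ‖x - y‖ := by
  have := norm_add_le (x + y) (x - y)
  have h : x + y + (x - y) = 2 * x := by ring
  rw [h, norm_mul] at this
  simpa using this

lemma two_le' (x y : ℂ) : 2 * ‖y‖ ≤ ‖x + y‖ + ‖x - y‖ := by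
  have := two_le y x
  rwa [add_comm y x, norm_sub_rev y x] at this

set_option maxHeartbeats 1000000 in
lemma intQ_second {g u : ℂ → ℂ} (hg : Differentiable ℂ g) (_hu : Differentiable ℂ u)
    (hb : ∀ t, ‖g (E t)‖ < 1) (hP : Adm (fun z => g z + u z)) (hM : Adm (fun z => g z - u z))
    {s : ℝ} (hs0 : 0 ≤ s) (hs4 : s ≤ 1 / 4)
    (hub : ∀ t, ‖u (E t)‖ ≤ s * (1 - ‖g (E t)‖ ^ 2)) :
    ∫ t, Q (g (E t) + u (E t)) ∂mu + ∫ t, Q (g (E t) - u (E t)) ∂mu ≤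
      2 * ∫ t, Q (g (E t)) ∂mu + 12 * s ^ 2 := by
  have c1 : Integrable (fun t => Q (g (E t) + u (E t))) mu := integrable_of_cont (Q_cont hP.1 hP.2)
  have c2 : Integrable (fun t => Q (g (E t) - u (E t))) mu := integrable_of_cont (Q_cont hM.1 hM.2)
  have c3 : Integrable (fun t => Q (g (E t))) mu := integrable_of_cont (Q_cont hg hb)
  have c4 : Integrable (fun t => 2 * Q (g (E t))) mu := c3.const_mul 2
  rw [← integral_add c1 c2]
  have h : ∫ t, (2 * Q (g (E t)) + 12 * s ^ 2) ∂mu = 2 * ∫ t, Q (g (E t)) ∂mu + 12 * s ^ 2 := by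
    rw [integral_add c4 (integrable_const _), integral_const_mul]
    simp
  rw [← h]
  have c5 : Integrable (fun t => Q (g (E t) + u (E t)) + Q (g (E t) - u (E t))) mu := c1.add c2
  have c6 : Integrable (fun t => 2 * Q (g (E t)) + 12 * s ^ 2) mu := c4.add (integrable_const _)
  have hle : ∀ t, Q (g (E t) + u (E t)) + Q (g (E t) - u (E t)) ≤ 2 * Q (g (E t)) + 12 * s ^ 2 :=
    fun t => Q_second (hb t) hs0 hs4 (hub t)
  exact integral_mono c5 c6 hle

/-- Finite version of the theorem of Kislyakov. -/
lemma variational (r : ℕ → ℝ) (hr0 : ∀ n, 0 ≤ r n) (N : ℕ)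
    (hr : ∑ n ∈ Finset.range N, r n ^ 2 ≤ 1) (η : ℝ) (hη : 0 < η) (hη1 : η ≤ 1) :
    ∃ g, Adm g ∧ ∀ n < N, Real.exp (-3) ^ 2 / 24 * r n ^ 2 - η ≤ r n * ‖coef g n‖ := by
  obtain ⟨g, hg, hmax⟩ := near_max r N hr η hη
  refine ⟨g, hg, fun n hn => ?_⟩
  obtain ⟨φ, hφ, hφb, hφ0⟩ := outer_exists hg.1 hg.2
  have hQ : ∫ t, Q (g (E t)) ∂mu ≤ 2 := by
    have h := hmax (fun _ => 0) ⟨by fun_prop, by simp⟩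
    have h1 := sum_le_one hr hg
    have h0 : W r N (fun _ => 0) = 0 := by simp [W, coef, Q]
    rw [h0] at h
    unfold W at h
    linarith
  set e := Real.exp (-3) with he
  have hφe : e ≤ ‖φ 0‖ := le_trans (Real.exp_le_exp.2 (by linarith)) hφ0
  have he0 : 0 < e := Real.exp_pos _
  have he1 : e ≤ 1 := Real.exp_le_one_iff.2 (by norm_num)
  have hrn : r n ≤ 1 := by
    have h1 : r n ^ 2 ≤ 1 := le_trans
      (Finset.single_le_sum (f := fun n => r n ^ 2) (fun i _ => sq_nonneg _)
        (Finset.mem_range.2 hn)) hr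
    nlinarith [hr0 n]
  set s := e / 12 * r n with hs
  have hs0 : 0 ≤ s := mul_nonneg (by positivity) (hr0 n)
  have hs4 : s ≤ 1 / 4 := by
    have := mul_le_mul he1 hrn (hr0 n) zero_le_one
    rw [hs]; linarith
  let u : ℂ → ℂ := fun z => (s : ℂ) * z ^ n * φ z
  have hu : Differentiable ℂ u := by fun_prop
  have hub : ∀ t, ‖u (E t)‖ ≤ s * (1 - ‖g (E t)‖ ^ 2) := by
    intro t
    simp only [u, norm_mul, norm_pow, E_norm, one_pow, mul_one, Complex.norm_real,
      Real.norm_of_nonneg hs0]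
    exact mul_le_mul_of_nonneg_left (hφb t) hs0
  have hcu : ‖coef u n‖ = s * ‖φ 0‖ := by
    rw [coef_shift hφ, norm_mul, Complex.norm_real, Real.norm_of_nonneg hs0]
  have hP : Adm (fun z => g z + u z) := ⟨hg.1.add hu, fun t => pert_lt (hg.2 t) hs4 (hub t)⟩
  have hM : Adm (fun z => g z - u z) := ⟨hg.1.sub hu, fun t => by
    change ‖g (E t) - u (E t)‖ < 1
    rw [sub_eq_add_neg]; exact pert_lt (hg.2 t) hs4 (by simpa using hub t)⟩
  have h1 := hmax _ hP
  have h2 := hmax _ hM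
  have hQ2 : ∫ t, Q (g (E t) + u (E t)) ∂mu + ∫ t, Q (g (E t) - u (E t)) ∂mu ≤
      2 * ∫ t, Q (g (E t)) ∂mu + 12 * s ^ 2 := by
    exact intQ_second hg.1 hu hg.2 hP hM hs0 hs4 hub
  have hsum : 2 * ∑ m ∈ Finset.range N, r m * ‖coef g m‖ + 2 * (r n * (s * ‖φ 0‖))
      - 2 * (r n * ‖coef g n‖) ≤
      ∑ m ∈ Finset.range N, r m * ‖coef (fun z => g z + u z) m‖ +
      ∑ m ∈ Finset.range N, r m * ‖coef (fun z => g z - u z) m‖ := by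
    rw [← Finset.sum_add_distrib, ← Finset.add_sum_erase _ _ (Finset.mem_range.2 hn),
      ← Finset.add_sum_erase _ (fun m => r m * ‖coef (fun z => g z + u z) m‖ +
        r m * ‖coef (fun z => g z - u z) m‖) (Finset.mem_range.2 hn)]
    have e1 : 2 * (r n * (s * ‖φ 0‖)) ≤ r n * ‖coef (fun z => g z + u z) n‖ +
        r n * ‖coef (fun z => g z - u z) n‖ := by
      rw [coef_add hg.1 hu, coef_sub hg.1 hu, ← hcu]
      have := mul_le_mul_of_nonneg_left (two_le' (coef g n) (coef u n)) (hr0 n)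
      linarith
    have e2 : 2 * ∑ m ∈ (Finset.range N).erase n, r m * ‖coef g m‖ ≤
        ∑ m ∈ (Finset.range N).erase n, (r m * ‖coef (fun z => g z + u z) m‖ +
        r m * ‖coef (fun z => g z - u z) m‖) := by
      rw [Finset.mul_sum]
      apply Finset.sum_le_sum
      intro m _
      rw [coef_add hg.1 hu, coef_sub hg.1 hu]
      have := mul_le_mul_of_nonneg_left (two_le (coef g m) (coef u m)) (hr0 m)
      linarith
    linarith
  unfold W at h1 h2
  have h3 : r n * (s * e) ≤ r n * (s * ‖φ 0‖) :=
    mul_le_mul_of_nonneg_left (mul_le_mul_of_nonneg_left hφe hs0) (hr0 n)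
  have h4 : r n * (s * e) - 6 * s ^ 2 = e ^ 2 / 24 * r n ^ 2 := by rw [hs]; ring
  linarith

/-- Partial sums. -/
noncomputable def S (b : ℕ → ℂ) (n : ℕ) (z : ℂ) : ℂ := ∑ k ∈ Finset.range (n + 1), b k * z ^ k

/-- Unnormalized Fejer means. -/
noncomputable def T (b : ℕ → ℂ) (n : ℕ) (z : ℂ) : ℂ := ∑ k ∈ Finset.range (n + 1), S b k z

lemma coef_neg {g : ℂ → ℂ} (hg : Differentiable ℂ g) {m : ℕ} (hm : m ≠ 0) :
    ∫ t, E t ^ m * g (E t) ∂mu = 0 := by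
  have := mean_value (g := fun z => z ^ m * g z) (by fun_prop)
  rw [this]; simp [hm]

/-- Pairing with a Fejer kernel. -/
lemma pair_fejer {g : ℂ → ℂ} (hg : Differentiable ℂ g) (n : ℕ) (z : ℂ) (hz : ‖z‖ = 1) :
    ∫ t, ((‖∑ k ∈ Finset.range (n + 1), (starRingEnd ℂ) z ^ k * E t ^ k‖ ^ 2 : ℝ) : ℂ)
      * g (E t) ∂mu = T (coef g) n z := by
  have hzz : z * (starRingEnd ℂ) z = 1 := by
    rw [Complex.mul_conj, Complex.normSq_eq_norm_sq, hz]; simp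
  have h1 : ∀ t, ((‖∑ k ∈ Finset.range (n + 1), (starRingEnd ℂ) z ^ k * E t ^ k‖ ^ 2 : ℝ) : ℂ)
      * g (E t) = ∑ k ∈ Finset.range (n + 1), ∑ j ∈ Finset.range (n + 1),
        z ^ k * (starRingEnd ℂ) z ^ j * ((starRingEnd ℂ) (E t) ^ k * E t ^ j * g (E t)) := by
    intro t
    rw [← Complex.normSq_eq_norm_sq, ← Complex.mul_conj, map_sum, mul_comm (Finset.sum _ _),
      Finset.sum_mul_sum, Finset.sum_mul]
    apply Finset.sum_congr rfl
    intro k _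
    rw [Finset.sum_mul]
    apply Finset.sum_congr rfl
    intro j _
    simp only [map_mul, map_pow, Complex.conj_conj]
    ring
  have hc : ∀ k j : ℕ, Integrable (fun t => z ^ k * (starRingEnd ℂ) z ^ j *
      ((starRingEnd ℂ) (E t) ^ k * E t ^ j * g (E t))) mu := by
    intro k j
    apply integrable_of_cont
    exact continuous_const.mul ((((Complex.continuous_conj.comp E_cont).pow k).mul
      (E_cont.pow j)).mul (cont_comp hg))
  simp only [h1]
  rw [integral_finsetSum _ (fun k _ => integrable_finsetSum _ (fun j _ => hc k j))]
  unfold T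
  apply Finset.sum_congr rfl
  intro k hk
  rw [integral_finsetSum _ (fun j _ => hc k j)]
  have hkn : k + 1 ≤ n + 1 := by have := Finset.mem_range.1 hk; omega
  rw [← Finset.sum_range_add_sum_Ico _ hkn]
  have hz0 : ∑ j ∈ Finset.Ico (k + 1) (n + 1), ∫ t, z ^ k * (starRingEnd ℂ) z ^ j *
      ((starRingEnd ℂ) (E t) ^ k * E t ^ j * g (E t)) ∂mu = 0 := by
    apply Finset.sum_eq_zero
    intro j hj
    obtain ⟨m, rfl⟩ : ∃ m, j = k + m := ⟨j - k, by have := Finset.mem_Ico.1 hj; omega⟩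
    have hm : m ≠ 0 := by have := Finset.mem_Ico.1 hj; omega
    rw [integral_const_mul]
    have : ∀ t, (starRingEnd ℂ) (E t) ^ k * E t ^ (k + m) * g (E t) = E t ^ m * g (E t) := by
      intro t
      have h : (starRingEnd ℂ) (E t) ^ k * E t ^ k = 1 := by rw [← mul_pow, conj_mul_E, one_pow]
      rw [pow_add]
      linear_combination E t ^ m * g (E t) * h
    simp only [this, coef_neg hg hm, mul_zero]
  rw [hz0, add_zero, ← Finset.sum_range_reflect]
  unfold S
  apply Finset.sum_congr rfl
  intro i hi
  have hi' : i ≤ k := by have := Finset.mem_range.1 hi; omega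
  obtain ⟨m, rfl⟩ := Nat.exists_eq_add_of_le hi'
  have e1 : i + m + 1 - 1 - i = m := by omega
  rw [e1, integral_const_mul, coef]
  have : ∀ t, (starRingEnd ℂ) (E t) ^ (i + m) * E t ^ m * g (E t) =
      (starRingEnd ℂ) (E t) ^ i * g (E t) := by
    intro t
    have h : (starRingEnd ℂ) (E t) ^ m * E t ^ m = 1 := by rw [← mul_pow, conj_mul_E, one_pow]
    rw [pow_add]
    linear_combination (starRingEnd ℂ) (E t) ^ i * g (E t) * h
  simp only [this]
  have h : z ^ m * (starRingEnd ℂ) z ^ m = 1 := by rw [← mul_pow, hzz, one_pow]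
  rw [pow_add]
  linear_combination (z ^ i * ∫ t, (starRingEnd ℂ) (E t) ^ i * g (E t) ∂mu) * h

lemma coef_one (n : ℕ) : coef (fun _ => 1) n = if n = 0 then 1 else 0 := by
  unfold coef
  split_ifs with h
  · simp [h]
  · have := coef_neg (g := fun _ => 1) (by fun_prop) h
    have h2 : ∀ t, (starRingEnd ℂ) (E t) ^ n * 1 = (starRingEnd ℂ) (E t ^ n * 1) := by
      intro t; simp
    simp only [h2]
    rw [integral_conj, this, map_zero]

lemma fejer_bound_circle {g : ℂ → ℂ} (hg : Adm g) (n : ℕ) (z : ℂ) (hz : ‖z‖ = 1) :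
    ‖T (coef g) n z‖ ≤ n + 1 := by
  rw [← pair_fejer hg.1 n z hz]
  have hcK : Continuous fun t =>
      ‖∑ k ∈ Finset.range (n + 1), (starRingEnd ℂ) z ^ k * E t ^ k‖ ^ 2 := by
    have := E_cont
    fun_prop
  have h1 := pair_fejer (g := fun _ => 1) (by fun_prop) n z hz
  have h2 : T (coef fun _ => 1) n z = (n : ℂ) + 1 := by
    unfold T S
    simp only [coef_one]
    simp
  rw [h2] at h1
  simp only [mul_one] at h1
  rw [integral_complex_ofReal] at h1
  have h3 : ∫ t, ‖∑ k ∈ Finset.range (n + 1), (starRingEnd ℂ) z ^ k * E t ^ k‖ ^ 2 ∂mu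
      = (n : ℝ) + 1 := by exact_mod_cast h1
  rw [← h3]
  apply norm_integral_le_of_norm_le (integrable_of_cont hcK)
  apply ae_of_all
  intro t
  rw [norm_mul, Complex.norm_real, Real.norm_of_nonneg (by positivity)]
  exact mul_le_of_le_one_right (by positivity) (hg.2 t).le

lemma T_diff (b : ℕ → ℂ) (n : ℕ) : Differentiable ℂ (T b n) := by
  unfold T S; fun_prop

lemma fejer_bound {g : ℂ → ℂ} (hg : Adm g) (n : ℕ) (z : ℂ) (hz : ‖z‖ ≤ 1) :
    ‖T (coef g) n z‖ ≤ n + 1 := by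
  refine Complex.norm_le_of_forall_mem_frontier_norm_le (U := Metric.ball 0 1)
    Metric.isBounded_ball ((T_diff (coef g) n).diffContOnCl) ?_ ?_
  · intro w hw
    rw [frontier_ball _ one_ne_zero] at hw
    exact fejer_bound_circle hg n w (by simpa using hw)
  · rw [closure_ball _ one_ne_zero]; simpa using hz

/-- The theorem of Kislyakov, in terms of coefficients and Fejer means. -/
lemma kislyakov : ∃ c : ℝ, 0 < c ∧ ∀ r : ℕ → ℝ, (∀ n, 0 ≤ r n) →
    (∀ N, ∑ n ∈ Finset.range N, r n ^ 2 ≤ 1) →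
    ∃ b : ℕ → ℂ, (∀ n, ‖b n‖ ≤ 1) ∧ (∀ n, c * r n ≤ ‖b n‖) ∧
      ∀ n z, ‖z‖ ≤ 1 → ‖T b n z‖ ≤ n + 1 := by
  refine ⟨Real.exp (-3) ^ 2 / 24, by positivity, fun r hr0 hr => ?_⟩
  set c := Real.exp (-3) ^ 2 / 24
  have hv := fun N : ℕ => variational r hr0 N (hr N) (1 / ((N : ℝ) + 1)) (by positivity)
    (by rw [div_le_one (by positivity)]; linarith [Nat.cast_nonneg (α := ℝ) N])
  choose g hg hgc using hv
  have hcomp : IsCompact (Set.univ.pi fun _ : ℕ => Metric.closedBall (0 : ℂ) 1) :=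
    isCompact_univ_pi fun _ => isCompact_closedBall _ _
  obtain ⟨b, hb, ψ, hψ, hlim⟩ := hcomp.tendsto_subseq (x := fun N => coef (g N))
    (fun N n _ => by simpa using coef_norm_le (fun t => ((hg N).2 t).le) n)
  have hl : ∀ n, Tendsto (fun j => coef (g (ψ j)) n) atTop (𝓝 (b n)) := fun n =>
    (tendsto_pi_nhds.1 hlim) n
  refine ⟨b, fun n => by simpa using hb n trivial, fun n => ?_, fun n z hz => ?_⟩
  · rcases (hr0 n).eq_or_lt with h0 | h0
    · rw [← h0]; simp
    have h1 : Tendsto (fun j => r n * ‖coef (g (ψ j)) n‖) atTop (𝓝 (r n * ‖b n‖)) :=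
      ((hl n).norm).const_mul _
    have h2 : Tendsto (fun j => c * r n ^ 2 - 1 / (((ψ j : ℕ) : ℝ) + 1)) atTop
        (𝓝 (c * r n ^ 2 - 0)) :=
      (tendsto_one_div_add_atTop_nhds_zero_nat.comp hψ.tendsto_atTop).const_sub _
    have h3 := le_of_tendsto_of_tendsto h2 h1 (by
      filter_upwards [eventually_gt_atTop n] with j hj
      exact hgc (ψ j) n (lt_of_lt_of_le hj hψ.le_apply))
    nlinarith
  · have h1 : Tendsto (fun j => T (coef (g (ψ j))) n z) atTop (𝓝 (T b n z)) := by
      unfold T S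
      exact tendsto_finsetSum _ fun k _ => tendsto_finsetSum _ fun i _ => (hl i).mul_const _
    exact le_of_tendsto h1.norm (Eventually.of_forall fun j => fejer_bound (hg (ψ j)) n z hz)

end Kis

namespace Kis

open Filter Topology

lemma abel {R : Type*} [CommRing R] (x v : ℕ → R) (N : ℕ) :
    ∑ n ∈ Finset.range N, (x n - x (n + 1)) * ∑ k ∈ Finset.range (n + 1), v k =
      ∑ n ∈ Finset.range N, x n * v n - x N * ∑ k ∈ Finset.range N, v k := by
  induction N with
  | zero => simp
  | succ N ih =>
    rw [Finset.sum_range_succ, ih, Finset.sum_range_succ (fun n => x n * v n),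
      Finset.sum_range_succ v]
    ring

/-- Real harmonic numbers. -/
noncomputable def H (n : ℕ) : ℝ := ∑ k ∈ Finset.range (n + 1), 1 / ((k : ℝ) + 1)

lemma H_ge_one (n : ℕ) : 1 ≤ H n := by
  have := Finset.single_le_sum (f := fun k : ℕ => 1 / ((k : ℝ) + 1)) (s := Finset.range (n + 1))
    (fun i _ => by positivity) (Finset.mem_range.2 (Nat.succ_pos n))
  simpa [H] using this

lemma log_le_H (n : ℕ) : Real.log ((n : ℝ) + 1) ≤ H n := by
  have h := log_add_one_le_harmonic (n + 1)
  have h2 : ((harmonic (n + 1) : ℚ) : ℝ) = H n := by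
    simp [harmonic, H]
  rw [h2] at h
  refine le_trans (Real.log_le_log (by positivity) ?_) h
  push_cast
  linarith

lemma H_sum (n : ℕ) : ((n : ℝ) + 1) * H n ≤ ∑ k ∈ Finset.range (n + 1), 2 * H k := by
  induction n with
  | zero => simp [H]
  | succ n ih =>
    rw [Finset.sum_range_succ]
    have h : H (n + 1) = H n + 1 / ((n : ℝ) + 1 + 1) := by
      unfold H; rw [Finset.sum_range_succ _ (n + 1)]; push_cast; rfl
    have h1 := H_ge_one n
    have h2 : ((n : ℝ) + 1 + 1) * (1 / ((n : ℝ) + 1 + 1)) = 1 := by field_simp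
    have h3 : 0 ≤ 1 / ((n : ℝ) + 1 + 1) := by positivity
    push_cast
    have h4 : ((n : ℝ) + 1 + 1) * H (n + 1) = ((n : ℝ) + 1) * H n + H n + 1 := by
      rw [h, mul_add, h2]; ring
    rw [h4]
    linarith

/-- First differences. -/
def d (α : ℕ → ℝ) (n : ℕ) : ℝ := α n - α (n + 1)

/-- Second differences. -/
def D (α : ℕ → ℝ) (n : ℕ) : ℝ := d α n - d α (n + 1)

/-- Admissible weights. -/
structure Wt (α : ℕ → ℝ) : Prop where
  nonneg : ∀ n, 0 ≤ α n
  dec : ∀ n, α (n + 1) ≤ α n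
  conv : ∀ n, 0 ≤ α n - 2 * α (n + 1) + α (n + 2)
  summ : Summable fun n => α n / ((n : ℝ) + 1)

variable {α : ℕ → ℝ}

lemma Wt.d_nonneg (h : Wt α) (n : ℕ) : 0 ≤ d α n := sub_nonneg.2 (h.dec n)

lemma Wt.D_nonneg (h : Wt α) (n : ℕ) : 0 ≤ D α n := by
  have := h.conv n
  unfold D d
  linarith

/-- The norm of the weight. -/
noncomputable def nrm (α : ℕ → ℝ) : ℝ := ∑' n, α n / ((n : ℝ) + 1)

lemma Wt.partial_le (h : Wt α) (N : ℕ) :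
    ∑ n ∈ Finset.range N, α n / ((n : ℝ) + 1) ≤ nrm α :=
  h.summ.sum_le_tsum _ (fun i _ => div_nonneg (h.nonneg i) (by positivity))

lemma Wt.zero_le_nrm (h : Wt α) : α 0 ≤ nrm α := by simpa using h.partial_le 1

lemma Wt.sum_one (h : Wt α) (N : ℕ) :
    ∑ n ∈ Finset.range N, D α n * ((n : ℝ) + 1) ≤ nrm α := by
  have h1 := abel (d α) (fun _ => (1 : ℝ)) N
  have h2 := abel α (fun n => if n = 0 then (1 : ℝ) else 0) N
  simp at h1
  have h3 : ∑ n ∈ Finset.range N, d α n = α 0 - α N := by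
    exact Finset.sum_range_sub' α N
  have h4 := h.d_nonneg N
  have h5 := h.nonneg N
  have h6 := h.zero_le_nrm
  have h7 : 0 ≤ d α N * N := by positivity
  unfold D
  linarith

lemma Wt.sum_H (h : Wt α) (N : ℕ) :
    ∑ n ∈ Finset.range N, D α n * (((n : ℝ) + 1) * H n) ≤ 2 * nrm α := by
  have h1 := abel (d α) (fun k => 2 * H k) N
  have h2 := abel α (fun k => 1 / ((k : ℝ) + 1)) N
  have h3 : ∑ n ∈ Finset.range N, D α n * (((n : ℝ) + 1) * H n) ≤
      ∑ n ∈ Finset.range N, (d α n - d α (n + 1)) * ∑ k ∈ Finset.range (n + 1), 2 * H k :=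
    Finset.sum_le_sum fun n _ => mul_le_mul_of_nonneg_left (H_sum n) (h.D_nonneg n)
  have h4 : 0 ≤ d α N * ∑ k ∈ Finset.range N, 2 * H k :=
    mul_nonneg (h.d_nonneg N) (Finset.sum_nonneg fun k _ => by linarith [H_ge_one k])
  have h5 : 0 ≤ α N * ∑ k ∈ Finset.range N, 1 / ((k : ℝ) + 1) :=
    mul_nonneg (h.nonneg N) (Finset.sum_nonneg fun k _ => by positivity)
  have h6 := h.partial_le N
  have h7 : ∑ n ∈ Finset.range N, d α n * (2 * H n) =
      2 * ∑ n ∈ Finset.range N, (α n - α (n + 1)) * ∑ k ∈ Finset.range (n + 1), 1 / ((k : ℝ) + 1) := by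
    rw [Finset.mul_sum]
    apply Finset.sum_congr rfl
    intro n _
    unfold d H
    ring
  have h8 : ∑ n ∈ Finset.range N, α n * (1 / ((n : ℝ) + 1)) =
      ∑ n ∈ Finset.range N, α n / ((n : ℝ) + 1) := by
    simp only [mul_one_div]
  linarith

lemma Wt.anti (h : Wt α) : Antitone α := antitone_nat_of_succ_le h.dec

lemma Wt.tendsto_zero (h : Wt α) : Tendsto α atTop (𝓝 0) := by
  have hb : ∀ n, α n * Real.log ((n : ℝ) + 1) ≤ nrm α := by
    intro n
    refine le_trans (mul_le_mul_of_nonneg_left (log_le_H n) (h.nonneg n)) ?_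
    refine le_trans ?_ (h.partial_le (n + 1))
    unfold H
    rw [Finset.mul_sum]
    apply Finset.sum_le_sum
    intro k hk
    rw [mul_one_div]
    have : k ≤ n := by have := Finset.mem_range.1 hk; omega
    exact div_le_div_of_nonneg_right (h.anti this) (by positivity)
  have hlog : Tendsto (fun n : ℕ => Real.log ((n : ℝ) + 1)) atTop atTop :=
    Real.tendsto_log_atTop.comp (tendsto_atTop_add_const_right _ _ tendsto_natCast_atTop_atTop)
  have hl : Tendsto (fun n : ℕ => nrm α / Real.log ((n : ℝ) + 1)) atTop (𝓝 0) :=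
    tendsto_const_nhds.div_atTop hlog
  refine tendsto_of_tendsto_of_tendsto_of_le_of_le' tendsto_const_nhds hl
    (Eventually.of_forall h.nonneg) ?_
  filter_upwards [hlog.eventually_gt_atTop 0] with n hn
  rw [le_div_iff₀ hn]
  exact hb n

lemma Wt.d_bound (h : Wt α) (m j : ℕ) : (j : ℝ) * d α (m + j) ≤ α m - α (m + j) := by
  induction j with
  | zero => simp
  | succ j ih =>
    have h1 := h.D_nonneg (m + j)
    have h2 : d α (m + j) = α (m + j) - α (m + (j + 1)) := rfl
    have h3 : D α (m + j) = d α (m + j) - d α (m + (j + 1)) := rfl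
    have h4 : d α (m + (j + 1)) ≤ d α (m + j) := by linarith
    have h5 := mul_le_mul_of_nonneg_left h4 (show (0 : ℝ) ≤ (j : ℝ) + 1 by positivity)
    push_cast
    linarith

lemma Wt.d_tendsto (h : Wt α) : Tendsto (fun n : ℕ => d α n * n) atTop (𝓝 0) := by
  have h1 : Tendsto (fun n : ℕ => 2 * α (n / 2)) atTop (𝓝 (2 * 0)) :=
    (h.tendsto_zero.comp (Nat.tendsto_div_const_atTop two_ne_zero)).const_mul 2
  rw [mul_zero] at h1
  refine tendsto_of_tendsto_of_tendsto_of_le_of_le tendsto_const_nhds h1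
    (fun n => mul_nonneg (h.d_nonneg n) (by positivity)) fun n => ?_
  have h2 := h.d_bound (n / 2) (n - n / 2)
  have h3 : n / 2 + (n - n / 2) = n := by omega
  rw [h3] at h2
  have h4 : (n : ℝ) ≤ 2 * ((n - n / 2 : ℕ) : ℝ) := by
    have : n ≤ 2 * (n - n / 2) := by omega
    exact_mod_cast this
  have h5 := mul_le_mul_of_nonneg_left h4 (h.d_nonneg n)
  have h6 := h.nonneg n
  simp only
  linarith

/-- The function. -/
noncomputable def FF (α : ℕ → ℝ) (b : ℕ → ℂ) (z : ℂ) : ℂ := ∑' n, (D α n : ℂ) * T b n z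

lemma Wt.summ_D (h : Wt α) : Summable fun n => D α n * ((n : ℝ) + 1) :=
  summable_of_sum_range_le (fun n => mul_nonneg (h.D_nonneg n) (by positivity)) h.sum_one

lemma term_le (h : Wt α) {b : ℕ → ℂ} (hT : ∀ n z, ‖z‖ ≤ 1 → ‖T b n z‖ ≤ n + 1) (n : ℕ) (z : ℂ)
    (hz : ‖z‖ ≤ 1) : ‖(D α n : ℂ) * T b n z‖ ≤ D α n * ((n : ℝ) + 1) := by
  rw [norm_mul, Complex.norm_real, Real.norm_of_nonneg (h.D_nonneg n)]
  exact mul_le_mul_of_nonneg_left (hT n z hz) (h.D_nonneg n)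

lemma FF_norm (h : Wt α) {b : ℕ → ℂ} (hT : ∀ n z, ‖z‖ ≤ 1 → ‖T b n z‖ ≤ n + 1) (z : ℂ)
    (hz : ‖z‖ ≤ 1) : ‖FF α b z‖ ≤ nrm α := by
  refine le_trans (tsum_of_norm_bounded h.summ_D.hasSum (fun n => term_le h hT n z hz)) ?_
  exact h.summ_D.tsum_le_of_sum_range_le h.sum_one

lemma FF_diff (h : Wt α) {b : ℕ → ℂ} (hT : ∀ n z, ‖z‖ ≤ 1 → ‖T b n z‖ ≤ n + 1) :
    DifferentiableOn ℂ (FF α b) (Metric.ball 0 1) := by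
  apply Complex.differentiableOn_tsum_of_summable_norm h.summ_D
  · intro n
    exact ((T_diff b n).const_mul _).differentiableOn
  · exact Metric.isOpen_ball
  · intro n z hz
    exact term_le h hT n z (by simpa using (Metric.mem_ball.1 hz).le)

lemma FF_cont (h : Wt α) {b : ℕ → ℂ} (hT : ∀ n z, ‖z‖ ≤ 1 → ‖T b n z‖ ≤ n + 1) :
    ContinuousOn (FF α b) (Metric.closedBall 0 1) := by
  apply continuousOn_tsum _ h.summ_D
  · intro n z hz
    exact term_le h hT n z (by simpa using hz)
  · intro n
    exact ((T_diff b n).const_mul _).continuous.continuousOn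

lemma FF_hasSum (h : Wt α) {b : ℕ → ℂ} (hb : ∀ n, ‖b n‖ ≤ 1)
    (hT : ∀ n z, ‖z‖ ≤ 1 → ‖T b n z‖ ≤ n + 1) (z : ℂ) (hz : ‖z‖ < 1) :
    HasSum (fun n => (α n : ℂ) * b n * z ^ n) (FF α b z) := by
  have hgeo := summable_geometric_of_lt_one (norm_nonneg z) hz
  have hbz : ∀ n, ‖b n * z ^ n‖ ≤ ‖z‖ ^ n := by
    intro n
    rw [norm_mul, norm_pow]
    exact mul_le_of_le_one_left (by positivity) (hb n)
  have hs : Summable (fun n => (α n : ℂ) * b n * z ^ n) := by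
    apply Summable.of_norm_bounded (hgeo.mul_left (α 0))
    intro n
    rw [mul_assoc, norm_mul, Complex.norm_real, Real.norm_of_nonneg (h.nonneg n)]
    exact mul_le_mul (h.anti (Nat.zero_le n)) (hbz n) (norm_nonneg _) (h.nonneg 0)
  have hsb : Summable (fun n => b n * z ^ n) := Summable.of_norm_bounded hgeo hbz
  have hsF : Summable (fun n => (D α n : ℂ) * T b n z) :=
    Summable.of_norm_bounded h.summ_D (fun n => term_le h hT n z hz.le)
  have l1 := hsF.hasSum.tendsto_sum_nat
  have l2 := hs.hasSum.tendsto_sum_nat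
  have l3 : Tendsto (fun N => (α N : ℂ) * ∑ k ∈ Finset.range N, b k * z ^ k) atTop (𝓝 0) := by
    have h0 : Tendsto (fun N => (α N : ℂ)) atTop (𝓝 0) := by
      have := (Complex.continuous_ofReal.tendsto 0).comp h.tendsto_zero
      rw [Complex.ofReal_zero] at this
      exact this
    simpa using h0.mul hsb.hasSum.tendsto_sum_nat
  have l4 : Tendsto (fun N => (d α N : ℂ) * ∑ k ∈ Finset.range N, S b k z) atTop (𝓝 0) := by
    apply squeeze_zero_norm _ h.d_tendsto
    intro N
    rw [norm_mul, Complex.norm_real, Real.norm_of_nonneg (h.d_nonneg N)]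
    apply mul_le_mul_of_nonneg_left _ (h.d_nonneg N)
    cases N with
    | zero => simp
    | succ N => have := hT N z hz.le; unfold T at this; exact_mod_cast this
  have key : ∀ N, ∑ n ∈ Finset.range N, (D α n : ℂ) * T b n z =
      ∑ n ∈ Finset.range N, (α n : ℂ) * b n * z ^ n
      - (α N : ℂ) * ∑ k ∈ Finset.range N, b k * z ^ k
      - (d α N : ℂ) * ∑ k ∈ Finset.range N, S b k z := by
    intro N
    have a1 := abel (fun n => (d α n : ℂ)) (fun k => S b k z) N
    have a2 := abel (fun n => (α n : ℂ)) (fun k => b k * z ^ k) N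
    have e1 : ∑ n ∈ Finset.range N, (D α n : ℂ) * T b n z = ∑ n ∈ Finset.range N,
        ((d α n : ℂ) - (d α (n + 1) : ℂ)) * ∑ k ∈ Finset.range (n + 1), S b k z := by
      apply Finset.sum_congr rfl
      intro n _
      simp [D, T]
    have e2 : ∑ n ∈ Finset.range N, (d α n : ℂ) * S b n z = ∑ n ∈ Finset.range N,
        ((α n : ℂ) - (α (n + 1) : ℂ)) * ∑ k ∈ Finset.range (n + 1), b k * z ^ k := by
      apply Finset.sum_congr rfl
      intro n _
      simp [d, S]
    rw [e1, a1, e2, a2]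
    simp only [mul_assoc]
  simp only [key] at l1
  have l5 := (l2.sub l3).sub l4
  have := tendsto_nhds_unique l1 l5
  rw [sub_zero, sub_zero] at this
  have e : FF α b z = ∑' n, (α n : ℂ) * b n * z ^ n := this
  rw [e]
  exact hs.hasSum

lemma FF_coeff (h : Wt α) {b : ℕ → ℂ} (hb : ∀ n, ‖b n‖ ≤ 1)
    (hT : ∀ n z, ‖z‖ ≤ 1 → ‖T b n z‖ ≤ n + 1) (n : ℕ) :
    taylorCoeff (FF α b) n = (α n : ℂ) * b n := by
  have h1 : HasFPowerSeriesAt (FF α b)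
      (FormalMultilinearSeries.ofScalars ℂ (fun n => (α n : ℂ) * b n)) 0 := by
    rw [hasFPowerSeriesAt_iff]
    filter_upwards [Metric.ball_mem_nhds (0 : ℂ) one_pos] with z hz
    rw [zero_add]
    have := FF_hasSum h hb hT z (by simpa using hz)
    simpa only [FormalMultilinearSeries.coeff_ofScalars, smul_eq_mul, mul_comm] using this
  have h2 := h1.analyticAt.hasFPowerSeriesAt
  have h3 := congrArg (fun p => p.coeff n) (h1.eq_formalMultilinearSeries h2)
  simp only [FormalMultilinearSeries.coeff_ofScalars] at h3
  exact h3.symm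

end Kis

namespace Kis

open Filter Topology

lemma lint_eq (a : ℝ) (f : X → ℝ≥0∞) :
    ∫⁻ t, f t ∂mu =
      (ENNReal.ofReal (2 * Real.pi))⁻¹ * ∫⁻ x in Set.Ioc a (a + 2 * Real.pi), f (x : X) := by
  rw [AddCircle.lintegral_preimage (2 * Real.pi) a f, AddCircle.volume_eq_smul_haarAddCircle,
    lintegral_smul_measure, smul_eq_mul, ← mul_assoc, ENNReal.inv_mul_cancel, one_mul]
  · simpa using Real.pi_pos
  · exact ENNReal.ofReal_ne_top

lemma circle_le (f : ℂ → ℝ≥0∞) : ∫⁻ z, f z ∂circleMeasure ≤ ∫⁻ t, f (E t) ∂mu := by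
  unfold circleMeasure
  refine le_trans (lintegral_map_le _ _) ?_
  rw [lintegral_smul_measure, lint_eq 0, smul_eq_mul, zero_add]
  simp only [E_coe]
  exact le_rfl

lemma chord (x : ℝ) (hx : |x| ≤ Real.pi) : 2 / Real.pi * |x| ≤ ‖E (x : X) - 1‖ := by
  rw [E_coe, mul_comm (x : ℂ), Complex.norm_exp_I_mul_ofReal_sub_one, norm_mul, Real.norm_eq_abs,
    Real.norm_eq_abs, abs_two]
  have h := Real.mul_abs_le_abs_sin (x := x / 2) (by rw [abs_div, abs_two]; linarith)
  rw [abs_div, abs_two] at h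
  have : 2 / Real.pi * (|x| / 2) = 2 / Real.pi * |x| / 2 := by ring
  linarith

lemma int_abs {ε : ℝ} (hε : 0 < ε) :
    ∫ x in (-Real.pi)..Real.pi, (|x| + ε)⁻¹ = 2 * Real.log ((Real.pi + ε) / ε) := by
  have hc : Continuous fun x : ℝ => (|x| + ε)⁻¹ := by
    apply Continuous.inv₀ (by fun_prop)
    intro x
    have := abs_nonneg x
    linarith
  rw [← intervalIntegral.integral_add_adjacent_intervals (b := 0)
    (hc.intervalIntegrable _ _) (hc.intervalIntegrable _ _)]
  have h1 : ∫ x in (0 : ℝ)..Real.pi, (|x| + ε)⁻¹ = Real.log ((Real.pi + ε) / ε) := by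
    have : ∫ x in (0 : ℝ)..Real.pi, (|x| + ε)⁻¹ = ∫ x in (0 : ℝ)..Real.pi, (x + ε)⁻¹ := by
      apply intervalIntegral.integral_congr
      intro x hx
      rw [Set.uIcc_of_le Real.pi_pos.le] at hx
      simp only [abs_of_nonneg hx.1]
    rw [this, intervalIntegral.integral_comp_add_right (fun x => x⁻¹), zero_add,
      integral_inv_of_pos hε (by linarith [Real.pi_pos])]
  have h2 : ∫ x in (-Real.pi)..0, (|x| + ε)⁻¹ = ∫ x in (0 : ℝ)..Real.pi, (|x| + ε)⁻¹ := by
    have := intervalIntegral.integral_comp_neg (a := 0) (b := Real.pi) (fun x : ℝ => (|x| + ε)⁻¹)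
    simp only [abs_neg, neg_zero] at this
    exact this.symm
  rw [h2, h1]
  ring

lemma kernel_int {ε : ℝ} (hε : 0 < ε) :
    ∫⁻ t, ENNReal.ofReal (4 / (‖E t - 1‖ + 2 * ε)) ∂mu ≤
      ENNReal.ofReal (2 * Real.log ((Real.pi + ε) / ε)) := by
  have hpi := Real.pi_pos
  have hc : Continuous fun x : ℝ => (|x| + ε)⁻¹ := by
    apply Continuous.inv₀ (by fun_prop)
    intro x
    have := abs_nonneg x
    linarith
  rw [lint_eq (-Real.pi)]
  have e : -Real.pi + 2 * Real.pi = Real.pi := by ring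
  rw [e]
  have h1 : ∫⁻ x in Set.Ioc (-Real.pi) Real.pi,
      ENNReal.ofReal (4 / (‖E (x : X) - 1‖ + 2 * ε)) ≤
      ∫⁻ x in Set.Ioc (-Real.pi) Real.pi,
        ENNReal.ofReal (2 * Real.pi) * ENNReal.ofReal ((|x| + ε)⁻¹) := by
    apply setLIntegral_mono' measurableSet_Ioc
    intro x hx
    rw [← ENNReal.ofReal_mul (by positivity)]
    apply ENNReal.ofReal_le_ofReal
    have h := chord x (abs_le.2 ⟨hx.1.le, hx.2⟩)
    have hx0 := abs_nonneg x
    rw [← div_eq_mul_inv, div_le_div_iff₀ (by positivity) (by positivity)]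
    have h2 := mul_le_mul_of_nonneg_left h (show (0 : ℝ) ≤ 2 * Real.pi by positivity)
    have h3 : 2 * Real.pi * (2 / Real.pi * |x|) = 4 * |x| := by field_simp; ring
    have h4 : (3 : ℝ) < Real.pi := Real.pi_gt_three
    nlinarith
  refine le_trans (mul_le_mul_right h1 _) ?_
  rw [lintegral_const_mul' _ _ ENNReal.ofReal_ne_top, ← mul_assoc, ENNReal.inv_mul_cancel, one_mul]
  · rw [← int_abs hε, intervalIntegral.integral_of_le (by linarith)]
    rw [ofReal_integral_eq_lintegral_ofReal]
    · exact (hc.intervalIntegrable (-Real.pi) Real.pi).1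
    · exact Eventually.of_forall fun x => by positivity
  · simpa using Real.pi_pos
  · exact ENNReal.ofReal_ne_top

/-- The kernel. -/
noncomputable def KK (n : ℕ) (t : X) : ℝ := 4 / (‖E t - 1‖ + 2 * (1 / ((n : ℝ) + 1) ^ 2))

lemma KK_int (n : ℕ) : ∫⁻ t, ENNReal.ofReal (KK n t) ∂mu ≤ ENNReal.ofReal (12 * H n) := by
  refine le_trans (kernel_int (by positivity)) (ENNReal.ofReal_le_ofReal ?_)
  have h1 := H_ge_one n
  have h2 := log_le_H n
  have hpi := Real.pi_lt_four
  have hpi0 := Real.pi_pos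
  have hn : (1 : ℝ) ≤ (n : ℝ) + 1 := by linarith [show (0 : ℝ) ≤ n from Nat.cast_nonneg n]
  have e : (Real.pi + 1 / ((n : ℝ) + 1) ^ 2) / (1 / ((n : ℝ) + 1) ^ 2) =
      Real.pi * ((n : ℝ) + 1) ^ 2 + 1 := by field_simp
  rw [e]
  have h3 : Real.log (Real.pi * ((n : ℝ) + 1) ^ 2 + 1) ≤ Real.log (5 * ((n : ℝ) + 1) ^ 2) := by
    apply Real.log_le_log (by positivity)
    nlinarith
  rw [Real.log_mul (by norm_num) (by positivity), Real.log_pow] at h3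
  have h4 : Real.log 5 ≤ 4 := by
    have := Real.log_le_sub_one_of_pos (show (0 : ℝ) < 5 by norm_num)
    linarith
  push_cast at h3
  linarith

lemma pow_lip (k : ℕ) {z w : ℂ} (hz : ‖z‖ ≤ 1) (hw : ‖w‖ ≤ 1) :
    ‖z ^ k - w ^ k‖ ≤ k * ‖z - w‖ := by
  induction k with
  | zero => simp
  | succ k ih =>
    have e : z ^ (k + 1) - w ^ (k + 1) = z * (z ^ k - w ^ k) + (z - w) * w ^ k := by ring
    rw [e]
    refine le_trans (norm_add_le _ _) ?_
    rw [norm_mul, norm_mul, norm_pow]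
    have h1 : ‖z‖ * ‖z ^ k - w ^ k‖ ≤ 1 * ‖z ^ k - w ^ k‖ :=
      mul_le_mul_of_nonneg_right hz (norm_nonneg _)
    have h2 : ‖z - w‖ * ‖w‖ ^ k ≤ ‖z - w‖ * 1 :=
      mul_le_mul_of_nonneg_left (pow_le_one₀ (norm_nonneg _) hw) (norm_nonneg _)
    push_cast
    linarith

lemma S_lip {b : ℕ → ℂ} (hb : ∀ n, ‖b n‖ ≤ 1) (m n : ℕ) (hmn : m ≤ n) {z w : ℂ} (hz : ‖z‖ ≤ 1)
    (hw : ‖w‖ ≤ 1) : ‖S b m z - S b m w‖ ≤ ((n : ℝ) + 1) ^ 2 * ‖z - w‖ := by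
  unfold S
  rw [← Finset.sum_sub_distrib]
  refine le_trans (norm_sum_le _ _) ?_
  have : ∀ k ∈ Finset.range (m + 1), ‖b k * z ^ k - b k * w ^ k‖ ≤ ((n : ℝ) + 1) * ‖z - w‖ := by
    intro k hk
    rw [← mul_sub, norm_mul]
    have h1 := mul_le_mul (hb k) (pow_lip k hz hw) (norm_nonneg _) zero_le_one
    have hk' : k ≤ n := by have := Finset.mem_range.1 hk; omega
    have h2 : (k : ℝ) ≤ (n : ℝ) := by exact_mod_cast hk'
    have := mul_le_mul_of_nonneg_right (show (k : ℝ) ≤ (n : ℝ) + 1 by linarith) (norm_nonneg (z - w))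
    linarith
  refine le_trans (Finset.sum_le_sum this) ?_
  rw [Finset.sum_const, Finset.card_range, nsmul_eq_mul]
  have h2 : (m : ℝ) ≤ (n : ℝ) := by exact_mod_cast hmn
  have h3 : 0 ≤ ((n : ℝ) + 1) * ‖z - w‖ := by positivity
  have := mul_le_mul_of_nonneg_right (show (m : ℝ) + 1 ≤ (n : ℝ) + 1 by linarith) h3
  push_cast
  linarith

lemma T_lip {b : ℕ → ℂ} (hb : ∀ n, ‖b n‖ ≤ 1) (n : ℕ) {z w : ℂ} (hz : ‖z‖ ≤ 1)
    (hw : ‖w‖ ≤ 1) : ‖T b n z - T b n w‖ ≤ ((n : ℝ) + 1) ^ 3 * ‖z - w‖ := by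
  unfold T
  rw [← Finset.sum_sub_distrib]
  refine le_trans (norm_sum_le _ _) ?_
  refine le_trans (Finset.sum_le_sum (fun k hk => S_lip hb k n
    (by have := Finset.mem_range.1 hk; omega) hz hw)) ?_
  rw [Finset.sum_const, Finset.card_range, nsmul_eq_mul]
  push_cast
  apply le_of_eq
  ring

lemma E_dist (t s : X) : ‖E t - E s‖ = ‖E (t - s) - 1‖ := by
  have : E t = E (t - s) * E s := by rw [← E_add]; simp
  rw [this, ← sub_one_mul, norm_mul, E_norm, mul_one]

lemma T_quot {b : ℕ → ℂ} (hb : ∀ n, ‖b n‖ ≤ 1)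
    (hT : ∀ n z, ‖z‖ ≤ 1 → ‖T b n z‖ ≤ n + 1) (n : ℕ) (t s : X) :
    ‖T b n (E t) - T b n (E s)‖ / ‖E t - E s‖ ≤ ((n : ℝ) + 1) * KK n (t - s) := by
  have ht := (E_norm t).le
  have hs := (E_norm s).le
  have h1 : ‖T b n (E t) - T b n (E s)‖ ≤ 2 * ((n : ℝ) + 1) := by
    have := norm_sub_le (T b n (E t)) (T b n (E s))
    have := hT n _ ht
    have := hT n _ hs
    linarith
  have h2 := T_lip hb n ht hs
  unfold KK
  rw [← E_dist]
  set δ := ‖E t - E s‖ with hδ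
  set y := ‖T b n (E t) - T b n (E s)‖ with hy
  have hδ0 : 0 ≤ δ := norm_nonneg _
  have hn : (0 : ℝ) < (n : ℝ) + 1 := by positivity
  rcases hδ0.eq_or_lt with h0 | h0
  · rw [← h0, div_zero]; positivity
  · rw [div_le_iff₀ h0]
    have e : ((n : ℝ) + 1) * (4 / (δ + 2 * (1 / ((n : ℝ) + 1) ^ 2))) * δ =
        (((n : ℝ) + 1) * 4 * δ) / (δ + 2 * (1 / ((n : ℝ) + 1) ^ 2)) := by ring
    rw [e, le_div_iff₀ (by positivity), mul_add]
    have h3 : y * δ ≤ 2 * ((n : ℝ) + 1) * δ := mul_le_mul_of_nonneg_right h1 hδ0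
    have h4 : y * (2 * (1 / ((n : ℝ) + 1) ^ 2)) ≤
        ((n : ℝ) + 1) ^ 3 * δ * (2 * (1 / ((n : ℝ) + 1) ^ 2)) :=
      mul_le_mul_of_nonneg_right h2 (by positivity)
    have h5 : ((n : ℝ) + 1) ^ 3 * δ * (2 * (1 / ((n : ℝ) + 1) ^ 2)) = 2 * ((n : ℝ) + 1) * δ := by
      field_simp
    linarith

variable {α : ℕ → ℝ}

lemma FF_quot (h : Wt α) {b : ℕ → ℂ} (hb : ∀ n, ‖b n‖ ≤ 1)
    (hT : ∀ n z, ‖z‖ ≤ 1 → ‖T b n z‖ ≤ n + 1) (t s : X) :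
    ENNReal.ofReal (‖FF α b (E t) - FF α b (E s)‖ / ‖E t - E s‖) ≤
      ∑' n, ENNReal.ofReal (D α n * ((n : ℝ) + 1)) * ENNReal.ofReal (KK n (t - s)) := by
  have hs : ∀ t : X, Summable (fun n => (D α n : ℂ) * T b n (E t)) := fun t =>
    Summable.of_norm_bounded h.summ_D (fun n => term_le h hT n _ (E_norm t).le)
  unfold FF
  rw [← (hs t).tsum_sub (hs s), div_eq_mul_inv, ENNReal.ofReal_mul (norm_nonneg _),
    ofReal_norm]
  refine le_trans (mul_le_mul_left enorm_tsum_le_tsum_enorm _) ?_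
  rw [← ENNReal.tsum_mul_right]
  apply ENNReal.tsum_le_tsum
  intro n
  rw [← ofReal_norm, ← ENNReal.ofReal_mul (norm_nonneg _),
    ← ENNReal.ofReal_mul (mul_nonneg (h.D_nonneg n) (by positivity))]
  apply ENNReal.ofReal_le_ofReal
  rw [← mul_sub, norm_mul, Complex.norm_real, Real.norm_of_nonneg (h.D_nonneg n), mul_assoc,
    ← div_eq_mul_inv, mul_assoc]
  exact mul_le_mul_of_nonneg_left (T_quot hb hT n t s) (h.D_nonneg n)

lemma KK_meas (n : ℕ) : Measurable fun t => ENNReal.ofReal (KK n t) := by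
  apply ENNReal.measurable_ofReal.comp
  unfold KK
  have := E_cont.measurable
  fun_prop

lemma FF_lint (h : Wt α) {b : ℕ → ℂ} (hb : ∀ n, ‖b n‖ ≤ 1)
    (hT : ∀ n z, ‖z‖ ≤ 1 → ‖T b n z‖ ≤ n + 1) (s : X) :
    ∫⁻ z, ENNReal.ofReal (‖FF α b z - FF α b (E s)‖ / ‖z - E s‖) ∂circleMeasure ≤
      ENNReal.ofReal (24 * nrm α) := by
  refine le_trans (circle_le _) ?_
  refine le_trans (lintegral_mono fun t => FF_quot h hb hT t s) ?_
  rw [lintegral_sub_right_eq_self (fun t => ∑' n, ENNReal.ofReal (D α n * ((n : ℝ) + 1)) *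
    ENNReal.ofReal (KK n t)) s]
  rw [lintegral_tsum (fun n => ((KK_meas n).const_mul _).aemeasurable)]
  apply ENNReal.tsum_le_of_sum_range_le
  intro N
  have hD : ∀ n, 0 ≤ D α n * ((n : ℝ) + 1) := fun n => mul_nonneg (h.D_nonneg n) (by positivity)
  have h1 : ∀ n ∈ Finset.range N, ∫⁻ t, ENNReal.ofReal (D α n * ((n : ℝ) + 1)) *
      ENNReal.ofReal (KK n t) ∂mu ≤ ENNReal.ofReal (12 * (D α n * (((n : ℝ) + 1) * H n))) := by
    intro n _
    rw [lintegral_const_mul' _ _ ENNReal.ofReal_ne_top]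
    refine le_trans (mul_le_mul_right (KK_int n) _) ?_
    rw [← ENNReal.ofReal_mul (hD n)]
    apply ENNReal.ofReal_le_ofReal
    apply le_of_eq
    ring
  refine le_trans (Finset.sum_le_sum h1) ?_
  rw [← ENNReal.ofReal_sum_of_nonneg]
  · apply ENNReal.ofReal_le_ofReal
    rw [← Finset.mul_sum]
    linarith [h.sum_H N]
  · intro n _
    have := H_ge_one n
    have := h.D_nonneg n
    positivity

lemma ae_circle : ∀ᵐ z ∂circleMeasure, ∃ s : X, z = E s := by
  have h : ∀ᵐ z ∂circleMeasure, ‖z‖ = 1 := by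
    unfold circleMeasure
    rw [ae_map_iff (by fun_prop) (measurableSet_eq_fun (by fun_prop) (by fun_prop))]
    exact Eventually.of_forall fun x => Complex.norm_exp_ofReal_mul_I x
  filter_upwards [h] with z hz
  refine ⟨(Complex.arg z : X), ?_⟩
  have := Complex.norm_mul_exp_arg_mul_I z
  rw [hz, Complex.ofReal_one, one_mul] at this
  rw [E_coe, this]

lemma FF_Lam (h : Wt α) {b : ℕ → ℂ} (hb : ∀ n, ‖b n‖ ≤ 1)
    (hT : ∀ n z, ‖z‖ ≤ 1 → ‖T b n z‖ ≤ n + 1) : Lam (FF α b) ≤ ENNReal.ofReal (24 * nrm α) := by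
  unfold Lam
  refine essSup_le_of_ae_le _ ?_
  filter_upwards [ae_circle] with z hz
  obtain ⟨s, rfl⟩ := hz
  exact FF_lint h hb hT s

lemma FF_bdry (h : Wt α) {b : ℕ → ℂ}
    (hT : ∀ n z, ‖z‖ ≤ 1 → ‖T b n z‖ ≤ n + 1) : IsBoundaryFn (FF α b) (FF α b) := by
  unfold IsBoundaryFn
  filter_upwards [ae_circle] with z hz
  obtain ⟨s, rfl⟩ := hz
  have h1 := FF_cont h hT (E s) (by simp [E_norm])
  refine Tendsto.comp h1 ?_
  apply tendsto_nhdsWithin_of_tendsto_nhds_of_eventually_within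
  · have : Continuous fun r : ℝ => (r : ℂ) * E s := by fun_prop
    have h2 := this.tendsto 1
    simp only [Complex.ofReal_one, one_mul] at h2
    exact h2.mono_left nhdsWithin_le_nhds
  · filter_upwards [Ioo_mem_nhdsLT (show (0 : ℝ) < 1 by norm_num)] with r hr
    rw [mem_closedBall_zero_iff, norm_mul, E_norm, mul_one, Complex.norm_real,
      Real.norm_of_nonneg hr.1.le]
    exact hr.2.le

lemma FF_sup (h : Wt α) {b : ℕ → ℂ}
    (hT : ∀ n z, ‖z‖ ≤ 1 → ‖T b n z‖ ≤ n + 1) : eSupAbs (FF α b) ≤ ENNReal.ofReal (nrm α) := by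
  unfold eSupAbs
  refine iSup₂_le fun z hz => ENNReal.ofReal_le_ofReal (FF_norm h hT z ?_)
  exact (mem_ball_zero_iff.1 hz).le

lemma Wt.smul (h : Wt α) {K : ℝ} (hK : 0 ≤ K) : Wt (fun n => K * α n) where
  nonneg n := mul_nonneg hK (h.nonneg n)
  dec n := mul_le_mul_of_nonneg_left (h.dec n) hK
  conv n := by
    have := mul_nonneg hK (h.conv n)
    linarith
  summ := by simpa only [mul_div_assoc] using h.summ.mul_left K

lemma nrm_smul (K : ℝ) : nrm (fun n => K * α n) = K * nrm α := by
  unfold nrm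
  simp only [mul_div_assoc, tsum_mul_left]

end Kis

/-- **Theorem 4.** There is an absolute constant `c₀` such that: for every monotone decreasing,
concave sequence `α` of positive numbers with `‖α‖ = ∑ α_n/(n+1) < ∞` and every `a ∈ ℓ²`,
there exists `f ∈ 𝔑` with `|f̂(n)| ≥ α_n |a_n|` for all `n` and
`‖f‖_𝔑 = ‖f‖_{H^∞} + Λ(f) ≤ c₀ ‖α‖ ‖a‖_{ℓ²}`. -/
theorem exists_frakN_function_with_large_coefficients :
    ∃ c₀ : ℝ, 0 < c₀ ∧
      ∀ α : ℕ → ℝ,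
        (∀ n, 0 < α n) →
        (∀ n, α (n + 1) ≤ α n) →
        (∀ n, 0 ≤ α n - 2 * α (n + 1) + α (n + 2)) →
        (Summable fun n => α n / ((n : ℝ) + 1)) →
        ∀ a : ℕ → ℂ, (Summable fun n => ‖a n‖ ^ 2) →
          ∃ f fs : ℂ → ℂ,
            DifferentiableOn ℂ f (Metric.ball (0 : ℂ) 1) ∧
            IsBoundaryFn f fs ∧
            (∀ n, α n * ‖a n‖ ≤ ‖taylorCoeff f n‖) ∧
            eSupAbs f + Lam fs ≤
              ENNReal.ofReal (c₀ * (∑' n, α n / ((n : ℝ) + 1)) *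
                Real.sqrt (∑' n, ‖a n‖ ^ 2)) := by
  obtain ⟨c, hc, hkis⟩ := Kis.kislyakov
  refine ⟨25 / c, by positivity, ?_⟩
  intro α hpos hdec hconv hsum a ha
  have hW : Kis.Wt α := ⟨fun n => (hpos n).le, hdec, hconv, hsum⟩
  set A := Real.sqrt (∑' n, ‖a n‖ ^ 2) with hA
  have hA0 : 0 ≤ A := Real.sqrt_nonneg _
  have hA2 : A ^ 2 = ∑' n, ‖a n‖ ^ 2 := Real.sq_sqrt (tsum_nonneg fun n => by positivity)
  have hpart : ∀ N, ∑ n ∈ Finset.range N, ‖a n‖ ^ 2 ≤ A ^ 2 := fun N => by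
    rw [hA2]; exact ha.sum_le_tsum _ (fun i _ => by positivity)
  have hle : ∀ n, ‖a n‖ ≤ A := fun n => by
    apply Real.le_sqrt_of_sq_le
    exact ha.le_tsum n (fun i _ => by positivity)
  obtain ⟨b, hb1, hb2, hT⟩ := hkis (fun n => ‖a n‖ / A)
    (fun n => div_nonneg (norm_nonneg _) hA0) (by
      intro N
      simp only [div_pow]
      rw [← Finset.sum_div]
      exact div_le_one_of_le₀ (hpart N) (by positivity))
  have hK : 0 ≤ A / c := by positivity
  have hW' := hW.smul hK
  refine ⟨Kis.FF (fun n => A / c * α n) b, Kis.FF (fun n => A / c * α n) b,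
    Kis.FF_diff hW' hT, Kis.FF_bdry hW' hT, ?_, ?_⟩
  · intro n
    rw [Kis.FF_coeff hW' hb1 hT, norm_mul, Complex.norm_real, Real.norm_of_nonneg (hW'.nonneg n)]
    have h1 := mul_le_mul_of_nonneg_left (hb2 n) (hW'.nonneg n)
    refine le_trans (le_of_eq ?_) h1
    rcases hA0.eq_or_lt with h0 | h0
    · have : ‖a n‖ = 0 := le_antisymm (h0 ▸ hle n) (norm_nonneg _)
      rw [this, ← h0]; simp
    · have := h0.ne'
      have := hc.ne'
      field_simp
  · refine le_trans (add_le_add (Kis.FF_sup hW' hT) (Kis.FF_Lam hW' hb1 hT)) ?_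
    have hn : 0 ≤ Kis.nrm (fun n => A / c * α n) := le_trans (hW'.nonneg 0) hW'.zero_le_nrm
    rw [← ENNReal.ofReal_add hn (by positivity)]
    apply ENNReal.ofReal_le_ofReal
    apply le_of_eq
    rw [Kis.nrm_smul]
    unfold Kis.nrm
    ring
end
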